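/- arXiv:1508.00778 — 3 statements merged into one kernel-verified Lean document; each statement's English description precedes it below -/
import Mathlib

section
/- Let (𝒮,d) be a Busemann surface, let δ > 0, and let S be a compact subset of 𝒮. Then ρ_δ(S) ≤ 19·ν_δ(S), i.e., S can be covered by at most 19 times as many closed balls of radius δ as the maximum number of pairwise disjoint closed balls of radius δ centered at points of S. -/
open Metric Set

section Defs

variable {X : Type*} [MetricSpace X]

/-- `γ` is a geodesic parametrized by arclength on the interval `[0, l]`. -/
def IsGeodesicMap (γ : ℝ → X) (l : ℝ) : Prop :=
  ∀ s ∈ Set.Icc (0 : ℝ) l, ∀ t ∈ Set.Icc (0 : ℝ) l, dist (γ s) (γ t) = |s - t|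

/-- A geodesic metric space: every pair of points is joined by a geodesic. -/
def IsGeodesicSpace (X : Type*) [MetricSpace X] : Prop :=
  ∀ x y : X, ∃ γ : ℝ → X, IsGeodesicMap γ (dist x y) ∧ γ 0 = x ∧ γ (dist x y) = y

/-- A Busemann space: a geodesic metric space in which the distance between
any two (affinely reparametrized) geodesics is convex. -/
def IsBusemannSpace (X : Type*) [MetricSpace X] : Prop :=
  IsGeodesicSpace X ∧
    ∀ (γ γ' : ℝ → X) (l l' : ℝ), 0 ≤ l → 0 ≤ l' →
      IsGeodesicMap γ l → IsGeodesicMap γ' l' →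
        ∀ t ∈ Set.Icc (0 : ℝ) 1,
          dist (γ (t * l)) (γ' (t * l')) ≤
            (1 - t) * dist (γ 0) (γ' 0) + t * dist (γ l) (γ' l')

/-- A Busemann surface: a Busemann space homeomorphic to the Euclidean plane. -/
def IsBusemannSurface (X : Type*) [MetricSpace X] : Prop :=
  IsBusemannSpace X ∧ Nonempty (X ≃ₜ EuclideanSpace ℝ (Fin 2))

/-- The covering number `ρ_δ(S)`: the least number of closed balls of radius `δ`
(centered at arbitrary points of `X`) needed to cover `S`. -/
noncomputable def covNum (δ : ℝ) (S : Set X) : ℕ∞ :=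
  sInf {n : ℕ∞ | ∃ T : Set X, T.encard = n ∧ S ⊆ ⋃ x ∈ T, Metric.closedBall x δ}

/-- The packing number `ν_δ(S)`: the largest cardinality of a subset `P ⊆ S`
whose points are pairwise at distance `> 2δ`. -/
noncomputable def packNum (δ : ℝ) (S : Set X) : ℕ∞ :=
  sSup {n : ℕ∞ | ∃ P : Set X, P ⊆ S ∧ P.encard = n ∧
    P.Pairwise fun p q => 2 * δ < dist p q}

/-- The geodesic segment `[x,y]` in a (uniquely geodesic) metric space. -/
def seg (x y : X) : Set X := {z | dist x z + dist z y = dist x y}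

/-- A set is (geodesically) convex if it contains the segment between any two of its points. -/
def GConvex (C : Set X) : Prop := ∀ x ∈ C, ∀ y ∈ C, seg x y ⊆ C

/-- The (geodesic) convex hull of a set. -/
def gHull (Q : Set X) : Set X := ⋂₀ {C : Set X | GConvex C ∧ Q ⊆ C}

/-- The triangle `Δ(x,y,z)`: the convex hull of `{x,y,z}`. -/
def triangleG (x y z : X) : Set X := gHull {x, y, z}

/-- The perimeter `π(a,b,c)` of a triangle. -/
def perim (a b c : X) : ℝ := dist a b + dist b c + dist c a

/-- Three points are collinear if one lies on the geodesic segment between the other two. -/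
def CollinearPts (a b c : X) : Prop := b ∈ seg a c ∨ a ∈ seg b c ∨ c ∈ seg a b

/-- A geodesic line: the image of an isometric embedding of `ℝ`. -/
def IsGeodesicLine (L : Set X) : Prop := ∃ γ : ℝ → X, Isometry γ ∧ L = Set.range γ

/-- A closed halfplane determined by the line `L`: the union of `L` with a
connected component of its complement. -/
def IsHalfplane (L H : Set X) : Prop :=
  ∃ p, p ∉ L ∧ H = connectedComponentIn Lᶜ p ∪ L

/-- The line `L` separates `A` from `B`: they lie in different closed halfplanes of `L`. -/
def LineSep (L A B : Set X) : Prop :=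
  ∃ H₁ H₂ : Set X, IsHalfplane L H₁ ∧ IsHalfplane L H₂ ∧ H₁ ≠ H₂ ∧ A ⊆ H₁ ∧ B ⊆ H₂

/-- The shade `Sh_u(x,y)` of the segment `[x,y]` with respect to `u`. -/
def Shade (u x y : X) : Set X :=
  {p | (seg u p ∩ seg x y).Nonempty ∧
    ∃ L : Set X, IsGeodesicLine L ∧ u ∈ L ∧ p ∈ L ∧ LineSep L {x} {y}}

/-- The shade `St_u(x,y,z)` of the triangle `Δ(x,y,z)` with respect to `u`. -/
def TriShade (u x y z : X) : Set X := Shade u x y ∪ Shade u y z ∪ Shade u z x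

end Defs


open Metric Set

set_option linter.unusedSectionVars false

namespace BS

/-- The data of a Busemann surface, with a fixed planar chart. -/
class Surf (X : Type*) [MetricSpace X] where
  bus : IsBusemannSpace X
  f : X → ℂ
  f_cont : Continuous f
  f_inj : Function.Injective f
  lc : LocallyCompactSpace X

section Met

variable {X : Type*} [MetricSpace X]

open Classical in
/-- The point dividing the segment from `x` to `y` in ratio `t : 1 - t`. -/
noncomputable def pt (x y : X) (t : ℝ) : X :=
  if h : ∃ γ : ℝ → X, IsGeodesicMap γ (dist x y) ∧ γ 0 = x ∧ γ (dist x y) = y then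
    h.choose (t * dist x y) else x

variable [Surf X]

lemma pt_spec (x y : X) : ∃ γ : ℝ → X, IsGeodesicMap γ (dist x y) ∧ γ 0 = x ∧ γ (dist x y) = y ∧
    ∀ t, pt x y t = γ (t * dist x y) := by
  have h := (Surf.bus (X := X)).1 x y
  refine ⟨h.choose, h.choose_spec.1, h.choose_spec.2.1, h.choose_spec.2.2, fun t => ?_⟩
  rw [pt, dif_pos h]

@[simp] lemma pt_zero (x y : X) : pt x y 0 = x := by
  obtain ⟨γ, _, h0, _, h⟩ := pt_spec x y
  simp [h, h0]

@[simp] lemma pt_one (x y : X) : pt x y 1 = y := by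
  obtain ⟨γ, _, _, h1, h⟩ := pt_spec x y
  simp [h, h1]

lemma mul_mem {t d : ℝ} (ht : t ∈ Icc (0:ℝ) 1) (hd : 0 ≤ d) : t * d ∈ Icc (0:ℝ) d :=
  ⟨mul_nonneg ht.1 hd, by nlinarith [ht.2]⟩

lemma dist_pt_pt (x y : X) {s t : ℝ} (hs : s ∈ Icc (0:ℝ) 1) (ht : t ∈ Icc (0:ℝ) 1) :
    dist (pt x y s) (pt x y t) = |s - t| * dist x y := by
  obtain ⟨γ, hg, _, _, h⟩ := pt_spec x y
  rw [h, h, hg _ (mul_mem hs dist_nonneg) _ (mul_mem ht dist_nonneg), ← sub_mul, abs_mul,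
    abs_of_nonneg (dist_nonneg (x := x) (y := y))]

lemma mem0 : (0:ℝ) ∈ Icc (0:ℝ) 1 := by constructor <;> norm_num
lemma mem1 : (1:ℝ) ∈ Icc (0:ℝ) 1 := by constructor <;> norm_num
lemma mem_half : (1/2:ℝ) ∈ Icc (0:ℝ) 1 := by constructor <;> norm_num

lemma dist_left_pt (x y : X) {t : ℝ} (ht : t ∈ Icc (0:ℝ) 1) : dist x (pt x y t) = t * dist x y := by
  have := dist_pt_pt x y mem0 ht
  simpa [abs_of_nonneg ht.1] using this

lemma dist_pt_right (x y : X) {t : ℝ} (ht : t ∈ Icc (0:ℝ) 1) :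
    dist (pt x y t) y = (1 - t) * dist x y := by
  have := dist_pt_pt x y ht mem1
  rw [pt_one, abs_sub_comm, abs_of_nonneg (by linarith [ht.2])] at this
  exact this

lemma busemann (x y x' y' : X) {t : ℝ} (ht : t ∈ Icc (0:ℝ) 1) :
    dist (pt x y t) (pt x' y' t) ≤ (1 - t) * dist x x' + t * dist y y' := by
  obtain ⟨γ, hg, h0, h1, h⟩ := pt_spec x y
  obtain ⟨γ', hg', h0', h1', h'⟩ := pt_spec x' y'
  have := (Surf.bus (X := X)).2 γ γ' _ _ dist_nonneg dist_nonneg hg hg' t ht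
  rwa [h0, h0', h1, h1', ← h, ← h'] at this

@[simp] lemma pt_self (x : X) {t : ℝ} : pt x x t = x := by
  obtain ⟨γ, hg, h0, h1, h⟩ := pt_spec x x
  rw [h]; simp [h0]

lemma pt_unique {x y q : X} {t : ℝ} (ht : t ∈ Icc (0:ℝ) 1) (h1 : dist x q = t * dist x y)
    (h2 : dist q y = (1 - t) * dist x y) : q = pt x y t := by
  obtain ⟨γ, hg, g0, g1, g⟩ := pt_spec x y
  obtain ⟨α, ha, a0, a1, -⟩ := pt_spec x q
  obtain ⟨β, hb, b0, b1, -⟩ := pt_spec q y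
  set d := dist x y with hd
  have hd0 : 0 ≤ d := dist_nonneg
  set m := dist x q with hm
  have hm0 : 0 ≤ m := dist_nonneg
  have hmd : dist q y = d - m := by rw [h2, h1]; ring
  have hmd0 : 0 ≤ d - m := hmd ▸ dist_nonneg
  rw [hmd] at hb b1
  let η : ℝ → X := fun u => if u ≤ m then α u else β (u - m)
  have key : ∀ s ∈ Icc (0:ℝ) d, ∀ t ∈ Icc (0:ℝ) d, s ≤ m → m < t → dist (α s) (β (t - m)) = t - s := by
    intro s hs t ht hsm hmt
    have e1 : dist x (α s) = s := by
      rw [← a0, ha 0 ⟨le_rfl, hm0⟩ s ⟨hs.1, hsm⟩]; rw [zero_sub, abs_neg, abs_of_nonneg hs.1]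
    have e2 : dist (α s) q = m - s := by
      conv_lhs => rw [← a1]
      rw [ha s ⟨hs.1, hsm⟩ m ⟨hm0, le_rfl⟩, abs_sub_comm, abs_of_nonneg (by linarith)]
    have e3 : dist q (β (t - m)) = t - m := by
      rw [← b0, hb 0 ⟨le_rfl, hmd0⟩ (t - m) ⟨by linarith, by linarith [ht.2]⟩]
      rw [zero_sub, abs_neg, abs_of_nonneg (by linarith)]
    have e4 : dist (β (t - m)) y = d - t := by
      conv_lhs => rw [← b1]
      rw [hb _ ⟨by linarith, by linarith [ht.2]⟩ _ ⟨hmd0, le_rfl⟩, abs_sub_comm, abs_of_nonneg (by linarith [ht.2])]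
      ring
    have t1 := dist_triangle (α s) q (β (t - m))
    have t2 := dist_triangle x (α s) y
    have t3 := dist_triangle (α s) (β (t - m)) y
    linarith
  have hη : IsGeodesicMap η d := by
    intro s hs t ht
    by_cases h1 : s ≤ m <;> by_cases h2 : t ≤ m
    · simp only [η, h1, h2, if_true]; exact ha s ⟨hs.1, h1⟩ t ⟨ht.1, h2⟩
    · simp only [η, h1, h2, if_true, if_false]; push Not at h2
      rw [key s hs t ht h1 h2, abs_sub_comm, abs_of_nonneg (by linarith)]
    · simp only [η, h1, h2, if_true, if_false]; push Not at h1
      rw [dist_comm, key t ht s hs h2 h1, abs_of_nonneg (by linarith)]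
    · simp only [η, h1, h2, if_false]; push Not at h1 h2
      rw [hb _ ⟨by linarith, by linarith [hs.2]⟩ _ ⟨by linarith, by linarith [ht.2]⟩]
      congr 1; ring
  have hη0 : η 0 = x := by simp [η, hm0, a0]
  have hηd : η d = y := by
    by_cases h : d ≤ m
    · have e : d = m := by linarith
      have : dist q y = 0 := by rw [hmd, e]; ring
      change (if d ≤ m then α d else β (d - m)) = y
      rw [if_pos h, e, a1]
      exact dist_eq_zero.1 this
    · simp only [η, h, if_false, b1]
  have hηm : η (t * d) = q := by
    rw [← h1]; simp [η, a1]
  have := (Surf.bus (X := X)).2 η γ _ _ hd0 hd0 hη hg t ht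
  rw [hη0, g0, hηd, g1, dist_self, dist_self, hηm, ← g] at this
  exact dist_le_zero.1 (by linarith)

lemma mem_seg_iff {x y q : X} : q ∈ seg x y ↔ ∃ t ∈ Icc (0:ℝ) 1, q = pt x y t := by
  constructor
  · intro h
    change dist x q + dist q y = dist x y at h
    by_cases h0 : dist x y = 0
    · have hx : dist x q = 0 := by linarith [dist_nonneg (x := x) (y := q), dist_nonneg (x := q) (y := y)]
      exact ⟨0, mem0, by rw [pt_zero]; exact (dist_eq_zero.1 hx).symm⟩
    · have hpos : 0 < dist x y := lt_of_le_of_ne dist_nonneg (Ne.symm h0)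
      have ht : dist x q / dist x y ∈ Icc (0:ℝ) 1 :=
        ⟨by positivity, by rw [div_le_one hpos]; linarith [dist_nonneg (x := q) (y := y)]⟩
      refine ⟨_, ht, pt_unique ht (by field_simp) ?_⟩
      rw [sub_mul, div_mul_cancel₀ _ h0]; linarith
  · rintro ⟨t, ht, rfl⟩
    change _ + _ = _
    rw [dist_left_pt x y ht, dist_pt_right x y ht]; ring

lemma pt_mem_seg (x y : X) {t : ℝ} (ht : t ∈ Icc (0:ℝ) 1) : pt x y t ∈ seg x y :=
  mem_seg_iff.2 ⟨t, ht, rfl⟩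

lemma seg_comm (x y : X) : seg x y = seg y x := by
  ext q; simp only [seg, mem_ofPred_eq, dist_comm x q, dist_comm q y, dist_comm x y]
  rw [add_comm]

lemma left_mem (x y : X) : x ∈ seg x y := by simp [seg]
lemma right_mem (x y : X) : y ∈ seg x y := by simp [seg]

lemma seg_self {x q : X} (h : q ∈ seg x x) : q = x := by
  simp only [seg, mem_ofPred_eq, dist_self] at h
  rw [dist_comm q x] at h
  exact (dist_eq_zero.1 (by linarith [dist_nonneg (x := x) (y := q)])).symm

lemma one_sub_mem {t : ℝ} (ht : t ∈ Icc (0:ℝ) 1) : 1 - t ∈ Icc (0:ℝ) 1 :=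
  ⟨by linarith [ht.2], by linarith [ht.1]⟩

lemma pt_symm (x y : X) {t : ℝ} (ht : t ∈ Icc (0:ℝ) 1) : pt y x (1 - t) = pt x y t := by
  apply pt_unique ht
  · rw [dist_comm, dist_pt_right y x (one_sub_mem ht), dist_comm x y]; ring
  · rw [dist_comm, dist_left_pt y x (one_sub_mem ht), dist_comm x y]

lemma dist_pt_le (o x y : X) {t : ℝ} (ht : t ∈ Icc (0:ℝ) 1) :
    dist o (pt x y t) ≤ (1 - t) * dist o x + t * dist o y := by
  have := busemann o o x y ht
  rwa [pt_self] at this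

lemma dist_seg_le {o x y q : X} {r : ℝ} (hq : q ∈ seg x y) (hx : dist o x ≤ r) (hy : dist o y ≤ r) :
    dist o q ≤ r := by
  obtain ⟨t, ht, rfl⟩ := mem_seg_iff.1 hq
  have := dist_pt_le o x y ht
  nlinarith [ht.1, ht.2]

lemma dist_seg_lt {o x y q : X} {r : ℝ} (hq : q ∈ seg x y) (hx : dist o x < r) (hy : dist o y < r) :
    dist o q < r := 
  lt_of_le_of_lt (dist_seg_le hq (le_max_left _ _) (le_max_right _ _)) (max_lt hx hy)

/-- sub-segments -/
lemma seg_trans {x y p q : X} (hp : p ∈ seg x y) (hq : q ∈ seg x p) : q ∈ seg x y := by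
  simp only [seg, mem_ofPred_eq] at *
  linarith [dist_triangle q p y, dist_triangle x q y]

lemma seg_trans_right {x y p q : X} (hp : p ∈ seg x y) (hq : q ∈ seg x p) : p ∈ seg q y := by
  simp only [seg, mem_ofPred_eq] at *
  linarith [dist_triangle q p y, dist_triangle x q y]

/-- two points on a segment are ordered -/
lemma seg_total {x y p q : X} (hp : p ∈ seg x y) (hq : q ∈ seg x y) : q ∈ seg x p ∨ p ∈ seg x q := by
  obtain ⟨s, hs, rfl⟩ := mem_seg_iff.1 hp
  obtain ⟨t, ht, rfl⟩ := mem_seg_iff.1 hq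
  simp only [seg, mem_ofPred_eq, dist_left_pt x y hs, dist_left_pt x y ht, dist_pt_pt x y hs ht,
    dist_pt_pt x y ht hs]
  rcases le_total s t with h | h
  · right; rw [abs_of_nonpos (by linarith)]; ring
  · left; rw [abs_of_nonpos (by linarith)]; ring

lemma seg_sub {x y p q : X} (hp : p ∈ seg x y) (hq : q ∈ seg x y) : seg p q ⊆ seg x y := by
  intro r hr
  rcases seg_total hp hq with h | h
  · have h1 : r ∈ seg p x := seg_trans (by rw [seg_comm]; exact h) hr
    rw [seg_comm] at h1
    exact seg_trans hp h1
  · have h1 : r ∈ seg q x := seg_trans (by rw [seg_comm]; exact h) (by rwa [seg_comm])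
    rw [seg_comm] at h1
    exact seg_trans hq h1

lemma pt_cont : Continuous fun p : X × X × unitInterval => pt p.1 p.2.1 p.2.2 := by
  rw [continuous_iff_continuousAt]
  rintro ⟨x, y, t⟩
  rw [ContinuousAt, tendsto_iff_dist_tendsto_zero]
  have hb : ∀ p : X × X × unitInterval, dist (pt p.1 p.2.1 p.2.2) (pt x y t) ≤
      dist p.1 x + dist p.2.1 y + |(p.2.2 : ℝ) - t| * dist x y := by
    rintro ⟨x', y', t'⟩
    have h1 := busemann x' y' x y t'.2
    have h2 := dist_pt_pt x y t'.2 t.2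
    have h3 := dist_triangle (pt x' y' t') (pt x y t') (pt x y t)
    have h4 := t'.2.1
    have h5 := t'.2.2
    simp only
    nlinarith [dist_nonneg (x := x') (y := x), dist_nonneg (x := y') (y := y)]
  have hc : Continuous fun p : X × X × unitInterval => dist p.1 x + dist p.2.1 y + |(p.2.2 : ℝ) - t| * dist x y := by
    fun_prop
  have := hc.tendsto (x, y, t)
  simp only [dist_self, sub_self, abs_zero, zero_mul, add_zero] at this
  exact squeeze_zero (fun _ => dist_nonneg) hb this

end Met
end BS

open Metric Set
set_option linter.unusedSectionVars false

namespace BS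
section Wind

open unitInterval

lemma exists_log (F : I × I → ℂ) (hF : Continuous F) (h0 : ∀ a, F a ≠ 0) :
    ∃ L : I × I → ℂ, Continuous L ∧ ∀ a, Complex.exp (L a) = F a := by
  let π : ℝ × ℝ → I × I := fun p => (projIcc 0 1 zero_le_one p.1, projIcc 0 1 zero_le_one p.2)
  have hπ : Continuous π := by
    have : Continuous (projIcc (0:ℝ) 1 zero_le_one) := continuous_projIcc
    fun_prop
  let G : C(ℝ × ℝ, {z : ℂ // z ≠ 0}) := ⟨fun a => ⟨F (π a), h0 _⟩, by fun_prop⟩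
  obtain ⟨L, ⟨-, hL⟩, -⟩ := Complex.isCoveringMap_exp.existsUnique_continuousMap_lifts G (0, 0)
    (Complex.log (F (π (0, 0)))) (Subtype.ext (Complex.exp_log (h0 _)))
  refine ⟨fun p => L (p.1, p.2), by fun_prop, fun a => ?_⟩
  have := congrArg Subtype.val (congrFun hL (a.1, a.2))
  simp only [Function.comp] at this
  rw [this]
  simp [G, π]

lemma log_unique {L L' : I → ℂ} (h : Continuous L) (h' : Continuous L')
    (he : ∀ t, Complex.exp (L t) = Complex.exp (L' t)) : L 1 - L 0 = L' 1 - L' 0 := by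
  have key := Complex.isCoveringMap_exp.eq_of_comp_eq (A := I) (g₁ := L)
    (g₂ := fun t => L' t + (L 0 - L' 0)) h (by fun_prop) (by
      funext t
      apply Subtype.ext
      simp only [Function.comp]
      rw [Complex.exp_add, Complex.exp_sub, he 0, he t, div_self (Complex.exp_ne_zero _), mul_one])
      0 (by ring)
  have := congrFun key 1
  rw [this]; ring

open Classical in
/-- The increment of a continuous logarithm along a path. -/
noncomputable def inc (g : I → ℂ) : ℂ :=
  if h : ∃ L : I → ℂ, Continuous L ∧ ∀ t, Complex.exp (L t) = g t then h.choose 1 - h.choose 0 else 0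

lemma inc_eq {g L : I → ℂ} (hL : Continuous L) (h : ∀ t, Complex.exp (L t) = g t) :
    inc g = L 1 - L 0 := by
  have hex : ∃ L : I → ℂ, Continuous L ∧ ∀ t, Complex.exp (L t) = g t := ⟨L, hL, h⟩
  rw [inc, dif_pos hex]
  exact log_unique hex.choose_spec.1 hL (fun t => by rw [hex.choose_spec.2, h])

lemma exists_log1 {g : I → ℂ} (hg : Continuous g) (h0 : ∀ t, g t ≠ 0) :
    ∃ L : I → ℂ, Continuous L ∧ ∀ t, Complex.exp (L t) = g t := by
  obtain ⟨L, h1, h2⟩ := exists_log (fun p => g p.1) (by fun_prop) (fun _ => h0 _)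
  exact ⟨fun t => L (t, 0), by fun_prop, fun t => h2 _⟩

lemma exp_inc {g : I → ℂ} (hg : Continuous g) (h0 : ∀ t, g t ≠ 0) :
    Complex.exp (inc g) = g 1 / g 0 := by
  obtain ⟨L, h1, h2⟩ := exists_log1 hg h0
  rw [inc_eq h1 h2, Complex.exp_sub, h2, h2]

lemma inc_const (c : ℂ) (hc : c ≠ 0) : inc (fun _ => c) = 0 := by
  rw [inc_eq (L := fun _ => Complex.log c) continuous_const (fun _ => Complex.exp_log hc), sub_self]

lemma inc_neg {g : I → ℂ} (hg : Continuous g) (h0 : ∀ t, g t ≠ 0) :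
    inc (fun t => - g t) = inc g := by
  obtain ⟨L, h1, h2⟩ := exists_log1 hg h0
  rw [inc_eq h1 h2, inc_eq (L := fun t => L t + Real.pi * Complex.I) (by fun_prop)]
  · ring
  · intro t; rw [Complex.exp_add, h2, Complex.exp_pi_mul_I]; ring

lemma inc_symm {g : I → ℂ} (hg : Continuous g) (h0 : ∀ t, g t ≠ 0) :
    inc (fun t => g (σ t)) = - inc g := by
  obtain ⟨L, h1, h2⟩ := exists_log1 hg h0
  rw [inc_eq h1 h2, inc_eq (L := fun t => L (σ t)) (by fun_prop) (fun t => h2 _)]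
  simp

lemma inc_rect (F : I × I → ℂ) (hF : Continuous F) (h0 : ∀ a, F a ≠ 0) :
    inc (fun s => F (s, 0)) + inc (fun t => F (1, t)) =
      inc (fun t => F (0, t)) + inc (fun s => F (s, 1)) := by
  obtain ⟨L, h1, h2⟩ := exists_log F hF h0
  rw [inc_eq (L := fun s => L (s, 0)) (by fun_prop) (fun _ => h2 _),
    inc_eq (L := fun s => L (1, s)) (by fun_prop) (fun _ => h2 _),
    inc_eq (L := fun s => L (0, s)) (by fun_prop) (fun _ => h2 _),
    inc_eq (L := fun s => L (s, 1)) (by fun_prop) (fun _ => h2 _)]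
  ring

variable {X : Type*} [MetricSpace X] [Surf X]

/-- Winding increment of the segment `[a, b]` seen from `p`. -/
noncomputable def W (p a b : X) : ℂ :=
  inc (fun t : I => Surf.f (pt a b t) - Surf.f p)

/-- the triangle over `[a,b]` coned from `z` -/
def cone (z a b : X) : Set X := {p | ∃ q ∈ seg a b, p ∈ seg z q}

lemma fpt_cont (a b : X) : Continuous fun t : I => Surf.f (pt a b t) :=
  Surf.f_cont.comp (pt_cont.comp (by fun_prop : Continuous fun t : I => (a, b, t)))

lemma fW_cont (p a b : X) : Continuous fun t : I => Surf.f (pt a b t) - Surf.f p :=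
  (fpt_cont a b).sub continuous_const

lemma f_sub_ne {x y : X} (h : x ≠ y) : Surf.f x - Surf.f y ≠ 0 :=
  sub_ne_zero.2 (fun e => h (Surf.f_inj e))

lemma W_ne {p a b : X} (h : p ∉ seg a b) (t : I) : Surf.f (pt a b t) - Surf.f p ≠ 0 :=
  f_sub_ne (fun e => h (e ▸ pt_mem_seg a b t.2))

lemma W1 {p a b : X} (h : p ∉ seg a b) :
    Complex.exp (W p a b) = (Surf.f b - Surf.f p) / (Surf.f a - Surf.f p) := by
  rw [W, exp_inc (fW_cont p a b) (W_ne h)]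
  simp

lemma W2 {p a b : X} (h : p ∉ seg a b) : W p b a = - W p a b := by
  rw [W, W, ← inc_symm (fW_cont p a b) (W_ne h)]
  congr 1
  funext t
  rw [unitInterval.coe_symm_eq, pt_symm b a t.2]

lemma W3 {p z a b : X} (h : p ∉ cone z a b) : W p z a + W p a b = W p z b := by
  have h1 : ∀ s t : I, pt z (pt a b s) t ≠ p := fun s t e =>
    h ⟨_, pt_mem_seg a b s.2, e ▸ pt_mem_seg z _ t.2⟩
  have := inc_rect (fun q : I × I => Surf.f (pt z (pt a b q.1) q.2) - Surf.f p)
    ((Surf.f_cont.comp (pt_cont.comp (by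
      have : Continuous fun q : I × I => pt a b q.1 :=
        pt_cont.comp (by fun_prop : Continuous fun q : I × I => (a, b, q.1))
      fun_prop : Continuous fun q : I × I => (z, pt a b q.1, q.2)))).sub continuous_const)
    (fun q => f_sub_ne (h1 _ _))
  simp only [Icc.coe_zero, Icc.coe_one, pt_zero, pt_one] at this
  rw [inc_const _ (f_sub_ne (by simpa using h1 0 0)), zero_add] at this
  exact this.symm

lemma W4 {a b c d : X} (h : Disjoint (seg a b) (seg c d)) :
    W c a b + W b c d = W a c d + W d a b := by
  rw [Set.disjoint_left] at h
  have h1 : ∀ s t : I, pt a b s ≠ pt c d t := fun s t e =>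
    h (pt_mem_seg a b s.2) (e ▸ pt_mem_seg c d t.2)
  have := inc_rect (fun q : I × I => Surf.f (pt a b q.1) - Surf.f (pt c d q.2))
    (((fpt_cont a b).comp continuous_fst).sub ((fpt_cont c d).comp continuous_snd))
    (fun q => f_sub_ne (h1 _ _))
  simp only [Icc.coe_zero, Icc.coe_one, pt_zero, pt_one] at this
  have e1 : W b c d = inc (fun t : I => Surf.f b - Surf.f (pt c d t)) := by
    rw [W, ← inc_neg (fW_cont b c d) (W_ne (h (right_mem a b)))]
    congr 1; funext t; ring
  have e2 : W a c d = inc (fun t : I => Surf.f a - Surf.f (pt c d t)) := by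
    rw [W, ← inc_neg (fW_cont a c d) (W_ne (h (left_mem a b)))]
    congr 1; funext t; ring
  rw [e1, e2]
  exact this

end Wind
end BS

open Metric Set
set_option linter.unusedSectionVars false

namespace BS
section Radon

variable {X : Type*} [MetricSpace X] [Surf X]

lemma triple_exp {a b c : X} (h1 : a ∉ seg b c) (h2 : b ∉ seg c a) (h3 : c ∉ seg a b) :
    Complex.exp (W a b c + W b c a + W c a b) = -1 := by
  rw [Complex.exp_add, Complex.exp_add, W1 h1, W1 h2, W1 h3]
  have e1 := f_sub_ne (X := X) (x := b) (y := a) (fun e => h1 (e ▸ left_mem _ _))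
  have e2 := f_sub_ne (X := X) (x := c) (y := b) (fun e => h2 (e ▸ left_mem _ _))
  have e3 := f_sub_ne (X := X) (x := a) (y := c) (fun e => h3 (e ▸ left_mem _ _))
  field_simp
  ring

/-- generic position of `o` w.r.t. the triangle `a b c` -/
structure Gen (o a b c : X) : Prop where
  d1 : Disjoint (seg o a) (seg b c)
  d2 : Disjoint (seg o b) (seg c a)
  d3 : Disjoint (seg o c) (seg a b)
  k1 : a ∉ cone o b c
  k2 : b ∉ cone o c a
  k3 : c ∉ cone o a b

lemma Gen.rot {o a b c : X} (h : Gen o a b c) : Gen o b c a :=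
  ⟨h.d2, h.d3, h.d1, h.k2, h.k3, h.k1⟩

lemma Gen.sum_ne {o a b c : X} (h : Gen o a b c) : W o a b + W o b c + W o c a ≠ 0 := by
  have e1 := W4 h.d1
  have e2 := W4 h.d2
  have e3 := W4 h.d3
  have f1 := W3 h.k1
  have f2 := W3 h.k2
  have f3 := W3 h.k3
  have hs : W o a b + W o b c + W o c a = 2 * (W a b c + W b c a + W c a b) := by
    linear_combination -e1 - e2 - e3 - f1 - f2 - f3
  intro h0
  rw [hs] at h0
  have h1 : W a b c + W b c a + W c a b = 0 := by simpa using h0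
  have h2 := triple_exp (Set.disjoint_left.1 h.d1 (right_mem _ _))
    (Set.disjoint_left.1 h.d2 (right_mem _ _)) (Set.disjoint_left.1 h.d3 (right_mem _ _))
  rw [h1, Complex.exp_zero] at h2
  norm_num at h2

lemma Gen.mem_cone {o a b c : X} (h : Gen o a b c) : o ∈ cone a b c := by
  by_contra hn
  apply h.sum_ne
  have e1 := W3 hn
  have e2 := W2 (Set.disjoint_left.1 h.d2 (left_mem _ _))
  linear_combination e1 + e2

/-- comparability -/
lemma Gen.comp {o a b c : X} (h : Gen o a b c) (y : X) :
    ∃ p, (p ∈ seg a b ∨ p ∈ seg b c ∨ p ∈ seg c a) ∧ (y ∈ seg o p ∨ p ∈ seg o y) := by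
  by_contra hn
  push Not at hn
  have hd : ∀ u v : X, (∀ p ∈ seg u v, (p ∈ seg a b ∨ p ∈ seg b c ∨ p ∈ seg c a)) →
      Disjoint (seg o y) (seg u v) ∧ y ∉ cone o u v := by
    intro u v huv
    constructor
    · rw [Set.disjoint_left]
      intro q h1 h2
      exact (hn q (huv q h2)).2 h1
    · rintro ⟨q, h1, h2⟩
      exact (hn q (huv q h1)).1 h2
  obtain ⟨d1, k1⟩ := hd a b (by tauto)
  obtain ⟨d2, k2⟩ := hd b c (by tauto)
  obtain ⟨d3, k3⟩ := hd c a (by tauto)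
  apply h.sum_ne
  linear_combination -(W4 d1) - (W4 d2) - (W4 d3) + W3 k1 + W3 k2 + W3 k3

/-- Radon-type theorem. -/
lemma radon (o a b c : X) : ∃ q, ∀ K : Set X, GConvex K →
    (a ∈ K → b ∈ K → c ∈ K → q ∈ K) ∧ (o ∈ K → b ∈ K → c ∈ K → q ∈ K) ∧
    (o ∈ K → a ∈ K → c ∈ K → q ∈ K) ∧ (o ∈ K → a ∈ K → b ∈ K → q ∈ K) := by
  have cr : ∀ u v x y q : X, q ∈ seg u v → q ∈ seg x y → ∀ K : Set X, GConvex K →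
    (v ∈ K → x ∈ K → y ∈ K → q ∈ K) ∧ (u ∈ K → x ∈ K → y ∈ K → q ∈ K) ∧
    (u ∈ K → v ∈ K → y ∈ K → q ∈ K) ∧ (u ∈ K → v ∈ K → x ∈ K → q ∈ K) := by
    intro u v x y q h1 h2 K hK
    exact ⟨fun _ hx hy => hK x hx y hy h2, fun _ hx hy => hK x hx y hy h2,
      fun hu hv _ => hK u hu v hv h1, fun hu hv _ => hK u hu v hv h1⟩
  have co : ∀ u v x q : X, q ∈ cone u v x → ∀ K : Set X, GConvex K → u ∈ K → v ∈ K → x ∈ K → q ∈ K := by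
    rintro u v x q ⟨r, h1, h2⟩ K hK hu hv hx
    exact hK u hu r (hK v hv x hx h1) h2
  by_cases d1 : Disjoint (seg o a) (seg b c)
  swap
  · obtain ⟨q, h1, h2⟩ := Set.not_disjoint_iff.1 d1
    exact ⟨q, fun K hK => by have := cr _ _ _ _ q h1 h2 K hK; tauto⟩
  by_cases d2 : Disjoint (seg o b) (seg c a)
  swap
  · obtain ⟨q, h1, h2⟩ := Set.not_disjoint_iff.1 d2
    exact ⟨q, fun K hK => by have := cr _ _ _ _ q h1 h2 K hK; tauto⟩
  by_cases d3 : Disjoint (seg o c) (seg a b)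
  swap
  · obtain ⟨q, h1, h2⟩ := Set.not_disjoint_iff.1 d3
    exact ⟨q, fun K hK => by have := cr _ _ _ _ q h1 h2 K hK; tauto⟩
  by_cases k1 : a ∉ cone o b c
  swap
  · push Not at k1
    exact ⟨a, fun K hK => by have := co _ _ _ _ k1 K hK; tauto⟩
  by_cases k2 : b ∉ cone o c a
  swap
  · push Not at k2
    exact ⟨b, fun K hK => by have := co _ _ _ _ k2 K hK; tauto⟩
  by_cases k3 : c ∉ cone o a b
  swap
  · push Not at k3
    exact ⟨c, fun K hK => by have := co _ _ _ _ k3 K hK; tauto⟩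
  exact ⟨o, fun K hK => by
    have := co _ _ _ _ (Gen.mem_cone ⟨d1, d2, d3, k1, k2, k3⟩) K hK; tauto⟩

lemma helly {ι : Type*} (C : ι → Set X) (hC : ∀ i, GConvex (C i)) (n : ℕ) : ∀ s : Finset ι, s.card = n →
    s.Nonempty → (∀ i ∈ s, ∀ j ∈ s, ∀ k ∈ s, ∃ p, p ∈ C i ∧ p ∈ C j ∧ p ∈ C k) → ∃ p, ∀ i ∈ s, p ∈ C i := by
  classical
  induction n with
  | zero => intro s hs hne; simp at hs; simp [hs] at hne
  | succ n ih =>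
    intro s hs hne h3
    obtain ⟨i, hi⟩ := hne
    have hi' : (s.erase i).card = n := by rw [Finset.card_erase_of_mem hi, hs]; rfl
    by_cases hn : 2 < n
    swap
    · have : ∃ j ∈ s, ∃ k ∈ s, ∀ l ∈ s, l = i ∨ l = j ∨ l = k := by
        rcases (by omega : n = 0 ∨ n = 1 ∨ n = 2) with h | h | h
        · refine ⟨i, hi, i, hi, fun l hl => ?_⟩
          rw [h, Finset.card_eq_zero] at hi'
          by_contra hc; push Not at hc
          have : l ∈ s.erase i := Finset.mem_erase.2 ⟨hc.1, hl⟩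
          simp [hi'] at this
        · rw [h, Finset.card_eq_one] at hi'
          obtain ⟨j, hj⟩ := hi'
          have hjs : j ∈ s.erase i := by simp [hj]
          refine ⟨j, Finset.mem_of_mem_erase hjs, j, Finset.mem_of_mem_erase hjs, fun l hl => ?_⟩
          by_contra hc; push Not at hc
          have : l ∈ s.erase i := Finset.mem_erase.2 ⟨hc.1, hl⟩
          simp [hj, hc] at this
        · rw [h, Finset.card_eq_two] at hi'
          obtain ⟨j, k, -, hj⟩ := hi'
          have hjs : j ∈ s.erase i := by simp [hj]
          have hks : k ∈ s.erase i := by simp [hj]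
          refine ⟨j, Finset.mem_of_mem_erase hjs, k, Finset.mem_of_mem_erase hks, fun l hl => ?_⟩
          by_contra hc; push Not at hc
          have : l ∈ s.erase i := Finset.mem_erase.2 ⟨hc.1, hl⟩
          simp [hj, hc] at this
      obtain ⟨j, hj, k, hk, hall⟩ := this
      obtain ⟨p, h1, h2, h3⟩ := h3 i hi j hj k hk
      exact ⟨p, fun l hl => by rcases hall l hl with rfl | rfl | rfl <;> assumption⟩
    · rw [← hi', Finset.two_lt_card] at hn
      obtain ⟨a, ha, b, hb, c, hc, hab, hac, hbc⟩ := hn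
      have step : ∀ j ∈ s, ∃ p, ∀ l ∈ s, l ≠ j → p ∈ C l := by
        intro j hj
        obtain ⟨p, hp⟩ := ih (s.erase j) (by rw [Finset.card_erase_of_mem hj, hs]; rfl) (by
          by_cases hji : j = a
          · exact ⟨b, Finset.mem_erase.2 ⟨fun e => hab (by rw [e, hji]), Finset.mem_of_mem_erase hb⟩⟩
          · exact ⟨a, Finset.mem_erase.2 ⟨fun e => hji e.symm, Finset.mem_of_mem_erase ha⟩⟩)
          (fun x hx y hy z hz => h3 x (Finset.mem_of_mem_erase hx) y (Finset.mem_of_mem_erase hy) z (Finset.mem_of_mem_erase hz))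
        exact ⟨p, fun l hl hlj => hp l (Finset.mem_erase.2 ⟨hlj, hl⟩)⟩
      have ha' := Finset.mem_erase.1 ha
      have hb' := Finset.mem_erase.1 hb
      have hc' := Finset.mem_erase.1 hc
      obtain ⟨pi, hpi⟩ := step i hi
      obtain ⟨pa, hpa⟩ := step a ha'.2
      obtain ⟨pb, hpb⟩ := step b hb'.2
      obtain ⟨pc, hpc⟩ := step c hc'.2
      obtain ⟨q, hq⟩ := radon pi pa pb pc
      refine ⟨q, fun l hl => ?_⟩
      obtain ⟨q1, q2, q3, q4⟩ := hq (C l) (hC l)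
      by_cases e1 : l = i
      · exact q1 (hpa l hl (by rw [e1]; exact ha'.1.symm)) (hpb l hl (by rw [e1]; exact hb'.1.symm))
          (hpc l hl (by rw [e1]; exact hc'.1.symm))
      by_cases e2 : l = a
      · exact q2 (hpi l hl e1) (hpb l hl (by rw [e2]; exact hab)) (hpc l hl (by rw [e2]; exact hac))
      by_cases e3 : l = b
      · exact q3 (hpi l hl e1) (hpa l hl e2) (hpc l hl (by rw [e3]; exact hbc))
      exact q4 (hpi l hl e1) (hpa l hl e2) (hpb l hl e3)

lemma gconvex_ball (x : X) (r : ℝ) : GConvex {p | dist x p < r} :=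
  fun _ ha _ hb _ hq => dist_seg_lt hq ha hb

end Radon
end BS

open Metric Set
set_option linter.unusedSectionVars false

namespace BS
section LemD

variable {X : Type*} [MetricSpace X] [Surf X]

/-- midpoint -/
noncomputable def mid (a b : X) : X := pt a b (1/2)

lemma mid_comm (a b : X) : mid a b = mid b a := by
  have := pt_symm a b mem_half
  rw [mid, mid, ← this]; norm_num

lemma dist_mid_left (a b : X) : dist (mid a b) a = dist a b / 2 := by
  rw [dist_comm, mid, dist_left_pt _ _ mem_half]; ring

lemma dist_mid_right (a b : X) : dist (mid a b) b = dist a b / 2 := by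
  rw [mid, dist_pt_right _ _ mem_half]; ring

lemma dist_mid_mid (a b c : X) : dist (mid b a) (mid b c) ≤ dist a c / 2 := by
  have := busemann b a b c mem_half
  rw [dist_self] at this
  unfold mid
  linarith

/-- A point on the segment: distance to midpoint plus the minimum distance to the ends. -/
lemma dist_mid_add {a b p : X} (hp : p ∈ seg a b) {e : ℝ} (h1 : e ≤ dist p a) (h2 : e ≤ dist p b) :
    dist (mid a b) p + e ≤ dist a b / 2 := by
  obtain ⟨s, hs, rfl⟩ := mem_seg_iff.1 hp
  rw [dist_comm, dist_left_pt _ _ hs] at h1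
  rw [dist_pt_right _ _ hs] at h2
  rw [mid, dist_pt_pt _ _ mem_half hs]
  rcases abs_cases (1/2 - s) with h | h <;> rw [h.1] <;> linarith

lemma dist_mid_seg {a b p : X} (hp : p ∈ seg a b) : dist (mid a b) p ≤ dist a b / 2 :=
  by simpa using dist_mid_add (e := 0) hp dist_nonneg dist_nonneg

/-- half of a side is in one of the two balls -/
lemma half_side {a b c p : X} {M : ℝ} (h1 : dist a b ≤ 2 * M) (h2 : dist b c ≤ 2 * M)
    (h3 : dist c a ≤ 2 * M) (hp : p ∈ seg b c) : dist (mid a b) p ≤ M ∨ dist (mid c a) p ≤ M := by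
  have e1 : dist (mid a b) (mid b c) ≤ M := by
    rw [mid_comm a b]; linarith [dist_mid_mid a b c, dist_comm a c]
  have e2 : dist (mid c a) (mid b c) ≤ M := by
    rw [mid_comm b c]; linarith [dist_mid_mid a c b]
  have hm : mid b c ∈ seg b c := pt_mem_seg _ _ mem_half
  rcases seg_total hm hp with h | h
  · left
    exact dist_seg_le h (by linarith [dist_mid_right a b]) e1
  · right
    have : p ∈ seg (mid b c) c := seg_trans_right hp h
    exact dist_seg_le this e2 (by linarith [dist_mid_left c a])

lemma tri_cover {a b c x : X} {M : ℝ} (h1 : dist a b ≤ 2 * M) (h2 : dist b c ≤ 2 * M)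
    (h3 : dist c a ≤ 2 * M) (hx : x ∈ cone a b c) : dist (mid a b) x ≤ M ∨ dist (mid c a) x ≤ M := by
  obtain ⟨p, hp, hx⟩ := hx
  rcases half_side h1 h2 h3 hp with h | h
  · left; exact dist_seg_le hx (by linarith [dist_mid_left a b]) h
  · right; exact dist_seg_le hx (by linarith [dist_mid_right c a]) h

lemma fin_cover {a b c o p y : X} {M : ℝ} (h1 : dist a b ≤ 2 * M) (h2 : dist b c ≤ 2 * M)
    (h3 : dist c a ≤ 2 * M) (ho1 : dist (mid a b) o ≤ M) (ho2 : dist (mid c a) o ≤ M)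
    (hp : p ∈ seg a b ∨ p ∈ seg b c ∨ p ∈ seg c a) (hy : y ∈ seg o p) :
    dist (mid a b) y ≤ M ∨ dist (mid c a) y ≤ M := by
  rcases hp with hp | hp | hp
  · left; exact dist_seg_le hy ho1 (by linarith [dist_mid_seg hp])
  · rcases half_side h1 h2 h3 hp with h | h
    · left; exact dist_seg_le hy ho1 h
    · right; exact dist_seg_le hy ho2 h
  · right; exact dist_seg_le hy ho2 (by linarith [dist_mid_seg hp])

set_option maxHeartbeats 1000000 in
/-- Case r > M. -/
lemma case_gt {a b c y : X} {M r : ℝ} (hM : 0 ≤ M) (hMr : M < r)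
    (h1 : dist a b ≤ 2 * M) (h2 : dist b c ≤ 2 * M) (h3 : dist c a ≤ 2 * M)
    (hno : ∀ p, dist a p < r → dist b p < r → r ≤ dist c p)
    (hap : ∀ ε > 0, ∃ o, dist a o < r + ε ∧ dist b o < r + ε ∧ dist c o < r + ε ∧ dist y o < r + ε) :
    dist (mid a b) y ≤ M ∨ dist (mid b c) y ≤ M ∨ dist (mid c a) y ≤ M := by
  by_contra hc
  push Not at hc
  obtain ⟨g1, g2, g3⟩ := hc
  obtain ⟨t, ht0, ht1, hE, hEr⟩ : ∃ t : ℝ, 0 < t ∧ t ≤ 1 ∧ (M + t * (r + M) < dist (mid a b) y ∧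
      M + t * (r + M) < dist (mid b c) y ∧ M + t * (r + M) < dist (mid c a) y) ∧ M + t * (r + M) < r := by
    have hlim : Filter.Tendsto (fun t : ℝ => M + t * (r + M)) (nhdsWithin 0 (Ioi 0)) (nhds M) := by
      have : Continuous (fun t : ℝ => M + t * (r + M)) := by fun_prop
      have := this.tendsto 0
      simp only [zero_mul, add_zero] at this
      exact this.mono_left nhdsWithin_le_nhds
    have e1 := hlim.eventually_lt_const g1
    have e2 := hlim.eventually_lt_const g2
    have e3 := hlim.eventually_lt_const g3
    have e4 := hlim.eventually_lt_const hMr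
    have e5 : ∀ᶠ t : ℝ in nhdsWithin 0 (Ioi 0), t ≤ 1 :=
      (Filter.Eventually.filter_mono nhdsWithin_le_nhds (Iic_mem_nhds zero_lt_one))
    have e6 : ∀ᶠ t : ℝ in nhdsWithin 0 (Ioi 0), 0 < t := self_mem_nhdsWithin
    obtain ⟨t, ht⟩ := (e1.and (e2.and (e3.and (e4.and (e5.and e6))))).exists
    exact ⟨t, ht.2.2.2.2.2, ht.2.2.2.2.1, ⟨ht.1, ht.2.1, ht.2.2.1⟩, ht.2.2.2.1⟩
  have htI : t ∈ Icc (0:ℝ) 1 := ⟨ht0.le, ht1⟩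
  have hε : 0 < t * (r - M) := mul_pos ht0 (by linarith)
  obtain ⟨o, oa, ob, oc, oy⟩ := hap _ hε
  -- lower bounds
  have low : ∀ u v w : X, dist u v ≤ 2 * M → dist v w ≤ 2 * M → dist w u ≤ 2 * M →
      dist v o < r + t * (r - M) → dist w o < r + t * (r - M) →
      (∀ p, dist u p < r → dist v p < r → r ≤ dist w p) → r - 2 * M * t ≤ dist u o := by
    intro u v w huv hvw hwu hv hw hno
    by_contra hlt
    push Not at hlt
    have q1 := dist_pt_le u o (mid v w) htI
    have q2 := dist_pt_le v o (mid v w) htI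
    have q3 := dist_pt_le w o (mid v w) htI
    have s1 : dist u (mid v w) ≤ 2 * M := dist_seg_le (pt_mem_seg v w mem_half) huv (by linarith [dist_comm u w])
    have s2 : dist v (mid v w) ≤ M := by rw [dist_comm]; linarith [dist_mid_left v w]
    have s3 : dist w (mid v w) ≤ M := by rw [dist_comm]; linarith [dist_mid_right v w]
    refine absurd (hno (pt o (mid v w) t) ?_ ?_) (not_le.2 ?_)
    · nlinarith [dist_nonneg (x := u) (y := o)]
    · nlinarith
    · nlinarith
  have la := low a b c h1 h2 h3 ob oc hno
  have lb := low b c a h2 h3 h1 oc oa (fun p q1 q2 => by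
    by_contra hh; push Not at hh; exact absurd (hno p hh q1) (not_le.2 q2))
  have lcc := low c a b h3 h1 h2 oa ob (fun p q1 q2 => by
    by_contra hh; push Not at hh; exact absurd (hno p q2 hh) (not_le.2 q1))
  have rule : ∀ u v x p : X, dist u v ≤ 2 * M → r - 2 * M * t ≤ dist u o → r - 2 * M * t ≤ dist v o →
      dist x o < r + t * (r - M) → p ∈ seg o x → p ∈ seg u v → dist (mid u v) x ≤ M + t * (r + M) := by
    intro u v x p huv lu lv hx hp hq
    have e1 : dist o p + dist p x = dist o x := hp
    have e2 := dist_mid_add (e := dist p x - t * (r + M)) hq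
      (by linarith [dist_triangle u p o, dist_comm u p, dist_comm o p, dist_comm o x])
      (by linarith [dist_triangle v p o, dist_comm v p, dist_comm o p, dist_comm o x])
    linarith [dist_triangle (mid u v) p x]
  have notcone : ∀ u v w : X, dist u v ≤ 2 * M → r - 2 * M * t ≤ dist w o → dist u o < r + t * (r - M) →
      dist v o < r + t * (r - M) → w ∈ cone o u v → dist (mid u v) w ≤ M + t * (r + M) := by
    rintro u v w huv lw hu hv ⟨p, hp, hw⟩
    have e1 : dist o w + dist w p = dist o p := hw
    have e2 : dist o p < r + t * (r - M) := dist_seg_lt hp (by rwa [dist_comm]) (by rwa [dist_comm])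
    have e3 := dist_mid_seg hp
    linarith [dist_triangle (mid u v) p w, dist_comm p w, dist_comm w o]
  have contr : ∀ u v w : X, dist u v ≤ 2 * M → (∀ p, dist u p < r → dist v p < r → r ≤ dist w p) →
      ¬ (dist (mid u v) w ≤ M + t * (r + M)) := by
    intro u v w huv hno hw
    have := hno (mid u v) (by rw [dist_comm]; linarith [dist_mid_left u v])
      (by rw [dist_comm]; linarith [dist_mid_right u v])
    rw [dist_comm] at this
    linarith
  have hnoa : ∀ p, dist b p < r → dist c p < r → r ≤ dist a p := fun p q1 q2 => by
    by_contra hh; push Not at hh; exact absurd (hno p hh q1) (not_le.2 q2)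
  have hnob : ∀ p, dist c p < r → dist a p < r → r ≤ dist b p := fun p q1 q2 => by
    by_contra hh; push Not at hh; exact absurd (hno p q2 hh) (not_le.2 q1)
  have gen : Gen o a b c := by
    refine ⟨?_, ?_, ?_, ?_, ?_, ?_⟩
    · rw [Set.disjoint_left]; intro p hp hq
      exact contr b c a h2 hnoa (rule b c a p h2 lb lcc oa hp hq)
    · rw [Set.disjoint_left]; intro p hp hq
      exact contr c a b h3 hnob (rule c a b p h3 lcc la ob hp hq)
    · rw [Set.disjoint_left]; intro p hp hq
      exact contr a b c h1 hno (rule a b c p h1 la lb oc hp hq)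
    · exact fun h => contr b c a h2 hnoa (notcone b c a h2 la ob oc h)
    · exact fun h => contr c a b h3 hnob (notcone c a b h3 lb oc oa h)
    · exact fun h => contr a b c h1 hno (notcone a b c h1 lcc oa ob h)
  have ca := tri_cover h1 h2 h3 gen.mem_cone
  have cb := tri_cover h2 h3 h1 gen.rot.mem_cone
  have cc := tri_cover h3 h1 h2 gen.rot.rot.mem_cone
  obtain ⟨p, hp, hy | hy⟩ := gen.comp y
  · have hp2 : p ∈ seg b c ∨ p ∈ seg c a ∨ p ∈ seg a b := by
      rcases hp with h | h | h
      exacts [Or.inr (Or.inr h), Or.inl h, Or.inr (Or.inl h)]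
    have hp3 : p ∈ seg c a ∨ p ∈ seg a b ∨ p ∈ seg b c := by
      rcases hp with h | h | h
      exacts [Or.inr (Or.inl h), Or.inr (Or.inr h), Or.inl h]
    have F1 : dist (mid a b) o ≤ M → dist (mid c a) o ≤ M → False := fun q1 q2 =>
      (fin_cover h1 h2 h3 q1 q2 hp hy).elim (not_le.2 g1) (not_le.2 g3)
    have F2 : dist (mid b c) o ≤ M → dist (mid a b) o ≤ M → False := fun q1 q2 =>
      (fin_cover h2 h3 h1 q1 q2 hp2 hy).elim (not_le.2 g2) (not_le.2 g1)
    have F3 : dist (mid c a) o ≤ M → dist (mid b c) o ≤ M → False := fun q1 q2 =>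
      (fin_cover h3 h1 h2 q1 q2 hp3 hy).elim (not_le.2 g3) (not_le.2 g2)
    rcases ca with u | u
    · rcases cc with v | v
      · exact F1 u v
      · exact F2 v u
    · rcases cb with v | v
      · exact F3 u v
      · exact F1 v u
  · rcases hp with hp | hp | hp
    · linarith [rule a b y p h1 la lb oy hy hp]
    · linarith [rule b c y p h2 lb lcc oy hy hp]
    · linarith [rule c a y p h3 lcc la oy hy hp]

/-- Case r = M. -/
lemma case_eq {a b y : X} {M : ℝ} (h1 : dist a b = 2 * M)
    (hap : ∀ ε > 0, ∃ o, dist a o < M + ε ∧ dist b o < M + ε ∧ dist y o < M + ε) :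
    dist (mid a b) y ≤ M := by
  by_contra hc
  push Not at hc
  have : LocallyCompactSpace X := Surf.lc
  set m := mid a b with hm
  obtain ⟨R, hR0, hR⟩ := exists_isCompact_closedBall m
  set g := dist m y - M with hg
  have hg0 : 0 < g := by linarith
  set η := min R (g / 2) with hη
  have hη0 : 0 < η := lt_min hR0 (by linarith)
  have hηg : η ≤ g / 2 := min_le_right _ _
  have hK : IsCompact (sphere m η) :=
    hR.of_isClosed_subset isClosed_sphere (sphere_subset_closedBall.trans (closedBall_subset_closedBall (min_le_left _ _)))
  have ma : dist a m = M := by rw [dist_comm, hm, dist_mid_left, h1]; ring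
  have mb : dist b m = M := by rw [dist_comm, hm, dist_mid_right, h1]; ring
  have hq : ∀ ε > 0, ε ≤ g / 2 → ∃ q ∈ sphere m η, max (dist a q) (dist b q) ≤ M + ε := by
    intro ε hε hεg
    obtain ⟨o, oa, ob, oy⟩ := hap ε hε
    have hd : η ≤ dist m o := by linarith [dist_triangle m o y, dist_comm o y]
    have hd0 : 0 < dist m o := by linarith
    have ht : η / dist m o ∈ Icc (0:ℝ) 1 := ⟨by positivity, by rw [div_le_one hd0]; exact hd⟩
    refine ⟨pt m o (η / dist m o), ?_, ?_⟩
    · rw [mem_sphere, dist_comm, dist_left_pt _ _ ht]; field_simp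
    · exact max_le (dist_seg_le (pt_mem_seg _ _ ht) (by linarith) oa.le)
        (dist_seg_le (pt_mem_seg _ _ ht) (by linarith) ob.le)
  obtain ⟨q0, hq0, -⟩ := hq (g/2) (by linarith) le_rfl
  obtain ⟨q, hqs, hmin⟩ := hK.exists_isMinOn ⟨q0, hq0⟩
    (f := fun q => max (dist a q) (dist b q)) (by fun_prop)
  have hle : max (dist a q) (dist b q) ≤ M := by
    apply le_of_forall_pos_le_add
    intro ε hε
    obtain ⟨q', hq', h⟩ := hq (min ε (g/2)) (lt_min hε (by linarith)) (min_le_right _ _)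
    have := hmin hq'
    simp only [mem_ofPred_eq] at this
    linarith [min_le_left ε (g/2)]
  have l1 : dist a q ≤ M := (le_max_left _ _).trans hle
  have l2 : dist b q ≤ M := (le_max_right _ _).trans hle
  have : q = m := pt_unique mem_half (by linarith [dist_triangle a q b, dist_comm b q])
    (by linarith [dist_triangle a q b, dist_comm b q])
  rw [this, mem_sphere, dist_self] at hqs
  linarith

lemma lemD (Y : Finset X) (hne : Y.Nonempty) {δ : ℝ} (hY : ∀ a ∈ Y, ∀ b ∈ Y, dist a b ≤ 2 * δ) :
    ∃ a ∈ Y, ∃ b ∈ Y, ∃ c ∈ Y, ∀ y ∈ Y,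
      dist (mid a b) y ≤ δ ∨ dist (mid b c) y ≤ δ ∨ dist (mid c a) y ≤ δ := by
  obtain ⟨⟨a, b⟩, hab, hmax⟩ := Finset.exists_max_image (Y ×ˢ Y) (fun p => dist p.1 p.2)
    (hne.product hne)
  simp only [Finset.mem_product] at hab hmax
  set M := dist a b / 2 with hM
  have hM0 : 0 ≤ M := by positivity
  have hMδ : M ≤ δ := by linarith [hY a hab.1 b hab.2]
  have hYM : ∀ u ∈ Y, ∀ v ∈ Y, dist u v ≤ 2 * M := fun u hu v hv => by
    have := hmax (u, v) ⟨hu, hv⟩; simp only at this; linarith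
  by_cases hA : ∀ ε > 0, ∃ o, ∀ y ∈ Y, dist y o < M + ε
  · refine ⟨a, hab.1, b, hab.2, a, hab.1, fun y hy => Or.inl ?_⟩
    refine le_trans (case_eq (M := M) (by linarith) (fun ε hε => ?_)) hMδ
    obtain ⟨o, ho⟩ := hA ε hε
    exact ⟨o, ho a hab.1, ho b hab.2, ho y hy⟩
  · push Not at hA
    obtain ⟨ε₀, hε₀, hA⟩ := hA
    set R : Set ℝ := {ρ | ∃ o, ∀ y ∈ Y, dist y o < ρ} with hR
    have hRne : R.Nonempty := ⟨2 * M + 1, a, fun y hy => by linarith [hYM y hy a hab.1]⟩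
    have hRlow : ∀ ρ ∈ R, M + ε₀ ≤ ρ := by
      rintro ρ ⟨o, ho⟩
      obtain ⟨y, hy, h⟩ := hA o
      linarith [ho y hy]
    have hRb : BddBelow R := ⟨_, hRlow⟩
    set r := sInf R with hr
    have hMr : M < r := by linarith [le_csInf hRne hRlow]
    have hap : ∀ ε > 0, ∃ o, ∀ y ∈ Y, dist y o < r + ε := by
      intro ε hε
      obtain ⟨ρ, ⟨o, ho⟩, hlt⟩ := exists_lt_of_csInf_lt hRne (show sInf R < r + ε by linarith)
      exact ⟨o, fun y hy => (ho y hy).trans hlt⟩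
    have hno : ¬ ∃ o, ∀ y ∈ Y, dist y o < r := by
      rintro ⟨o, ho⟩
      obtain ⟨y0, hy0, hy0m⟩ := Finset.exists_max_image Y (fun y => dist y o) hne
      have : (dist y0 o + r) / 2 ∈ R := ⟨o, fun y hy => by linarith [hy0m y hy, ho y0 hy0]⟩
      linarith [csInf_le hRb this, ho y0 hy0]
    have : ∃ a ∈ Y, ∃ b ∈ Y, ∃ c ∈ Y, ∀ p, dist a p < r → dist b p < r → r ≤ dist c p := by
      by_contra hcon
      push Not at hcon
      exact hno (helly (fun y => {p | dist y p < r}) (fun y => gconvex_ball y r) _ Y rfl hne hcon)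
    obtain ⟨a, ha, b, hb, c, hc, hno3⟩ := this
    refine ⟨a, ha, b, hb, c, hc, fun y hy => ?_⟩
    have := case_gt (y := y) hM0 hMr (hYM a ha b hb) (hYM b hb c hc) (hYM c hc a ha) hno3 (fun ε hε => by
      obtain ⟨o, ho⟩ := hap ε hε
      exact ⟨o, ho a ha, ho b hb, ho c hc, ho y hy⟩)
    rcases this with h | h | h
    · left; linarith
    · right; left; linarith
    · right; right; linarith

end LemD
end BS

open Metric Set
set_option linter.unusedSectionVars false

namespace BS
section Loc

variable {X : Type*} [MetricSpace X] [Surf X]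

/-- Configuration: `x` is near `v`, not farther from `z` than `v`, and outside of the ball at `u`. -/
structure Fp (z v u : X) (δ : ℝ) (x : X) : Prop where
  hz : dist z x ≤ dist z v
  hv : dist v x ≤ 2 * δ
  hu : δ < dist u x

/-- The base configuration. -/
structure Base (z v u : X) (δ : ℝ) : Prop where
  pos : 0 < δ
  hu : u ∈ seg v z
  hd : dist v u = δ

variable {z v u : X} {δ : ℝ}

namespace Fp

variable {x y w : X}

lemma a (hb : Base z v u δ) (h : Fp z v u δ x) : u ∉ seg v x := by
  intro hh
  have : dist v u + dist u x = dist v x := hh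
  linarith [h.hv, h.hu, hb.hd]

lemma b (hb : Base z v u δ) (h : Fp z v u δ x) : u ∉ seg x z := by
  intro hh
  have h1 : dist x u + dist u z = dist x z := hh
  have h2 : dist v u + dist u z = dist v z := hb.hu
  linarith [h.hz, h.hu, hb.hd, dist_comm x u, dist_comm x z, dist_comm v z]

lemma c (hb : Base z v u δ) (h : Fp z v u δ x) : x ∉ seg v z := by
  intro hh
  rcases seg_total hb.hu hh with h1 | h1
  · have : dist v x + dist x u = dist v u := h1
    linarith [h.hu, hb.hd, dist_comm x u, dist_nonneg (x := v) (y := x)]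
  · exact h.a hb h1

lemma d (hb : Base z v u δ) (h : Fp z v u δ x) : Disjoint (seg u z) (seg v x) := by
  rw [Set.disjoint_left]
  intro s h1 h2
  have h3 : u ∈ seg v s := by
    rw [seg_comm]
    exact seg_trans_right (x := z) (by rw [seg_comm]; exact hb.hu) (by rw [seg_comm]; exact h1)
  exact h.a hb (seg_trans h2 h3)

lemma e (hb : Base z v u δ) (h : Fp z v u δ x) : Disjoint (seg v u) (seg x z) := by
  rw [Set.disjoint_left]
  intro s h1 h2
  have h3 : u ∈ seg s z := seg_trans_right hb.hu h1
  exact h.b hb (seg_sub h2 (right_mem x z) h3)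

/-- the angle -/
noncomputable def ang (z v u x : X) : ℂ := W u v x + W u x z

lemma ne_u (hb : Base z v u δ) (h : Fp z v u δ x) : x ≠ u := fun e => by
  have := h.hu; rw [e, dist_self] at this; linarith [hb.pos]

lemma ang_exp (hb : Base z v u δ) (h : Fp z v u δ x) :
    Complex.exp (ang z v u x) = (Surf.f z - Surf.f u) / (Surf.f v - Surf.f u) := by
  rw [ang, Complex.exp_add, W1 (h.a hb), W1 (h.b hb)]
  have e1 := f_sub_ne (h.ne_u hb)
  field_simp

lemma ang_eq (hb : Base z v u δ) (h : Fp z v u δ x) :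
    ang z v u x = W v u z + W z v u + W z v x + W v x z - W x v z := by
  have i1 := W4 (h.d hb)
  have i2 := W4 (h.e hb)
  have i3 : W x v u + W x u z = W x v z := W3 (by
    rintro ⟨q, h1, h2⟩
    exact h.c hb (seg_trans (seg_sub hb.hu (right_mem v z) h1) h2))
  rw [ang]
  linear_combination -i1 + i2 - i3

lemma ang_diff (hb : Base z v u δ) (hx : Fp z v u δ x) (hy : Fp z v u δ y)
    (E1 : Disjoint (seg v y) (seg x z)) (E2 : Disjoint (seg v x) (seg y z))
    (T1 : x ∉ cone z v y) (T2 : y ∉ cone z v x) :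
    ∃ Q, ang z v u x - ang z v u y = 2 * Q ∧ Complex.exp Q = -1 := by
  have nxzy : x ∉ seg y z := fun h => T1 ⟨y, right_mem _ _, by rwa [seg_comm]⟩
  have nyzx : y ∉ seg x z := fun h => T2 ⟨x, right_mem _ _, by rwa [seg_comm]⟩
  have nyvx : y ∉ seg v x := fun h => T2 ⟨y, h, right_mem _ _⟩
  have nxvy : x ∉ seg v y := fun h => T1 ⟨x, h, right_mem _ _⟩
  have nvyz : v ∉ seg y z := Set.disjoint_left.1 (hy.e hb) (left_mem _ _)
  have nvxz : v ∉ seg x z := Set.disjoint_left.1 (hx.e hb) (left_mem _ _)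
  refine ⟨W y v x - W v y z + W v x z - W x v y, ?_, ?_⟩
  · have t1 := W3 T1
    have t2 := W3 T2
    have s1 := W2 (hx.c hb)
    have s2 := W2 (hy.c hb)
    have s3 := W2 nxzy
    have s4 := W2 nyzx
    have s5 := W2 nvyz
    have s6 := W2 nvxz
    rw [seg_comm y z] at E2
    rw [seg_comm x z] at E1
    have e1 := W4 E2
    have e2 := W4 E1
    rw [hx.ang_eq hb, hy.ang_eq hb]
    linear_combination e1 - e2 + t1 - t2 - s1 + s2 + s5 - s6
  · rw [Complex.exp_sub, Complex.exp_add, Complex.exp_sub, W1 nyvx, W1 nvyz, W1 nvxz, W1 nxvy]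
    have e1 := f_sub_ne (X := X) (x := v) (y := y) (fun e => nvyz (e ▸ left_mem _ _))
    have e2 := f_sub_ne (X := X) (x := v) (y := x) (fun e => nvxz (e ▸ left_mem _ _))
    have e3 := f_sub_ne (X := X) (x := y) (y := x) (fun e => nxzy (e ▸ left_mem _ _))
    have e4 := f_sub_ne (X := X) (x := z) (y := v) (fun e => nvxz (e ▸ right_mem _ _))
    have e5 := f_sub_ne (X := X) (x := x) (y := v) (fun e => nvxz (e ▸ left_mem _ _))
    have e6 := f_sub_ne (X := X) (x := y) (y := v) (fun e => nvyz (e ▸ left_mem _ _))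
    field_simp
    ring

end Fp

lemma coloring (hb : Base z v u δ) : ∃ P : X → Prop, ∀ x y, Fp z v u δ x → Fp z v u δ y → (P x ↔ P y) →
    ¬ Disjoint (seg v y) (seg x z) ∨ ¬ Disjoint (seg v x) (seg y z) ∨ x ∈ cone z v y ∨ y ∈ cone z v x := by
  set k := (Surf.f z - Surf.f u) / (Surf.f v - Surf.f u) with hk
  set r := Complex.exp (Complex.log k / 2) with hr
  refine ⟨fun x => Complex.exp (Fp.ang z v u x / 2) = r, fun x y hx hy hxy => ?_⟩
  by_contra hc
  push Not at hc
  obtain ⟨E1, E2, T1, T2⟩ := hc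
  obtain ⟨Q, h1, h2⟩ := Fp.ang_diff hb hx hy E1 E2 T1 T2
  have hk0 : k ≠ 0 := by rw [hk, ← hx.ang_exp hb]; exact Complex.exp_ne_zero _
  have sq : ∀ w, Fp z v u δ w → Complex.exp (Fp.ang z v u w / 2) = r ∨ Complex.exp (Fp.ang z v u w / 2) = -r := by
    intro w hw
    apply sq_eq_sq_iff_eq_or_eq_neg.1
    rw [hr, ← Complex.exp_nat_mul, ← Complex.exp_nat_mul]
    have e1 : ((2:ℕ):ℂ) * (Fp.ang z v u w / 2) = Fp.ang z v u w := by push_cast; ring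
    have e2 : ((2:ℕ):ℂ) * (Complex.log k / 2) = Complex.log k := by push_cast; ring
    rw [e1, e2, hw.ang_exp hb, Complex.exp_log hk0]
  have heq : Complex.exp (Fp.ang z v u x / 2) = Complex.exp (Fp.ang z v u y / 2) := by
    by_cases hp : Complex.exp (Fp.ang z v u x / 2) = r
    · rw [hp, hxy.1 hp]
    · have hq : ¬ Complex.exp (Fp.ang z v u y / 2) = r := fun h => hp (hxy.2 h)
      rw [(sq x hx).resolve_left hp, (sq y hy).resolve_left hq]
  have e3 : Fp.ang z v u x / 2 = Fp.ang z v u y / 2 + Q := by linear_combination h1 / 2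
  rw [e3, Complex.exp_add, h2] at heq
  have := Complex.exp_ne_zero (Fp.ang z v u y / 2)
  have h3 : Complex.exp (Fp.ang z v u y / 2) = 0 := by linear_combination - heq / 2
  exact this h3

/-- crossing implies close -/
lemma cross_close {x y : X} (hx : Fp z v u δ x) (hy : Fp z v u δ y)
    (h : ¬ Disjoint (seg v y) (seg x z)) : dist x y ≤ 2 * δ := by
  obtain ⟨p, h1, h2⟩ := Set.not_disjoint_iff.1 h
  have e1 : dist v p + dist p y = dist v y := h1
  have e2 : dist x p + dist p z = dist x z := h2
  linarith [dist_triangle x p y, dist_triangle z p v, dist_comm z p, dist_comm p v, hx.hz, hy.hv,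
    dist_comm x z]

/-- `x ≪ y` -/
def Far (z v : X) (δ : ℝ) (x y : X) : Prop := x ∈ cone z v y ∧ 2 * δ < dist x y

lemma far_of {P : X → Prop} (hP : ∀ x y, Fp z v u δ x → Fp z v u δ y → (P x ↔ P y) →
    ¬ Disjoint (seg v y) (seg x z) ∨ ¬ Disjoint (seg v x) (seg y z) ∨ x ∈ cone z v y ∨ y ∈ cone z v x)
    {x y : X} (hx : Fp z v u δ x) (hy : Fp z v u δ y) (hc : P x ↔ P y) (hd : 2 * δ < dist x y) :
    Far z v δ x y ∨ Far z v δ y x := by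
  rcases hP x y hx hy hc with h | h | h | h
  · linarith [cross_close hx hy h]
  · linarith [cross_close hy hx h, dist_comm x y]
  · exact Or.inl ⟨h, hd⟩
  · exact Or.inr ⟨h, by rwa [dist_comm]⟩

lemma Far.data {x y : X} (hb : Base z v u δ) (hx : Fp z v u δ x) (hy : Fp z v u δ y)
    (h : Far z v δ x y) : ∃ (p : X) (σ t D hp : ℝ), σ ∈ Icc (0:ℝ) 1 ∧ t ∈ Icc (0:ℝ) 1 ∧
      p = pt v y σ ∧ x = pt p z t ∧ dist x p = D ∧ D = t * dist z p ∧ hp = dist z v - dist z p ∧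
      D = dist z v - dist z x - hp ∧ σ * (dist z v - dist z y) ≤ hp ∧ 0 ≤ hp ∧ hp ≤ σ * dist v y ∧
      dist v p = σ * dist v y ∧
      σ * dist v y + 2 * δ - dist v y < D ∧ 2 * δ < D + σ * dist v y ∧ δ < D := by
  obtain ⟨⟨p, hp, hxp⟩, hfar⟩ := h
  obtain ⟨σ, hσ, rfl⟩ := mem_seg_iff.1 hp
  rw [seg_comm] at hxp
  obtain ⟨t, ht, hxt⟩ := mem_seg_iff.1 hxp
  set p := pt v y σ with hpd
  have e1 : dist p x + dist x z = dist p z := hxp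
  have e2 : dist v p = σ * dist v y := dist_left_pt _ _ hσ
  have e3 : dist p y = (1 - σ) * dist v y := dist_pt_right _ _ hσ
  have e4 : dist z p ≤ (1 - σ) * dist z v + σ * dist z y := dist_pt_le _ _ _ hσ
  have e5 : dist x p = t * dist z p := by rw [hxt, dist_comm, dist_left_pt _ _ ht, dist_comm]
  have hpos := hb.pos
  have q1 : σ * (dist z v - dist z y) ≤ dist z v - dist z p := by linarith
  have q2 : 0 ≤ dist z v - dist z p := le_trans (mul_nonneg hσ.1 (by linarith [hy.hz])) q1
  have q3 : dist z v - dist z p ≤ σ * dist v y := by linarith [dist_triangle z p v, dist_comm p v]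
  have q4 : σ * dist v y + 2 * δ - dist v y < dist x p := by linarith [dist_triangle x p y]
  have q5 : dist z v = dist z p + (dist z v - dist z p) := by ring
  have key : 2 * δ < dist x p + σ * dist v y := by
    obtain ⟨τ, hτ, hu⟩ := mem_seg_iff.1 hb.hu
    have f1 : τ * dist z v = δ := by
      rw [← hb.hd, hu, dist_left_pt _ _ hτ, dist_comm v z]
    have f2 : dist x (pt v z t) ≤ (1 - t) * dist v p := by
      have := busemann p z v z ht
      rw [dist_self, ← hxt, dist_comm p v] at this
      linarith
    have f3 : dist (pt v z t) u = |t - τ| * dist z v := by rw [hu, dist_pt_pt _ _ ht hτ, dist_comm v z]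
    have f4 := dist_triangle x (pt v z t) u
    have f5 := hx.hu
    rw [dist_comm] at f5
    have f6 : 0 ≤ dist v p := dist_nonneg
    have f7 : 0 ≤ dist z v := dist_nonneg
    have g1 : t * dist z v = dist x p + t * (dist z v - dist z p) := by rw [e5]; ring
    have g2 := mul_nonneg ht.1 q2
    have g3 := mul_le_mul_of_nonneg_left q3 ht.1
    have g4 := mul_nonneg ht.1 f6
    rw [f3] at f4
    rw [e2] at *
    rcases abs_cases (t - τ) with h | h
    · rw [h.1] at f4
      nlinarith [hy.hv]
    · rw [h.1] at f4
      nlinarith [hy.hv]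
  refine ⟨p, σ, t, dist x p, _, hσ, ht, rfl, hxt, rfl, e5, rfl, ?_, q1, q2, q3, e2, q4, key, ?_⟩
  · linarith [dist_comm p x, dist_comm x z, dist_comm p z]
  · linarith [hy.hv]

lemma Far.deep {x y : X} (hb : Base z v u δ) (hx : Fp z v u δ x) (hy : Fp z v u δ y)
    (h : Far z v δ x y) : δ < dist z v - dist z x := by
  obtain ⟨p, σ, t, D, hp, h1⟩ := h.data hb hx hy
  linarith [h1.2.2.2.2.2.2.2.1, h1.2.2.2.2.2.2.2.2.2.1, h1.2.2.2.2.2.2.2.2.2.2.2.2.2.2]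

lemma arith1 {σ s D' D : ℝ} (h0 : 0 ≤ σ) (h1 : σ ≤ 1) (hs : 0 ≤ s) (a1 : s < D')
    (a3 : D' ≤ 2 - s / 2) (a4 : 1 < D) (a5 : 2 * σ < D) (a6 : D ≤ 2 - σ * (D' + s / 2)) :
    (1 - σ) * s + (1 + σ) * D' - D ≤ 2 := by
  rcases le_or_gt σ (1/2) with h | h
  · have b1 : (1 + σ) * D' ≤ (1 + σ) * (2 - s / 2) := mul_le_mul_of_nonneg_left a3 (by linarith)
    have b2 : s < 4 / 3 := by linarith
    rcases le_or_gt σ (1/3) with g | g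
    · have b3 : (1/2 - 3 * σ / 2) * s ≤ (1/2 - 3 * σ / 2) * (4/3) :=
        mul_le_mul_of_nonneg_left b2.le (by linarith)
      nlinarith
    · have b3 : 0 ≤ (3 * σ / 2 - 1/2) * s := mul_nonneg (by linarith) hs
      nlinarith
  · have c1 : σ * (D' + s / 2) < 2 - 2 * σ := by linarith
    have c2 : (1 - σ) * s ≤ (1 - σ) * (4 - 2 * D') := mul_le_mul_of_nonneg_left (by linarith) (by linarith)
    have c3 : σ * D' < 2 - 2 * σ := by nlinarith
    have c4 : D' * (3 * σ - 1) * σ ≤ (2 - 2 * σ) * (3 * σ - 1) := by nlinarith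
    have c5 : ((1 - σ) * s + (1 + σ) * D' - D) ≤ 4 - 6 * σ + D' * (3 * σ - 1) := by nlinarith
    have c6 : (4 - 6 * σ + D' * (3 * σ - 1)) * σ ≤ 2 * σ := by nlinarith
    have := le_of_mul_le_mul_right c6 (by linarith)
    linarith

lemma arith2 {σ s D' D δ : ℝ} (hδ : 0 < δ) (h0 : 0 ≤ σ) (h1 : σ ≤ 1) (hs : 0 ≤ s) (a1 : s < D')
    (a3 : D' ≤ 2 * δ - s / 2) (a4 : δ < D) (a5 : 2 * σ * δ < D) (a6 : D ≤ 2 * δ - σ * (D' + s / 2)) :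
    (1 - σ) * s + (1 + σ) * D' - D ≤ 2 * δ := by
  have := arith1 (σ := σ) (s := s / δ) (D' := D' / δ) (D := D / δ) h0 h1 (by positivity)
    (by gcongr) (by
      rw [div_le_iff₀ hδ]; field_simp; linarith) (by rwa [one_lt_div hδ]) (by rwa [lt_div_iff₀ hδ])
    (by rw [div_le_iff₀ hδ]; field_simp; linarith)
  have e : (1 - σ) * (s / δ) + (1 + σ) * (D' / δ) - D / δ = ((1 - σ) * s + (1 + σ) * D' - D) / δ := by
    field_simp
  rwa [e, div_le_iff₀ hδ] at this

lemma Far.chain {x y w : X} (hb : Base z v u δ) (hx : Fp z v u δ x) (hy : Fp z v u δ y)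
    (hw : Fp z v u δ w) (h : Far z v δ x y) (h' : Far z v δ y w)
    (hdw : δ < dist z v - dist z w) : False := by
  obtain ⟨p, σ, t, D, hp, hσ, ht, hpp, hxt, hD, hDt, hhp, hDh, hps, hp0, hpl, hvp, f1, f2, f3⟩ := h.data hb hx hy
  obtain ⟨p', σ', t', D', hp', hσ', ht', hpp', hxt', hD', hDt', hhp', hDh', hps', hp0', hpl', hvp', f1', f2', f3'⟩ :=
    h'.data hb hy hw
  have hpos := hb.pos
  have hfar := h.2
  set s' := dist v p' with hs'
  have s'0 : 0 ≤ s' := dist_nonneg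
  have hlw := hw.hv
  have a0 : s' / 2 ≤ hp' := by
    have b1 := mul_le_mul_of_nonneg_left hdw.le hσ'.1
    have b2 := mul_le_mul_of_nonneg_left hlw hσ'.1
    linarith
  have hy2 : dist z v - dist z y ≤ 2 * δ := by linarith [dist_triangle z y v, dist_comm y v, hy.hv]
  have hx2 : dist z v - dist z x ≤ 2 * δ := by linarith [dist_triangle z x v, dist_comm x v, hx.hv]
  have a3 : D' ≤ 2 * δ - s' / 2 := by linarith
  have a1 : s' < D' := by linarith
  have a5 : 2 * σ * δ < D := by
    have := mul_le_mul_of_nonneg_left hy.hv (one_sub_mem hσ).1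
    linarith
  have a6 : D ≤ 2 * δ - σ * (D' + s' / 2) := by
    have : σ * (D' + s' / 2) ≤ σ * (dist z v - dist z y) := mul_le_mul_of_nonneg_left (by linarith) hσ.1
    linarith
  have hQ := arith2 hpos hσ.1 hσ.2 s'0 a1 a3 f3 a5 a6
  have dpp : dist p p' ≤ (1 - σ) * s' + σ * D' := by
    have := dist_pt_le p' v y hσ
    rw [← hpp, dist_comm p' p, dist_comm p' v, dist_comm p' y, hD'] at this
    exact this
  have dxy : dist x y ≤ (1 - t) * dist p p' + |t - t'| * dist z p' := by
    have b1 := busemann p z p' z ht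
    have b2 := dist_pt_pt p' z ht ht'
    rw [dist_self] at b1
    rw [hxt, hxt']
    have := dist_triangle (pt p z t) (pt p' z t) (pt p' z t')
    rw [b2, dist_comm p' z] at this
    linarith
  have tr1 : t * dist z p' ≤ t * (dist z p + dist p p') :=
    mul_le_mul_of_nonneg_left (dist_triangle _ _ _) ht.1
  have tr2 : t * dist z p ≤ t * (dist z p' + dist p p') :=
    mul_le_mul_of_nonneg_left (by rw [dist_comm p p']; exact dist_triangle _ _ _) ht.1
  rcases abs_cases (t - t') with hc | hc
  · rw [hc.1] at dxy
    have : 0 ≤ (1 - σ) * (D' - s') := mul_nonneg (one_sub_mem hσ).1 (by linarith)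
    linarith
  · rw [hc.1] at dxy
    linarith

end Loc
end BS

open Metric Set
set_option linter.unusedSectionVars false

namespace BS
section Glob

variable {X : Type*} [MetricSpace X] [Surf X]

/-- possible centers -/
def Cen (S : Set X) : Set X := {c | ∃ a ∈ S, ∃ b ∈ S, ∃ t ∈ Icc (0:ℝ) 1, c = pt a b t}

lemma lemD' {S : Set X} (Y : Finset X) (hYS : ∀ y ∈ Y, y ∈ S) {δ : ℝ}
    (hY : ∀ a ∈ Y, ∀ b ∈ Y, dist a b ≤ 2 * δ) :
    ∃ T : Finset X, T.card ≤ 3 ∧ (∀ c ∈ T, c ∈ Cen S) ∧ ∀ y ∈ Y, ∃ c ∈ T, dist c y ≤ δ := by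
  classical
  rcases Y.eq_empty_or_nonempty with rfl | hne
  · exact ⟨∅, by simp, by simp, by simp⟩
  · obtain ⟨a, ha, b, hb, c, hc, h⟩ := lemD Y hne hY
    refine ⟨{mid a b, mid b c, mid c a}, Finset.card_le_three, ?_, ?_⟩
    · intro q hq
      simp only [Finset.mem_insert, Finset.mem_singleton] at hq
      rcases hq with rfl | rfl | rfl
      · exact ⟨a, hYS a ha, b, hYS b hb, 1/2, mem_half, rfl⟩
      · exact ⟨b, hYS b hb, c, hYS c hc, 1/2, mem_half, rfl⟩
      · exact ⟨c, hYS c hc, a, hYS a ha, 1/2, mem_half, rfl⟩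
    · intro y hy
      rcases h y hy with h | h | h
      · exact ⟨_, by simp, h⟩
      · exact ⟨mid b c, by simp, h⟩
      · exact ⟨mid c a, by simp, h⟩

lemma local19 {S : Set X} {δ : ℝ} (hδ : 0 < δ) (F : Finset X) (hFS : ∀ x ∈ F, x ∈ S) {z v : X} (hz : z ∈ S)
    (hv : v ∈ F) (hmax : ∀ x ∈ F, dist z x ≤ dist z v) :
    ∃ T : Finset X, T.card ≤ 19 ∧ (∀ c ∈ T, c ∈ Cen S) ∧
      ∀ x ∈ F, dist v x ≤ 2 * δ → ∃ c ∈ T, dist c x ≤ δ := by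
  classical
  by_cases hR : dist z v ≤ δ
  · refine ⟨{z}, by simp, ?_, fun x hx _ => ⟨z, by simp, (hmax x hx).trans hR⟩⟩
    intro c hc
    rw [Finset.mem_singleton] at hc
    exact ⟨z, hz, z, hz, 0, mem0, by simp [hc]⟩
  push Not at hR
  have hR0 : 0 < dist z v := hδ.trans hR
  have hτ : δ / dist z v ∈ Icc (0:ℝ) 1 := ⟨by positivity, by rw [div_le_one hR0]; exact hR.le⟩
  set u := pt v z (δ / dist z v) with hu
  have hb : Base z v u δ := ⟨hδ, pt_mem_seg _ _ hτ, by
    rw [hu, dist_left_pt _ _ hτ, dist_comm v z]; field_simp⟩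
  obtain ⟨P, hP⟩ := coloring hb
  let deep : X → Prop := fun x => δ < dist z v - dist z x
  let L : X → Prop := fun x => ∃ y, Fp z v u δ y ∧ deep y ∧ (P x ↔ P y) ∧ Far z v δ x y
  let kind : X → Fin 3 := fun x => if deep x then (if L x then 1 else 2) else 0
  let Y : Bool × Fin 3 → Finset X := fun k => F.filter (fun x => Fp z v u δ x ∧ (P x ↔ k.1 = true) ∧ kind x = k.2)
  have nofar : ∀ x y, Fp z v u δ x → Fp z v u δ y → (P x ↔ P y) → kind x = kind y → ¬ Far z v δ x y := by
    intro x y hx hy hc hk hf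
    have hdx : deep x := hf.deep hb hx hy
    by_cases hdy : deep y
    · have hLx : L x := ⟨y, hy, hdy, hc, hf⟩
      have hLy : L y := by
        by_contra hn
        simp only [kind, hdx, hdy, hLx, hn, if_true, if_false] at hk
        exact absurd hk (by decide)
      obtain ⟨w, hw, hdw, -, hfw⟩ := hLy
      exact hf.chain hb hx hy hw hfw hdw
    · simp only [kind, hdx, hdy, if_true, if_false] at hk
      split_ifs at hk <;> exact absurd hk (by decide)
  have hY : ∀ k, ∀ a ∈ Y k, ∀ b ∈ Y k, dist a b ≤ 2 * δ := by
    intro k a ha b hb'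
    by_contra hn
    push Not at hn
    obtain ⟨-, fa, ca, ka⟩ := Finset.mem_filter.1 ha
    obtain ⟨-, fb, cb, kb⟩ := Finset.mem_filter.1 hb'
    have hc : P a ↔ P b := ca.trans cb.symm
    rcases far_of hP fa fb hc hn with h | h
    · exact nofar a b fa fb hc (ka.trans kb.symm) h
    · exact nofar b a fb fa hc.symm (kb.trans ka.symm) h
  choose T hT1 hT2 hT3 using fun k => lemD' (S := S) (Y k) (fun y hy => hFS y (Finset.mem_filter.1 hy).1) (hY k)
  refine ⟨insert u (Finset.univ.biUnion T), ?_, ?_, ?_⟩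
  · refine (Finset.card_insert_le _ _).trans ?_
    have := Finset.card_biUnion_le_card_mul (Finset.univ : Finset (Bool × Fin 3)) T 3 (fun k _ => hT1 k)
    have hc : (Finset.univ : Finset (Bool × Fin 3)).card = 6 := by simp
    rw [hc] at this
    omega
  · intro c hc
    rcases Finset.mem_insert.1 hc with rfl | hc
    · exact ⟨v, hFS v hv, z, hz, _, hτ, rfl⟩
    · obtain ⟨k, -, hk⟩ := Finset.mem_biUnion.1 hc
      exact hT2 k c hk
  · intro x hx hvx
    by_cases hux : dist u x ≤ δ
    · exact ⟨u, Finset.mem_insert_self _ _, hux⟩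
    push Not at hux
    have hxk : x ∈ Y (decide (P x), kind x) :=
      Finset.mem_filter.2 ⟨hx, ⟨hmax x hx, hvx, hux⟩, by simp, rfl⟩
    obtain ⟨c, hc, hcx⟩ := hT3 _ x hxk
    exact ⟨c, Finset.mem_insert_of_mem (Finset.mem_biUnion.2 ⟨_, Finset.mem_univ _, hc⟩), hcx⟩

lemma greedy {S : Set X} {δ : ℝ} (hδ : 0 < δ) {z : X} (hz : z ∈ S) (n : ℕ) : ∀ F : Finset X, F.card = n →
    (∀ x ∈ F, x ∈ S) → ∃ P T : Finset X, (∀ x ∈ P, x ∈ F) ∧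
      ((P : Set X).Pairwise fun p q => 2 * δ < dist p q) ∧ T.card ≤ 19 * P.card ∧ (∀ c ∈ T, c ∈ Cen S) ∧
      ∀ x ∈ F, ∃ c ∈ T, dist c x ≤ δ := by
  classical
  induction n using Nat.strong_induction_on with
  | _ n ih =>
  intro F hn hFS
  rcases F.eq_empty_or_nonempty with rfl | hne
  · exact ⟨∅, ∅, by simp, by simp, by simp, by simp, by simp⟩
  obtain ⟨v, hv, hmax⟩ := Finset.exists_max_image F (fun x => dist z x) hne
  obtain ⟨T0, c0, i0, k0⟩ := local19 hδ F hFS hz hv hmax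
  set F1 := F.filter (fun x => 2 * δ < dist v x) with hF1
  have hlt : F1.card < n := by
    rw [← hn]
    apply Finset.card_lt_card
    rw [Finset.filter_ssubset]
    exact ⟨v, hv, by simp; positivity⟩
  obtain ⟨P, T, h1, h2, h3, h4, h5⟩ := ih _ hlt F1 rfl (fun x hx => hFS x (Finset.mem_filter.1 hx).1)
  have hvP : v ∉ P := fun h => by
    have := (Finset.mem_filter.1 (h1 v h)).2
    rw [dist_self] at this; linarith
  refine ⟨insert v P, T0 ∪ T, ?_, ?_, ?_, ?_, ?_⟩
  · intro x hx
    rcases Finset.mem_insert.1 hx with rfl | hx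
    · exact hv
    · exact (Finset.mem_filter.1 (h1 x hx)).1
  · rw [Finset.coe_insert]
    refine Set.pairwise_insert.2 ⟨h2, fun b hb _ => ?_⟩
    have hb2 := (Finset.mem_filter.1 (h1 b hb)).2
    exact ⟨hb2, by rw [dist_comm]; exact hb2⟩
  · rw [Finset.card_insert_of_notMem hvP]
    have := Finset.card_union_le T0 T
    omega
  · intro c hc
    rcases Finset.mem_union.1 hc with h | h
    · exact i0 c h
    · exact h4 c h
  · intro x hx
    by_cases hvx : dist v x ≤ 2 * δ
    · obtain ⟨c, hc, h⟩ := k0 x hx hvx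
      exact ⟨c, Finset.mem_union_left _ hc, h⟩
    · push Not at hvx
      obtain ⟨c, hc, h⟩ := h5 x (Finset.mem_filter.2 ⟨hx, hvx⟩)
      exact ⟨c, Finset.mem_union_right _ hc, h⟩

lemma cen_compact {S : Set X} (hS : IsCompact S) : IsCompact (Cen S) := by
  have : Cen S = (fun p : X × X × unitInterval => pt p.1 p.2.1 p.2.2) '' (S ×ˢ S ×ˢ univ) := by
    ext c
    constructor
    · rintro ⟨a, ha, b, hb, t, ht, rfl⟩
      exact ⟨(a, b, ⟨t, ht⟩), ⟨ha, hb, trivial⟩, rfl⟩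
    · rintro ⟨⟨a, b, t⟩, ⟨ha, hb, -⟩, rfl⟩
      exact ⟨a, ha, b, hb, t, t.2, rfl⟩
  rw [this]
  exact (hS.prod (hS.prod isCompact_univ)).image pt_cont

lemma limit {S : Set X} (hS : IsCompact S) {δ : ℝ} (m : ℕ)
    (h : ∀ F : Finset X, (∀ x ∈ F, x ∈ S) → ∃ T : Finset X, T.card ≤ m ∧ (∀ c ∈ T, c ∈ Cen S) ∧
      ∀ x ∈ F, ∃ c ∈ T, dist c x ≤ δ) (hne : S.Nonempty) :
    ∃ c : Fin m → X, ∀ x ∈ S, ∃ i, dist (c i) x ≤ δ := by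
  classical
  have hK : IsCompact (Set.univ.pi fun _ : Fin m => Cen S) := isCompact_univ_pi fun _ => cen_compact hS
  obtain ⟨z, hz⟩ := hne
  have := hK.inter_iInter_nonempty (fun x : S => {c : Fin m → X | ∃ i, dist (c i) x ≤ δ}) (by
    intro x
    have : {c : Fin m → X | ∃ i, dist (c i) x ≤ δ} = ⋃ i, {c : Fin m → X | dist (c i) x ≤ δ} := by
      ext c; simp
    rw [this]
    exact isClosed_iUnion_of_finite fun i => isClosed_le (by fun_prop) continuous_const) (by
    intro F
    obtain ⟨T, hT, hTc, hcov⟩ := h (F.image Subtype.val) (by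
      intro x hx
      obtain ⟨y, -, rfl⟩ := Finset.mem_image.1 hx
      exact y.2)
    have hex : ∃ c : Fin m → X, (∀ i, c i ∈ Cen S) ∧ ∀ q ∈ T, ∃ i, c i = q := by
      let l := T.toList
      refine ⟨fun i => l.getD i z, fun i => ?_, fun q hq => ?_⟩
      · by_cases hi : (i : ℕ) < l.length
        · beta_reduce
          rw [List.getD_eq_getElem _ _ hi]
          exact hTc _ (Finset.mem_toList.1 (List.getElem_mem hi))
        · beta_reduce
          rw [List.getD_eq_default _ _ (not_lt.1 hi)]
          exact ⟨z, hz, z, hz, 0, mem0, by simp⟩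
      · obtain ⟨i, hi, hq⟩ := List.getElem_of_mem (Finset.mem_toList.2 hq)
        refine ⟨⟨i, lt_of_lt_of_le hi (by rw [Finset.length_toList]; exact hT)⟩, ?_⟩
        simp only
        rw [List.getD_eq_getElem _ _ hi]; exact hq
    obtain ⟨c, hc1, hc2⟩ := hex
    refine ⟨c, fun i _ => hc1 i, ?_⟩
    simp only [Set.mem_iInter]
    intro x hx
    obtain ⟨q, hq, hqx⟩ := hcov x (Finset.mem_image.2 ⟨x, hx, rfl⟩)
    obtain ⟨i, rfl⟩ := hc2 q hq
    exact ⟨i, hqx⟩)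
  obtain ⟨c, -, hc⟩ := this
  refine ⟨c, fun x hx => ?_⟩
  exact Set.mem_iInter.1 hc ⟨x, hx⟩

lemma main (δ : ℝ) (hδ : 0 < δ) (S : Set X) (hS : IsCompact S) : covNum δ S ≤ 19 * packNum δ S := by
  classical
  rcases S.eq_empty_or_nonempty with rfl | hne
  · refine le_trans (sInf_le ⟨∅, Set.encard_empty, by simp⟩) (zero_le)
  by_cases htop : packNum δ S = ⊤
  · rw [htop]; simp
  obtain ⟨n, hn⟩ := ENat.ne_top_iff_exists.1 htop
  obtain ⟨z, hz⟩ := hne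
  obtain ⟨c, hc⟩ := limit hS (δ := δ) (19 * n) (fun F hF => by
    obtain ⟨P, T, h1, h2, h3, h4, h5⟩ := greedy hδ hz _ F rfl hF
    refine ⟨T, h3.trans ?_, h4, h5⟩
    have : (P.card : ℕ∞) ≤ packNum δ S :=
      le_sSup ⟨(P : Set X), fun x hx => hF x (h1 x hx), Set.encard_coe_eq_coe_finsetCard P, h2⟩
    rw [← hn] at this
    have : P.card ≤ n := by exact_mod_cast this
    omega) ⟨z, hz⟩
  rw [← hn]
  have h1 : covNum δ S ≤ (Set.range c).encard := sInf_le ⟨Set.range c, rfl, fun x hx => by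
    obtain ⟨i, hi⟩ := hc x hx
    simp only [Set.mem_iUnion]
    exact ⟨c i, ⟨i, rfl⟩, by rw [mem_closedBall, dist_comm]; exact hi⟩⟩
  refine h1.trans ?_
  rw [← Set.image_univ]
  refine (Set.encard_image_le _ _).trans ?_
  simp

end Glob
end BS

/-- covering–packing inequality on Busemann surfaces. -/
theorem covNum_le_19_mul_packNum_of_busemannSurface {X : Type*} [MetricSpace X]
    (hX : IsBusemannSurface X) (δ : ℝ) (hδ : 0 < δ) (S : Set X) (hS : IsCompact S) :
    covNum δ S ≤ 19 * packNum δ S := by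
  obtain ⟨hB, ⟨φ⟩⟩ := hX
  let e := Complex.orthonormalBasisOneI.repr
  letI : BS.Surf X :=
    { bus := hB
      f := fun x => e.symm (φ x)
      f_cont := e.symm.continuous.comp φ.continuous
      f_inj := e.symm.injective.comp φ.injective
      lc := φ.isClosedEmbedding.locallyCompactSpace }
  exact BS.main δ hδ S hS
end

section
/- Let P be a compact convex subset of a Busemann surface (𝒮,d) and let δ > 0. Then there exists a finite set T ⊆ P of cardinality at most 19·ν_δ(P) such that P is contained in the union of the closed balls of radius δ centered at the points of T; in particular ν_δ(P) ≤ ρ_δ(P) ≤ 19·ν_δ(P). -/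
open Metric Set

class BSurf (X : Type*) [MetricSpace X] : Prop where
  out : IsBusemannSurface X

section Geo
variable {X : Type*} [MetricSpace X]

/-- clamp to the unit interval -/
noncomputable def clp (t : ℝ) : ℝ := max 0 (min 1 t)

lemma clp_mem (t : ℝ) : clp t ∈ Icc (0:ℝ) 1 := by
  unfold clp; constructor
  · exact le_max_left _ _
  · exact max_le zero_le_one (min_le_left _ _)

lemma clp_of_mem {t : ℝ} (h : t ∈ Icc (0:ℝ) 1) : clp t = t := by
  unfold clp; rw [min_eq_right h.2, max_eq_right h.1]

lemma clp_cont : Continuous clp := by unfold clp; fun_prop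

open Classical in
/-- the point at fraction `t` of the geodesic from `a` to `b` -/
noncomputable def gp (a b : X) (t : ℝ) : X :=
  if h : ∃ γ : ℝ → X, IsGeodesicMap γ (dist a b) ∧ γ 0 = a ∧ γ (dist a b) = b then
    Classical.choose h (clp t * dist a b) else a

variable [BSurf X]

lemma gp_spec (a b : X) : ∃ γ : ℝ → X, (IsGeodesicMap γ (dist a b) ∧ γ 0 = a ∧ γ (dist a b) = b) ∧
    ∀ t, gp a b t = γ (clp t * dist a b) := by
  have h := (BSurf.out (X := X)).1.1 a b
  refine ⟨Classical.choose h, Classical.choose_spec h, fun t => ?_⟩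
  unfold gp; rw [dif_pos h]

lemma mul_mem_Icc {t l : ℝ} (ht : t ∈ Icc (0:ℝ) 1) (hl : 0 ≤ l) : t * l ∈ Icc 0 l :=
  ⟨mul_nonneg ht.1 hl, by nlinarith [ht.2]⟩

lemma dist_gp_gp (a b : X) (s t : ℝ) : dist (gp a b s) (gp a b t) = |clp s - clp t| * dist a b := by
  obtain ⟨γ, ⟨h1, h2, h3⟩, h4⟩ := gp_spec a b
  rw [h4, h4, h1 _ (mul_mem_Icc (clp_mem s) dist_nonneg) _ (mul_mem_Icc (clp_mem t) dist_nonneg),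
    ← sub_mul, abs_mul, abs_of_nonneg (dist_nonneg (x := a) (y := b))]

lemma zero_mem' : (0:ℝ) ∈ Icc (0:ℝ) 1 := ⟨le_rfl, zero_le_one⟩
lemma one_mem' : (1:ℝ) ∈ Icc (0:ℝ) 1 := ⟨zero_le_one, le_rfl⟩

@[simp] lemma gp_zero (a b : X) : gp a b 0 = a := by
  obtain ⟨γ, ⟨h1, h2, h3⟩, h4⟩ := gp_spec a b
  rw [h4, clp_of_mem zero_mem', zero_mul, h2]

@[simp] lemma gp_one (a b : X) : gp a b 1 = b := by
  obtain ⟨γ, ⟨h1, h2, h3⟩, h4⟩ := gp_spec a b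
  rw [h4, clp_of_mem one_mem', one_mul, h3]

lemma dist_left_gp (a b : X) {t : ℝ} (ht : t ∈ Icc (0:ℝ) 1) : dist a (gp a b t) = t * dist a b := by
  have := dist_gp_gp a b 0 t
  rw [gp_zero, clp_of_mem zero_mem', clp_of_mem ht, zero_sub, abs_neg, abs_of_nonneg ht.1] at this
  exact this

lemma dist_gp_right (a b : X) {t : ℝ} (ht : t ∈ Icc (0:ℝ) 1) :
    dist (gp a b t) b = (1 - t) * dist a b := by
  have := dist_gp_gp a b t 1
  rw [gp_one, clp_of_mem one_mem', clp_of_mem ht, abs_sub_comm, abs_of_nonneg (by linarith [ht.2])] at this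
  exact this

lemma gp_clp (a b : X) (t : ℝ) : gp a b t = gp a b (clp t) := by
  obtain ⟨γ, ⟨h1, h2, h3⟩, h4⟩ := gp_spec a b
  rw [h4, h4, clp_of_mem (clp_mem t)]

lemma gp_mem (a b : X) (t : ℝ) : gp a b t ∈ seg a b := by
  rw [gp_clp]
  show _ + _ = _
  rw [dist_left_gp a b (clp_mem t), dist_gp_right a b (clp_mem t)]; ring

lemma gp_comp (a b a' b' : X) {t : ℝ} (ht : t ∈ Icc (0:ℝ) 1) :
    dist (gp a b t) (gp a' b' t) ≤ (1 - t) * dist a a' + t * dist b b' := by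
  obtain ⟨γ, ⟨h1, h2, h3⟩, h4⟩ := gp_spec a b
  obtain ⟨γ', ⟨h1', h2', h3'⟩, h4'⟩ := gp_spec a' b'
  have := (BSurf.out (X := X)).1.2 γ γ' _ _ dist_nonneg dist_nonneg h1 h1' t ht
  rw [h2, h2', h3, h3'] at this
  rw [h4, h4', clp_of_mem ht]; exact this

lemma geo_unique {a b : X} {γ : ℝ → X} (h : IsGeodesicMap γ (dist a b)) (h0 : γ 0 = a)
    (h1 : γ (dist a b) = b) {t : ℝ} (ht : t ∈ Icc (0:ℝ) 1) : γ (t * dist a b) = gp a b t := by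
  obtain ⟨γ', ⟨h1', h2', h3'⟩, h4'⟩ := gp_spec a b
  have := (BSurf.out (X := X)).1.2 γ γ' _ _ dist_nonneg dist_nonneg h h1' t ht
  rw [h0, h1, h2', h3', dist_self, dist_self] at this
  rw [h4', clp_of_mem ht]
  exact dist_le_zero.1 (by linarith)

lemma mem_seg_gp {a b z : X} (hz : z ∈ seg a b) : ∃ t ∈ Icc (0:ℝ) 1, z = gp a b t := by
  change _ + _ = _ at hz
  rcases eq_or_ne a b with rfl | hab
  · rw [dist_self] at hz
    have : dist a z = 0 := by linarith [dist_nonneg (x := a) (y := z), dist_nonneg (x := z) (y := a)]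
    exact ⟨0, zero_mem', by rw [gp_zero]; exact (dist_eq_zero.1 this).symm⟩
  have hpos : 0 < dist a b := dist_pos.2 hab
  obtain ⟨γ, ⟨h1, h2, h3⟩, -⟩ := gp_spec a z
  obtain ⟨γ', ⟨h1', h2', h3'⟩, -⟩ := gp_spec z b
  set l := dist a z
  have hl : 0 ≤ l := dist_nonneg
  have hl' : l ≤ dist a b := by linarith [dist_nonneg (x := z) (y := b)]
  let G : ℝ → X := fun s => if s ≤ l then γ s else γ' (s - l)
  have key : ∀ s t, s ∈ Icc (0:ℝ) (dist a b) → t ∈ Icc (0:ℝ) (dist a b) → s ≤ t →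
      dist (G s) (G t) = t - s := by
    intro s t hs ht hst
    by_cases c1 : t ≤ l
    · have c2 : s ≤ l := hst.trans c1
      simp only [G, if_pos c1, if_pos c2]
      rw [h1 s ⟨hs.1, c2⟩ t ⟨ht.1, c1⟩, abs_sub_comm, abs_of_nonneg (by linarith)]
    · by_cases c2 : s ≤ l
      · simp only [G, if_neg c1, if_pos c2]
        push Not at c1
        have mt : t - l ∈ Icc 0 (dist z b) := ⟨by linarith, by linarith [ht.2]⟩
        have e1 := h1 s ⟨hs.1, c2⟩ l ⟨hl, le_rfl⟩
        have e2 := h1' 0 ⟨le_rfl, dist_nonneg⟩ (t - l) mt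
        have e3 := h1 0 ⟨le_rfl, hl⟩ s ⟨hs.1, c2⟩
        have e4 := h1' (t - l) mt (dist z b) ⟨dist_nonneg, le_rfl⟩
        rw [h3, abs_sub_comm, abs_of_nonneg (by linarith)] at e1
        rw [h2', abs_sub_comm, abs_of_nonneg (by linarith [mt.1])] at e2
        rw [h2, abs_sub_comm, abs_of_nonneg (by linarith [hs.1])] at e3
        rw [h3', abs_sub_comm, abs_of_nonneg (by linarith [mt.2])] at e4
        have t1 := dist_triangle (γ s) z (γ' (t - l))
        have t2 := dist_triangle4 a (γ s) (γ' (t - l)) b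
        apply le_antisymm <;> linarith
      · simp only [G, if_neg c1, if_neg c2]
        push Not at c1 c2
        rw [h1' _ ⟨by linarith, by linarith [hs.2]⟩ _ ⟨by linarith, by linarith [ht.2]⟩,
          abs_sub_comm, abs_of_nonneg (by linarith)]; ring
  have hG : IsGeodesicMap G (dist a b) := by
    intro s hs t ht
    rcases le_total s t with h | h
    · rw [key s t hs ht h, abs_sub_comm, abs_of_nonneg (by linarith)]
    · rw [dist_comm, key t s ht hs h, abs_of_nonneg (by linarith)]
  have hG0 : G 0 = a := by simp only [G, if_pos hl, h2]
  have hG1 : G (dist a b) = b := by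
    by_cases c : dist a b ≤ l
    · have e : dist z b = 0 := by linarith [dist_nonneg (x := z) (y := b)]
      have e' : dist a b = l := by linarith
      simp only [G, if_pos c]; rw [e', h3]; exact dist_eq_zero.1 e
    · simp only [G, if_neg c]
      rw [show dist a b - l = dist z b by linarith, h3']
  have ht : l / dist a b ∈ Icc (0:ℝ) 1 := ⟨by positivity, by rw [div_le_one hpos]; exact hl'⟩
  refine ⟨l / dist a b, ht, ?_⟩
  rw [← geo_unique hG hG0 hG1 ht, div_mul_cancel₀ _ hpos.ne']
  simp only [G, if_pos le_rfl, h3]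

lemma seg_comm' (a b : X) : seg a b = seg b a := by
  ext z; simp only [seg, mem_setOf_eq, dist_comm b, dist_comm _ a]
  rw [add_comm]

lemma seg_symm {a b z : X} (h : z ∈ seg a b) : z ∈ seg b a := by rwa [seg_comm']

lemma left_mem_seg (a b : X) : a ∈ seg a b := by simp [seg]
lemma right_mem_seg (a b : X) : b ∈ seg a b := by simp [seg]

lemma seg_self {a z : X} (h : z ∈ seg a a) : z = a := by
  change _ + _ = _ at h
  rw [dist_self] at h
  exact dist_le_zero.1 (by linarith [dist_nonneg (x := a) (y := z)])

lemma seg_eq {a b y z : X} (hy : y ∈ seg a b) (hz : z ∈ seg a b) (h : dist a y = dist a z) : y = z := by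
  obtain ⟨s, hs, rfl⟩ := mem_seg_gp hy
  obtain ⟨t, ht, rfl⟩ := mem_seg_gp hz
  rw [dist_left_gp _ _ hs, dist_left_gp _ _ ht] at h
  apply dist_le_zero.1
  rw [dist_gp_gp, clp_of_mem hs, clp_of_mem ht]
  have : (s - t) * dist a b = 0 := by linarith
  rcases mul_eq_zero.1 this with h | h <;> simp [h]

lemma seg_sub {a b z y : X} (hz : z ∈ seg a b) (hy : y ∈ seg a z) : y ∈ seg a b := by
  change _ + _ = _ at *
  apply le_antisymm _ (dist_triangle _ _ _)
  linarith [dist_triangle y z b]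

lemma seg_tail {a b z y : X} (hz : z ∈ seg a b) (hy : y ∈ seg a z) : z ∈ seg y b := by
  change _ + _ = _ at *
  apply le_antisymm _ (dist_triangle _ _ _)
  linarith [dist_triangle a y b]

lemma seg_sub_right {a b z y : X} (hz : z ∈ seg a b) (hy : y ∈ seg z b) : y ∈ seg a b :=
  seg_symm (seg_sub (seg_symm hz) (seg_symm hy))

lemma seg_head {a b z y : X} (hz : z ∈ seg a b) (hy : y ∈ seg z b) : z ∈ seg a y :=
  seg_symm (seg_tail (seg_symm hz) (seg_symm hy))

lemma seg_total {a b y z : X} (hy : y ∈ seg a b) (hz : z ∈ seg a b) : y ∈ seg a z ∨ z ∈ seg a y := by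
  obtain ⟨s, hs, rfl⟩ := mem_seg_gp hy
  obtain ⟨t, ht, rfl⟩ := mem_seg_gp hz
  rcases le_total s t with h | h
  · left
    show _ + _ = _
    rw [dist_left_gp _ _ hs, dist_left_gp _ _ ht, dist_gp_gp, clp_of_mem hs, clp_of_mem ht,
      abs_sub_comm, abs_of_nonneg (by linarith)]; ring
  · right
    show _ + _ = _
    rw [dist_left_gp _ _ hs, dist_left_gp _ _ ht, dist_gp_gp, clp_of_mem hs, clp_of_mem ht,
      abs_sub_comm, abs_of_nonneg (by linarith)]; ring

/-- both points on `[a,b]`: splitting at `y` -/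
lemma seg_split {a b y z : X} (hy : y ∈ seg a b) (hz : z ∈ seg a b) : z ∈ seg a y ∨ z ∈ seg y b := by
  rcases seg_total hy hz with h | h
  · right; exact seg_tail hz h
  · left; exact h

lemma gp_symm (a b : X) {t : ℝ} (ht : t ∈ Icc (0:ℝ) 1) : gp b a (1 - t) = gp a b t := by
  have ht' : 1 - t ∈ Icc (0:ℝ) 1 := ⟨by linarith [ht.2], by linarith [ht.1]⟩
  apply seg_eq (a := a) (b := b) (seg_symm (gp_mem _ _ _)) (gp_mem _ _ _)
  rw [dist_left_gp _ _ ht, dist_comm, dist_gp_right _ _ ht', dist_comm b a]; ring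

lemma gp_cont : Continuous (fun x : (X × X) × ℝ => gp x.1.1 x.1.2 x.2) := by
  rw [continuous_iff_continuousAt]
  rintro ⟨⟨a, b⟩, t⟩
  unfold ContinuousAt
  rw [tendsto_iff_dist_tendsto_zero]
  have hlim : Filter.Tendsto (fun x : (X × X) × ℝ => dist x.1.1 a + dist x.1.2 b + |clp x.2 - clp t| * dist a b)
      (nhds ((a, b), t)) (nhds 0) := by
    have : Continuous (fun x : (X × X) × ℝ => dist x.1.1 a + dist x.1.2 b + |clp x.2 - clp t| * dist a b) := by
      have := clp_cont; fun_prop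
    simpa using this.tendsto ((a, b), t)
  refine squeeze_zero (fun _ => dist_nonneg) (fun x => ?_) hlim
  obtain ⟨⟨a', b'⟩, t'⟩ := x
  simp only
  have h1 := gp_comp a' b' a b (clp_mem t')
  rw [← gp_clp, ← gp_clp] at h1
  have h2 := dist_gp_gp a b t' t
  have h3 := dist_triangle (gp a' b' t') (gp a b t') (gp a b t)
  have h4 := clp_mem t'
  nlinarith [h4.1, h4.2, dist_nonneg (x := a') (y := a), dist_nonneg (x := b') (y := b)]

lemma dist_gp_le (u a b : X) {t : ℝ} (ht : t ∈ Icc (0:ℝ) 1) :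
    dist u (gp a b t) ≤ (1 - t) * dist u a + t * dist u b := by
  have h := gp_comp u u a b ht
  have : gp u u t = u := seg_self (gp_mem u u t)
  rwa [this] at h

/-- closed balls are convex -/
lemma seg_ball {u a b w : X} {R : ℝ} (hw : w ∈ seg a b) (ha : dist u a ≤ R) (hb : dist u b ≤ R) :
    dist u w ≤ R := by
  obtain ⟨t, ht, rfl⟩ := mem_seg_gp hw
  have := dist_gp_le u a b ht
  nlinarith [ht.1, ht.2]

lemma gp_sub {a b : X} {s t : ℝ} (hs : s ∈ Icc (0:ℝ) 1) (ht : t ∈ Icc (0:ℝ) 1) (hst : s ≤ t) :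
    gp a b s ∈ seg a (gp a b t) := by
  show _ + _ = _
  rw [dist_left_gp _ _ hs, dist_left_gp _ _ ht, dist_gp_gp, clp_of_mem hs, clp_of_mem ht,
      abs_sub_comm, abs_of_nonneg (by linarith)]; ring

/-- a point at prescribed distance -/
lemma exists_at {a b : X} {e : ℝ} (h0 : 0 ≤ e) (h1 : e ≤ dist a b) : ∃ c ∈ seg a b, dist a c = e := by
  rcases eq_or_lt_of_le (dist_nonneg (x := a) (y := b)) with h | h
  · exact ⟨a, left_mem_seg _ _, by rw [dist_self]; linarith⟩
  · have ht : e / dist a b ∈ Icc (0:ℝ) 1 := ⟨by positivity, by rw [div_le_one h]; exact h1⟩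
    exact ⟨gp a b (e / dist a b), gp_mem _ _ _, by rw [dist_left_gp _ _ ht, div_mul_cancel₀ _ h.ne']⟩

end Geo


section Theta
variable {X : Type*} [MetricSpace X] [BSurf X]

lemma exists_planar : ∃ f : X → ℂ, Continuous f ∧ Function.Injective f := by
  obtain ⟨e⟩ := (BSurf.out (X := X)).2
  refine ⟨fun x => (e x 0 : ℂ) + (e x 1 : ℂ) * Complex.I, by fun_prop, fun x y h => ?_⟩
  apply e.injective
  have h0 := congrArg Complex.re h
  have h1 := congrArg Complex.im h
  simp at h0 h1
  ext i; fin_cases i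
  · exact h0
  · exact h1

/-- a planar chart -/
noncomputable def hh : X → ℂ := Classical.choose (exists_planar (X := X))
lemma hh_cont : Continuous (hh : X → ℂ) := (Classical.choose_spec (exists_planar (X := X))).1
lemma hh_inj : Function.Injective (hh : X → ℂ) := (Classical.choose_spec (exists_planar (X := X))).2

lemma hh_sub_ne {a b : X} (h : a ≠ b) : hh a - hh b ≠ 0 := sub_ne_zero.2 (fun e => h (hh_inj e))

lemma exp_lift (f : ℝ × ℝ → ℂ) (hf : Continuous f) (h0 : ∀ x, f x ≠ 0) :
    ∃ F : ℝ × ℝ → ℂ, Continuous F ∧ ∀ x, Complex.exp (F x) = f x := by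
  obtain ⟨F, hF, -⟩ := Complex.isCoveringMap_exp.existsUnique_continuousMap_lifts
    (A := ℝ × ℝ) ⟨fun x => (⟨f x, h0 x⟩ : {z : ℂ // z ≠ 0}), by fun_prop⟩ (0, 0)
    (Complex.log (f (0, 0))) (by ext; simp [Complex.exp_log (h0 _)])
  refine ⟨F, F.continuous, fun x => ?_⟩
  have := congrFun hF.2 x
  simpa using congrArg Subtype.val this

lemma exp_const {f : ℝ → ℂ} (hf : Continuous f) {c : ℂ} (h : ∀ s, Complex.exp (f s) = c) (s t : ℝ) :
    f s = f t := by
  have := Complex.isCoveringMap_exp.eq_of_comp_eq (A := ℝ) hf (continuous_const (y := f t))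
    (by ext x; simp [h]) t rfl
  exact congrFun this s

lemma exists_log {z a b : X} (hz : z ∉ seg a b) : ∃ L : ℝ → ℂ, Continuous L ∧
    ∀ t, Complex.exp (L t) = hh (gp a b t) - hh z := by
  obtain ⟨F, hF, hF'⟩ := exp_lift (fun x => hh (gp a b x.2) - hh z)
    ((hh_cont.comp (gp_cont.comp (by fun_prop : Continuous (fun x : ℝ × ℝ => ((a, b), x.2))))).sub
      continuous_const) (fun x => hh_sub_ne (fun e => hz (e ▸ gp_mem a b x.2)))
  exact ⟨fun t => F (0, t), by fun_prop, fun t => hF' (0, t)⟩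

open Classical in
/-- total change of the complex logarithm of `hh · - hh z` along the geodesic from `a` to `b` -/
noncomputable def th (z a b : X) : ℂ :=
  if h : z ∉ seg a b then Classical.choose (exists_log h) 1 - Classical.choose (exists_log h) 0 else 0

lemma th_eq {z a b : X} (hz : z ∉ seg a b) {L : ℝ → ℂ} (hL : Continuous L)
    (h : ∀ t, Complex.exp (L t) = hh (gp a b t) - hh z) : th z a b = L 1 - L 0 := by
  unfold th
  rw [dif_pos hz]
  obtain ⟨c1, c2⟩ := Classical.choose_spec (exists_log hz)
  have hne : ∀ t, hh (gp a b t) - hh z ≠ 0 := fun t => hh_sub_ne (fun e => hz (e ▸ gp_mem a b t))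
  have := exp_const (c := 1) (c1.sub hL) (fun s => by
    simp only [Pi.sub_apply]
    rw [Complex.exp_sub, c2, h, div_self (hne s)]) 1 0
  simp only [Pi.sub_apply] at this
  linear_combination this

lemma exp_th {z a b : X} (hz : z ∉ seg a b) :
    Complex.exp (th z a b) = (hh b - hh z) / (hh a - hh z) := by
  obtain ⟨L, hL, h⟩ := exists_log hz
  rw [th_eq hz hL h, Complex.exp_sub, h, h, gp_one, gp_zero]

lemma th_self (z a : X) : th z a a = 0 := by
  by_cases hz : z ∉ seg a a
  · have hza : a ≠ z := fun e => hz (e ▸ left_mem_seg a a)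
    rw [th_eq hz (L := fun _ => Complex.log (hh a - hh z)) continuous_const, sub_self]
    intro t
    rw [Complex.exp_log (hh_sub_ne hza), seg_self (gp_mem a a t)]
  · unfold th; rw [dif_neg hz]

lemma th_symm (z a b : X) : th z b a = - th z a b := by
  by_cases hz : z ∉ seg a b
  · obtain ⟨L, hL, h⟩ := exists_log hz
    rw [th_eq hz hL h, th_eq (by rwa [seg_comm']) (L := fun t => L (1 - t)) (by fun_prop)]
    · norm_num
    · intro t
      rw [h]
      congr 2
      have e : clp (1 - t) = 1 - clp t := by
        unfold clp
        rcases le_total t 0 with h | h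
        · rw [min_eq_left (by linarith), min_eq_right (by linarith), max_eq_left h]; norm_num
        · rcases le_total t 1 with h' | h'
          · rw [min_eq_right (by linarith), min_eq_right (by linarith), max_eq_right h,
              max_eq_right (by linarith)]
          · rw [min_eq_right (by linarith), min_eq_left (by linarith), max_eq_left (by linarith)]; norm_num
      rw [gp_clp a b, gp_clp b a t, e, gp_symm b a (clp_mem t)]
  · have hz' : ¬ z ∉ seg b a := by rwa [seg_comm']
    unfold th; rw [dif_neg hz, dif_neg hz', neg_zero]

lemma th_cont {z a b : ℝ → X} (hz : Continuous z) (ha : Continuous a) (hb : Continuous b)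
    (h : ∀ s, z s ∉ seg (a s) (b s)) : Continuous (fun s => th (z s) (a s) (b s)) := by
  obtain ⟨F, hF, hF'⟩ := exp_lift (fun x => hh (gp (a x.1) (b x.1) x.2) - hh (z x.1))
    ((hh_cont.comp (gp_cont.comp (by fun_prop : Continuous
      (fun x : ℝ × ℝ => ((a x.1, b x.1), x.2))))).sub (hh_cont.comp (by fun_prop)))
    (fun x => hh_sub_ne (fun e => h x.1 (e ▸ gp_mem _ _ x.2)))
  have : (fun s => th (z s) (a s) (b s)) = fun s => F (s, 1) - F (s, 0) := by
    ext s
    exact th_eq (h s) (L := fun t => F (s, t)) (by fun_prop) (fun t => hF' (s, t))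
  rw [this]; fun_prop

lemma gp_path (a b : X) : Continuous (fun s => gp a b s) :=
  gp_cont.comp (by fun_prop : Continuous (fun s : ℝ => ((a, b), s)))

end Theta


section Top
variable {X : Type*} [MetricSpace X] [BSurf X]

noncomputable def sg (u v p : X) : ℂ := th u v p - th v u p + th p u v

noncomputable def FF (u v p q : X) : ℂ :=
  th p u q - th v u q + th u v p + th q u v - th q u p

def Cu (u v p : X) : Set X := {q | ∃ w ∈ seg v p, q ∈ seg u w}

def gtu (u v q p : X) : Prop := (∀ x ∈ seg u q, x ∉ seg v p) ∧ q ∉ Cu u v p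

def Ad (u v m q : X) : Prop :=
  (∀ x ∈ seg u q, x ∉ seg v m) ∧ (∀ x ∈ seg v q, x ∉ seg u m)

lemma FF_add (u v p q : X) : FF u v p q + FF u v q p = sg u v p + sg u v q := by
  unfold FF sg; ring

lemma sg_swap (u v p : X) : sg v u p = - sg u v p := by
  unfold sg; rw [th_symm p u v]; ring

lemma ne_of_not_left {z a b : X} (h : z ∉ seg a b) : a ≠ z := fun e => h (e ▸ left_mem_seg _ _)
lemma ne_of_not_right {z a b : X} (h : z ∉ seg a b) : b ≠ z := fun e => h (e ▸ right_mem_seg _ _)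

lemma exp_sg {u v p : X} (h1 : u ∉ seg v p) (h2 : v ∉ seg u p) (h3 : p ∉ seg u v) :
    Complex.exp (sg u v p) = -1 := by
  unfold sg
  rw [Complex.exp_add, Complex.exp_sub, exp_th h1, exp_th h2, exp_th h3]
  have n1 := hh_sub_ne (ne_of_not_left h1)
  have n2 := hh_sub_ne (ne_of_not_left h2)
  have n3 := hh_sub_ne (ne_of_not_left h3)
  have n4 := hh_sub_ne (ne_of_not_right h2)
  field_simp
  ring

lemma sg_ne {u v p : X} (h1 : u ∉ seg v p) (h2 : v ∉ seg u p) (h3 : p ∉ seg u v) :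
    sg u v p ≠ 0 := by
  intro h
  have := exp_sg h1 h2 h3
  rw [h, Complex.exp_zero] at this
  norm_num at this

lemma sg_im_ne {u v p : X} (h1 : u ∉ seg v p) (h2 : v ∉ seg u p) (h3 : p ∉ seg u v) :
    (sg u v p).im ≠ 0 := by
  intro h
  have e := exp_sg h1 h2 h3
  have hr : (sg u v p).re = 0 := by
    have := congrArg (‖·‖) e
    simp only [Complex.norm_exp, norm_neg, norm_one] at this
    simpa using this
  exact sg_ne h1 h2 h3 (Complex.ext hr h)

lemma exp_FF {u v p q : X} (h1 : p ∉ seg u q) (h2 : q ∉ seg u p) (h3 : v ∉ seg u q)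
    (h4 : u ∉ seg v p) (h5 : q ∉ seg u v) : Complex.exp (FF u v p q) = 1 := by
  unfold FF
  rw [Complex.exp_sub, Complex.exp_add, Complex.exp_add, Complex.exp_sub, exp_th h1, exp_th h2,
    exp_th h3, exp_th h4, exp_th h5]
  have n1 := hh_sub_ne (ne_of_not_left h1)
  have n1' := hh_sub_ne (ne_of_not_right h1)
  have n2 := hh_sub_ne (ne_of_not_left h2)
  have n2' := hh_sub_ne (ne_of_not_right h2)
  have n3 := hh_sub_ne (ne_of_not_left h3)
  have n4 := hh_sub_ne (ne_of_not_left h4)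
  have n5 := hh_sub_ne (ne_of_not_left h5)
  have n6 := hh_sub_ne (ne_of_not_right h3)
  field_simp
  ring

lemma FF_const {u v : X} {p q : ℝ → X} (hp : Continuous p) (hq : Continuous q)
    (h1 : ∀ s, p s ∉ seg u (q s)) (h2 : ∀ s, q s ∉ seg u (p s)) (h3 : ∀ s, v ∉ seg u (q s))
    (h4 : ∀ s, u ∉ seg v (p s)) (h5 : ∀ s, q s ∉ seg u v) :
    FF u v (p 0) (q 0) = FF u v (p 1) (q 1) := by
  have c : ∀ x : X, Continuous (fun _ : ℝ => x) := fun x => continuous_const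
  have hc : Continuous (fun s => FF u v (p s) (q s)) := by
    unfold FF
    exact ((((th_cont hp (c u) hq h1).sub (th_cont (c v) (c u) hq h3)).add
      (th_cont (c u) (c v) hp h4)).add (th_cont hq (c u) (c v) h5)).sub (th_cont hq (c u) hp h2)
  exact exp_const hc (fun s => exp_FF (h1 s) (h2 s) (h3 s) (h4 s) (h5 s)) 0 1

lemma sg_const {u v a b : X} (h1 : ∀ y ∈ seg a b, u ∉ seg v y) (h2 : ∀ y ∈ seg a b, v ∉ seg u y)
    (h3 : ∀ y ∈ seg a b, y ∉ seg u v) : sg u v a = sg u v b := by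
  have c : ∀ x : X, Continuous (fun _ : ℝ => x) := fun x => continuous_const
  have hp := gp_path a b
  have hc : Continuous (fun s => sg u v (gp a b s)) := by
    unfold sg
    exact ((th_cont (c u) (c v) hp (fun s => h1 _ (gp_mem _ _ s))).sub
      (th_cont (c v) (c u) hp (fun s => h2 _ (gp_mem _ _ s)))).add
      (th_cont hp (c u) (c v) (fun s => h3 _ (gp_mem _ _ s)))
  have := exp_const hc (fun s => exp_sg (h1 _ (gp_mem _ _ s)) (h2 _ (gp_mem _ _ s))
    (h3 _ (gp_mem _ _ s))) 0 1
  simpa using this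

lemma FF_const_q {u v p a b : X} (h1 : ∀ y ∈ seg a b, p ∉ seg u y) (h2 : ∀ y ∈ seg a b, y ∉ seg u p)
    (h3 : ∀ y ∈ seg a b, v ∉ seg u y) (h4 : u ∉ seg v p) (h5 : ∀ y ∈ seg a b, y ∉ seg u v) :
    FF u v p a = FF u v p b := by
  have := FF_const (u := u) (v := v) (p := fun _ => p) (q := gp a b) continuous_const (gp_path a b)
    (fun s => h1 _ (gp_mem _ _ s)) (fun s => h2 _ (gp_mem _ _ s)) (fun s => h3 _ (gp_mem _ _ s))
    (fun s => h4) (fun s => h5 _ (gp_mem _ _ s))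
  simpa using this

lemma L1 {u v p q : X} (h : gtu u v q p) (h1 : u ∉ seg v p) (h2 : v ∉ seg u q) (h3 : q ∉ seg u v) :
    FF u v p q = 0 := by
  have := FF_const (u := u) (v := v) (p := gp v p) (q := fun _ => q) (gp_path v p) continuous_const
    (fun s hs => h.1 _ hs (gp_mem _ _ s)) (fun s hs => h.2 ⟨_, gp_mem v p s, hs⟩) (fun s => h2)
    (fun s hs => h1 (seg_sub (gp_mem v p s) hs)) (fun s => h3)
  simp only [gp_zero, gp_one] at this
  rw [← this]
  unfold FF
  rw [th_self]; ring

lemma Ad.h1 {u v m q : X} (h : Ad u v m q) : u ∉ seg v q := fun e => h.2 _ e (left_mem_seg _ _)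
lemma Ad.h2 {u v m q : X} (h : Ad u v m q) : v ∉ seg u q := fun e => h.1 _ e (left_mem_seg _ _)
lemma Ad.h3 {u v m q : X} (hm : m ∈ seg u v) (h : Ad u v m q) : q ∉ seg u v := by
  intro e
  rcases seg_split hm e with h' | h'
  · exact h.2 _ (right_mem_seg _ _) h'
  · exact h.1 _ (right_mem_seg _ _) (seg_symm h')

lemma Ad.swap {u v m q : X} (h : Ad u v m q) : Ad v u m q := ⟨h.2, h.1⟩

lemma Cu_sub {u v w r : X} (hw : w ∈ seg v r) : Cu u v w ⊆ Cu u v r :=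
  fun _ ⟨w', h1, h2⟩ => ⟨w', seg_sub hw h1, h2⟩

lemma L3 {u v m p q r : X} (hm : m ∈ seg u v) (hp : Ad u v m p) (hq : Ad u v m q)
    (hr : Ad u v m r) (hs : sg u v p + sg u v q ≠ 0) (hpq : gtu u v p q) (hqr : gtu u v q r) :
    gtu u v p r := by
  -- the two bad configurations lead to the same contradiction
  have fin : ∀ w ∈ seg v r, FF u v q w = FF u v q p → sg u v w = sg u v p → False := by
    intro w hw e1 e2
    have a1 := L1 hpq hq.h1 hp.h2 (hp.h3 hm)
    have a2 : FF u v w q = 0 := L1 ⟨fun x hx hx' => hqr.1 x hx (seg_sub hw hx'),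
      fun hx => hqr.2 (Cu_sub hw hx)⟩ (fun hx => hr.h1 (seg_sub hw hx)) hq.h2 (hq.h3 hm)
    have a3 := FF_add u v q w
    rw [e1, e2, a1, a2] at a3
    apply hs
    rw [add_comm, ← a3, add_zero]
  constructor
  · intro w hw1 hw2
    have hy1 : ∀ y ∈ seg w p, y ∈ seg u p := fun y hy => seg_sub_right hw1 hy
    have hy2 : ∀ y ∈ seg w p, w ∈ seg u y := fun y hy => seg_head hw1 hy
    have k3 : ∀ y ∈ seg w p, v ∉ seg u y := fun y hy e => hp.h2 (seg_sub (hy1 y hy) e)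
    have k5 : ∀ y ∈ seg w p, y ∉ seg u v := by
      intro y hy e
      have hwv : w ∈ seg u v := seg_sub e (hy2 y hy)
      rcases seg_split hm hwv with h | h
      · exact hr.2 _ hw2 h
      · exact hp.1 _ hw1 (seg_symm h)
    have kd : ∀ y ∈ seg w p, u ∉ seg v y := by
      intro y hy e
      -- u ∈ [v,y], w ∈ [u,y] so u ∈ [v,w]
      exact hr.h1 (seg_sub hw2 (seg_head e (hy2 y hy)))
    refine fin w hw2 (FF_const_q ?_ ?_ k3 hq.h1 k5) (sg_const kd k3 k5)
    · intro y hy e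
      exact hpq.1 _ (seg_sub (hy1 y hy) e) (right_mem_seg _ _)
    · intro y hy e
      exact hqr.1 w (seg_sub e (hy2 y hy)) hw2
  · rintro ⟨w, hw2, hw1⟩
    have hy1 : ∀ y ∈ seg w p, y ∈ seg u w := fun y hy => seg_sub_right hw1 (seg_symm hy)
    have hy2 : ∀ y ∈ seg w p, p ∈ seg u y := fun y hy => seg_head hw1 (seg_symm hy)
    have k3 : ∀ y ∈ seg w p, v ∉ seg u y := by
      intro y hy e
      rcases seg_total e (hy2 y hy) with h | h
      · exact hp.h2 h
      · exact hp.h3 hm h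
    have k5 : ∀ y ∈ seg w p, y ∉ seg u v := fun y hy e => hp.h3 hm (seg_sub e (hy2 y hy))
    have kd : ∀ y ∈ seg w p, u ∉ seg v y := fun y hy e => hp.h1 (seg_head e (hy2 y hy))
    refine fin w hw2 (FF_const_q ?_ ?_ k3 hq.h1 k5) (sg_const kd k3 k5)
    · intro y hy e
      exact hqr.2 ⟨w, hw2, seg_sub (hy1 y hy) e⟩
    · intro y hy e
      exact hpq.2 ⟨q, right_mem_seg _ _, seg_sub e (hy2 y hy)⟩

lemma L4 {u v m : X} (hm : m ∈ seg u v) (S : Finset X) (hS : S.Nonempty) (hA : ∀ p ∈ S, Ad u v m p)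
    (hs : ∀ p ∈ S, ∀ q ∈ S, sg u v p + sg u v q ≠ 0) :
    ∃ j ∈ S, ∀ q ∈ S, (∃ w, w ∈ seg u q ∧ w ∈ seg v j) ∨ q ∈ Cu u v j := by
  let r : {x // x ∈ S} → {x // x ∈ S} → Prop := fun a b => gtu u v a.1 b.1
  have : IsTrans _ r := ⟨fun a b c h h' => L3 hm (hA _ a.2) (hA _ b.2) (hA _ c.2)
    (hs _ a.2 _ b.2) h h'⟩
  have : Std.Irrefl r := ⟨fun a h => h.2 ⟨_, right_mem_seg _ _, right_mem_seg _ _⟩⟩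
  have wf : WellFounded r := Finite.wellFounded_of_trans_of_irrefl r
  obtain ⟨x, hx⟩ := hS
  obtain ⟨j, -, hj⟩ := wf.has_min univ ⟨⟨x, hx⟩, trivial⟩
  refine ⟨j.1, j.2, fun q hq => ?_⟩
  have := hj ⟨q, hq⟩ trivial
  by_contra hcon
  push Not at hcon
  exact this ⟨hcon.1, hcon.2⟩

lemma square {a b c d : X} (h : ∀ x ∈ seg a b, x ∉ seg c d) :
    th a c d + th d a b - th b c d - th c a b = 0 := by
  have c' : ∀ x : X, Continuous (fun _ : ℝ => x) := fun x => continuous_const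
  have hp := gp_path a b
  have k0 : a ∉ seg c d := h _ (left_mem_seg _ _)
  have k1 : ∀ s, d ∉ seg a (gp a b s) := fun s hs => h _ (seg_sub (gp_mem _ _ s) hs) (right_mem_seg _ _)
  have k2 : ∀ s, gp a b s ∉ seg c d := fun s => h _ (gp_mem _ _ s)
  have k3 : ∀ s, c ∉ seg a (gp a b s) := fun s hs => h _ (seg_sub (gp_mem _ _ s) hs) (left_mem_seg _ _)
  have hc : Continuous (fun s => th a c d + th d a (gp a b s) - th (gp a b s) c d - th c a (gp a b s)) :=
    ((continuous_const.add (th_cont (c' d) (c' a) hp k1)).sub (th_cont hp (c' c) (c' d) k2)).sub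
      (th_cont (c' c) (c' a) hp k3)
  have := exp_const hc (c := 1) (fun s => by
    rw [Complex.exp_sub, Complex.exp_sub, Complex.exp_add, exp_th k0, exp_th (k1 s), exp_th (k2 s),
      exp_th (k3 s)]
    have n1 := hh_sub_ne (ne_of_not_left k0)
    have n1' := hh_sub_ne (ne_of_not_right k0)
    have n2 := hh_sub_ne (ne_of_not_left (k1 s))
    have n2' := hh_sub_ne (ne_of_not_right (k1 s))
    have n3 := hh_sub_ne (ne_of_not_left (k2 s))
    have n3' := hh_sub_ne (ne_of_not_right (k2 s))
    have n4 := hh_sub_ne (ne_of_not_left (k3 s))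
    have n4' := hh_sub_ne (ne_of_not_right (k3 s))
    field_simp
    ring) 1 0
  simp only [gp_one, gp_zero, th_self] at this
  rw [this]; ring

lemma L5 {u v m p q : X} (hm : m ∈ seg u v) (hp : Ad u v m p) (hq : Ad u v m q)
    (hC : q ∈ Cu u v p) (hd : ∀ x ∈ seg u q, x ∉ seg v p) : q ∈ Cu v u p := by
  by_cases hqp : q ∈ seg u p
  · exact ⟨q, hqp, right_mem_seg _ _⟩
  obtain ⟨w, hw, hqw⟩ := hC
  have hpw : p ∉ seg u w := by
    intro e
    rcases seg_total hqw e with h | h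
    · exact hqp h
    · exact hd _ h (right_mem_seg _ _)
  have hy1 : ∀ y ∈ seg q w, y ∈ seg u w := fun y hy => seg_sub_right hqw hy
  have hy2 : ∀ y ∈ seg q w, q ∈ seg u y := fun y hy => seg_head hqw hy
  have hv : ∀ y ∈ seg q w, v ∉ seg u y := by
    intro y hy e
    rcases seg_total e (hy2 y hy) with h | h
    · exact hq.h2 h
    · exact hq.h3 hm h
  have hwq := right_mem_seg q w
  have e1 : FF u v p q = FF u v p w := FF_const_q
    (fun y hy e => hpw (seg_sub (hy1 y hy) e)) (fun y hy e => hqp (seg_sub e (hy2 y hy)))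
    hv hp.h1 (fun y hy e => hq.h3 hm (seg_sub e (hy2 y hy)))
  have e2 : FF u v w p = 0 := by
    refine L1 ⟨fun x hx hx' => ?_, ?_⟩ (fun e => hp.h1 (seg_sub hw e)) hp.h2 (hp.h3 hm)
    · have : w ∈ seg x p := seg_tail hw hx'
      exact hqp (seg_sub (seg_sub_right hx this) hqw)
    · rintro ⟨y, hy, hpy⟩
      have : w ∈ seg y p := seg_tail hw hy
      exact hpw (seg_head hpy (seg_symm this))
  have e3 : sg u v w = sg u v p := by
    refine sg_const (fun y hy e => ?_) (fun y hy e => ?_) (fun y hy e => ?_)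
    · exact hp.h1 (seg_sub (seg_sub_right hw hy) e)
    · exact hv w hwq (seg_head e (seg_head hw hy))
    · have : w ∈ seg v u := seg_sub (seg_symm e) (seg_head hw hy)
      exact hq.h3 hm (seg_sub (seg_symm this) hqw)
  have e4 := FF_add u v p w
  rw [e2, e3, ← e1] at e4
  have hne : FF u v p q ≠ 0 := by
    intro h
    rw [h] at e4
    apply sg_ne hp.h1 hp.h2 (hp.h3 hm)
    linear_combination -e4 / 2
  have sq := square hd
  have e5 : FF u v p q = th q v p - th q u p + th q u v := by
    unfold FF; linear_combination sq
  by_contra hcon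
  apply hne
  rw [e5]
  have c' : ∀ x : X, Continuous (fun _ : ℝ => x) := fun x => continuous_const
  have hpp := gp_path u p
  have k1 : ∀ s, q ∉ seg v (gp u p s) := fun s hs => hcon ⟨_, gp_mem _ _ s, hs⟩
  have k2 : ∀ s, q ∉ seg u (gp u p s) := fun s hs => hqp (seg_sub (gp_mem _ _ s) hs)
  have k3 : q ∉ seg u v := hq.h3 hm
  have hc : Continuous (fun s => th q v (gp u p s) - th q u (gp u p s) + th q u v) :=
    ((th_cont (c' q) (c' v) hpp k1).sub (th_cont (c' q) (c' u) hpp k2)).add continuous_const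
  have := exp_const hc (c := 1) (fun s => by
    rw [Complex.exp_add, Complex.exp_sub, exp_th (k1 s), exp_th (k2 s), exp_th k3]
    have n1 := hh_sub_ne (ne_of_not_left (k1 s))
    have n1' := hh_sub_ne (ne_of_not_right (k1 s))
    have n2 := hh_sub_ne (ne_of_not_left k3)
    field_simp) 1 0
  simp only [gp_one, gp_zero, th_self] at this
  rw [this, th_symm q u v]; ring

end Top


section Met
variable {X : Type*} [MetricSpace X] [BSurf X]

lemma seg_dist {a b y z : X} (hy : y ∈ seg a b) (hz : z ∈ seg a b) :
    dist y z = |dist a y - dist a z| := by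
  obtain ⟨s, hs, rfl⟩ := mem_seg_gp hy
  obtain ⟨t, ht, rfl⟩ := mem_seg_gp hz
  rw [dist_left_gp _ _ hs, dist_left_gp _ _ ht, dist_gp_gp, clp_of_mem hs, clp_of_mem ht, ← sub_mul,
    abs_mul, abs_of_nonneg (dist_nonneg (x := a) (y := b))]

lemma up_lemma {u v j : X} {δ : ℝ} (hδ : 0 < δ)
    (hD : dist v j + (dist u v - dist u j) ≤ 2 * δ) :
    ∃ c ∈ seg v j, ∀ q, dist u q ≤ dist u v → ∀ w, w ∈ seg u q → w ∈ seg v j → dist q c ≤ δ := by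
  obtain ⟨c, hc, hcd⟩ := exists_at (a := v) (b := j) (e := min δ (dist v j))
    (le_min hδ.le dist_nonneg) (min_le_right _ _)
  refine ⟨c, hc, fun q hq w hw1 hw2 => ?_⟩
  have e1 := seg_dist hw2 hc
  have e2 := dist_triangle q w c
  have e3 : dist u w + dist w q = dist u q := hw1
  have e4 : dist v w + dist w j = dist v j := hw2
  have e5 := dist_triangle u w v
  have e6 := dist_triangle u w j
  rw [dist_comm q w] at e2
  rw [dist_comm w v] at e5
  rw [hcd] at e1
  rcases le_total δ (dist v j) with h | h
  · rw [min_eq_left h] at e1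
    rcases abs_cases (dist v w - δ) with ⟨h1, h2⟩ | ⟨h1, h2⟩ <;> rw [h1] at e1 <;> linarith
  · rw [min_eq_right h] at e1
    have := dist_nonneg (x := w) (y := j)
    rw [abs_of_nonpos (by linarith)] at e1
    linarith

lemma low_lemma {u v i : X} {δ : ℝ}
    (hD : 2 * δ ≤ dist v i + (dist u v - dist u i)) :
    ∃ c ∈ seg i u, ∀ q, dist v q ≤ 2 * δ → ∀ w, w ∈ seg v q → w ∈ seg u i → dist q c ≤ δ := by
  obtain ⟨c, hc, hcd⟩ := exists_at (a := i) (b := u) (e := max 0 (min (dist v i - δ) (dist u i)))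
    (le_max_left _ _) (by rw [dist_comm i u]; exact max_le dist_nonneg (min_le_right _ _))
  refine ⟨c, hc, fun q hq w hw1 hw2 => ?_⟩
  have e1 := seg_dist (seg_symm hw2) hc
  have e2 := dist_triangle q w c
  have e3 : dist v w + dist w q = dist v q := hw1
  have e4 : dist u w + dist w i = dist u i := hw2
  have e5 := dist_triangle u w v
  have e6 := dist_triangle v w i
  have n1 := dist_nonneg (x := u) (y := w)
  have n2 := dist_nonneg (x := u) (y := i)
  rw [dist_comm q w] at e2
  rw [dist_comm w v] at e5
  rw [hcd, dist_comm i w] at e1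
  rcases le_total (dist v i - δ) (dist u i) with h | h
  · rw [min_eq_left h] at e1
    rcases le_total (dist v i - δ) 0 with h' | h'
    · rw [max_eq_left h', sub_zero, abs_of_nonneg dist_nonneg] at e1
      linarith
    · rw [max_eq_right h'] at e1
      rcases abs_cases (dist w i - (dist v i - δ)) with ⟨h1, h2⟩ | ⟨h1, h2⟩ <;> rw [h1] at e1 <;> linarith
  · rw [min_eq_right h, max_eq_right n2, abs_of_nonpos (by linarith)] at e1
    linarith

lemma cell {u w' : X} {e : ℝ} (he : 0 ≤ e) : ∃ c ∈ seg w' u, ∀ w q, q ∈ seg w u →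
    dist q c ≤ dist w w' + |dist w q - e| := by
  obtain ⟨c, hc, hcd⟩ := exists_at (a := w') (b := u) (e := min e (dist w' u))
    (le_min he dist_nonneg) (min_le_right _ _)
  refine ⟨c, hc, fun w q hq => ?_⟩
  obtain ⟨t, ht, rfl⟩ := mem_seg_gp hq
  have e1 := gp_comp w u w' u ht
  have e2 := seg_dist (gp_mem w' u t) hc
  rw [hcd, dist_left_gp _ _ ht] at e2
  rw [dist_left_gp _ _ ht]
  rw [dist_self, mul_zero, add_zero] at e1
  have e3 := dist_triangle (gp w u t) (gp w' u t) c
  have e4 : |t * dist w' u - min e (dist w' u)| ≤ |t * dist w' u - e| := by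
    rcases le_total e (dist w' u) with h | h
    · rw [min_eq_left h]
    · rw [min_eq_right h]
      have : t * dist w' u ≤ dist w' u := by nlinarith [ht.2, dist_nonneg (x := w') (y := u)]
      rw [abs_of_nonpos (by linarith), abs_of_nonpos (by linarith)]; linarith
  have e5 : |t * dist w' u - e| ≤ t * dist w w' + |t * dist w u - e| := by
    have f1 : |dist w' u - dist w u| ≤ dist w w' := by
      rw [dist_comm w w']; exact abs_dist_sub_le _ _ _
    have f2 : |t * dist w' u - t * dist w u| ≤ t * dist w w' := by
      rw [← mul_sub, abs_mul, abs_of_nonneg ht.1]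
      exact mul_le_mul_of_nonneg_left f1 ht.1
    have f3 := abs_sub_le (t * dist w' u) (t * dist w u) e
    linarith
  linarith

lemma grid2 {K : Set X} (hK : GConvex K) {u v p : X} (hu : u ∈ K) (hv : v ∈ K) (hp : p ∈ K) {δ e : ℝ}
    (he : 0 ≤ e) (hD : dist v p ≤ 2 * δ) :
    ∃ T : Finset X, ↑T ⊆ K ∧ T.card ≤ 2 ∧ ∀ w q, w ∈ seg v p → q ∈ seg u w → |dist w q - e| ≤ δ / 2 →
      ∃ c ∈ T, dist q c ≤ δ := by
  classical
  obtain ⟨c1, h1, h1'⟩ := cell (u := u) (w' := gp v p (1/4)) he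
  obtain ⟨c2, h2, h2'⟩ := cell (u := u) (w' := gp v p (3/4)) he
  refine ⟨{c1, c2}, ?_, Finset.card_le_two, ?_⟩
  · have k1 := hK _ (hK _ hv _ hp (gp_mem v p (1/4))) _ hu h1
    have k2 := hK _ (hK _ hv _ hp (gp_mem v p (3/4))) _ hu h2
    intro x hx
    simp at hx
    rcases hx with rfl | rfl <;> assumption
  · intro w q hw hq hb
    obtain ⟨s, hs, rfl⟩ := mem_seg_gp hw
    have n := dist_nonneg (x := v) (y := p)
    rcases le_total s (1/2) with h | h
    · refine ⟨c1, by simp, ?_⟩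
      have g1 := h1' _ _ (seg_symm hq)
      rw [dist_gp_gp, clp_of_mem hs, clp_of_mem (by constructor <;> norm_num)] at g1
      have : |s - 1/4| ≤ 1/4 := by rw [abs_le]; constructor <;> linarith [hs.1]
      nlinarith
    · refine ⟨c2, by simp, ?_⟩
      have g1 := h2' _ _ (seg_symm hq)
      rw [dist_gp_gp, clp_of_mem hs, clp_of_mem (by constructor <;> norm_num)] at g1
      have : |s - 3/4| ≤ 1/4 := by rw [abs_le]; constructor <;> linarith [hs.2]
      nlinarith

lemma side {K : Set X} (hK : GConvex K) {u v m : X} (hu : u ∈ K) (hv : v ∈ K) {δ : ℝ} (hδ : 0 < δ)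
    (hm : m ∈ seg u v) (S : Finset X) (hS : ↑S ⊆ K) (hA : ∀ q ∈ S, Ad u v m q)
    (hs : ∀ p ∈ S, ∀ q ∈ S, sg u v p + sg u v q ≠ 0)
    (h1 : ∀ q ∈ S, dist u q ≤ dist u v) (h2 : ∀ q ∈ S, dist v q ≤ 2 * δ) :
    ∃ T : Finset X, ↑T ⊆ K ∧ T.card ≤ 8 ∧ ∀ q ∈ S, ∃ c ∈ T, dist q c ≤ δ := by
  classical
  have key : ∀ p ∈ S, ∀ w ∈ seg v p, ∀ q ∈ S, q ∈ seg u w → dist w q ≤ dist u v - dist u q := by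
    intro p hp w hw q hq hqw
    have e1 : dist u q + dist q w = dist u w := hqw
    have e2 : dist u w ≤ dist u v := seg_ball hw le_rfl (h1 p hp)
    rw [dist_comm q w] at e1; linarith
  have hG : ∃ T : Finset X, ↑T ⊆ K ∧ T.card ≤ 3 ∧
      ∀ q ∈ S, dist v q + (dist u v - dist u q) ≤ 2 * δ → ∃ c ∈ T, dist q c ≤ δ := by
    rcases (S.filter (fun q => dist v q + (dist u v - dist u q) ≤ 2 * δ)).eq_empty_or_nonempty with he | hne
    · refine ⟨∅, by simp, by simp, fun q hq hq' => ?_⟩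
      have : q ∈ S.filter (fun q => dist v q + (dist u v - dist u q) ≤ 2 * δ) :=
        Finset.mem_filter.2 ⟨hq, hq'⟩
      rw [he] at this; simp at this
    · obtain ⟨j, hj, hmax⟩ := L4 hm _ hne (fun p hp => hA p (Finset.mem_filter.1 hp).1)
        (fun p hp q hq => hs p (Finset.mem_filter.1 hp).1 q (Finset.mem_filter.1 hq).1)
      obtain ⟨hjS, hjD⟩ := Finset.mem_filter.1 hj
      obtain ⟨c, hc, hc'⟩ := up_lemma hδ hjD
      obtain ⟨T, hT1, hT2, hT3⟩ := grid2 hK hu hv (hS hjS) (δ := δ) (e := δ/2) (by linarith) (h2 j hjS)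
      refine ⟨insert c T, ?_, (Finset.card_insert_le _ _).trans (by omega), fun q hq hq' => ?_⟩
      · rw [Finset.coe_insert]
        exact insert_subset (hK _ hv _ (hS hjS) hc) hT1
      · rcases hmax q (Finset.mem_filter.2 ⟨hq, hq'⟩) with ⟨w, hw1, hw2⟩ | ⟨w, hw1, hw2⟩
        · exact ⟨c, by simp, hc' q (h1 q hq) w hw1 hw2⟩
        · have k := key j hjS w hw1 q hq hw2
          have k2 := dist_triangle u q v
          rw [dist_comm q v] at k2
          obtain ⟨c', hc1, hc2⟩ := hT3 w q hw1 hw2 (by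
            rw [abs_le]; constructor <;> linarith [dist_nonneg (x := w) (y := q)])
          exact ⟨c', by simp [hc1], hc2⟩
  have hN : ∃ T : Finset X, ↑T ⊆ K ∧ T.card ≤ 5 ∧
      ∀ q ∈ S, ¬ dist v q + (dist u v - dist u q) ≤ 2 * δ → ∃ c ∈ T, dist q c ≤ δ := by
    rcases (S.filter (fun q => ¬ dist v q + (dist u v - dist u q) ≤ 2 * δ)).eq_empty_or_nonempty with he | hne
    · refine ⟨∅, by simp, by simp, fun q hq hq' => ?_⟩
      have : q ∈ S.filter (fun q => ¬ dist v q + (dist u v - dist u q) ≤ 2 * δ) :=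
        Finset.mem_filter.2 ⟨hq, hq'⟩
      rw [he] at this; simp at this
    · obtain ⟨i, hi, hmax⟩ := L4 (seg_symm hm) _ hne (fun p hp => (hA p (Finset.mem_filter.1 hp).1).swap)
        (fun p hp q hq => by
          rw [sg_swap, sg_swap u v q, ← neg_add]
          exact neg_ne_zero.2 (hs p (Finset.mem_filter.1 hp).1 q (Finset.mem_filter.1 hq).1))
      obtain ⟨hiS, hiD⟩ := Finset.mem_filter.1 hi
      push Not at hiD
      obtain ⟨c, hc, hc'⟩ := low_lemma hiD.le
      obtain ⟨T, hT1, hT2, hT3⟩ := grid2 hK hu hv (hS hiS) (δ := δ) (e := δ/2) (by linarith) (h2 i hiS)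
      obtain ⟨T', hT1', hT2', hT3'⟩ := grid2 hK hu hv (hS hiS) (δ := δ) (e := 3*δ/2) (by linarith) (h2 i hiS)
      refine ⟨insert c (T ∪ T'), ?_, (Finset.card_insert_le _ _).trans
        (by have := Finset.card_union_le T T'; omega), fun q hq hq' => ?_⟩
      · rw [Finset.coe_insert, Finset.coe_union]
        exact insert_subset (hK _ (hS hiS) _ hu hc) (union_subset hT1 hT1')
      · by_cases hx : ∃ w, w ∈ seg v q ∧ w ∈ seg u i
        · obtain ⟨w, hw1, hw2⟩ := hx
          exact ⟨c, by simp, hc' q (h2 q hq) w hw1 hw2⟩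
        · have hq2 : q ∈ Cu v u i := (hmax q (Finset.mem_filter.2 ⟨hq, hq'⟩)).resolve_left hx
          push Not at hx
          obtain ⟨w, hw1, hw2⟩ := L5 (seg_symm hm) (hA i hiS).swap (hA q hq).swap hq2 hx
          have k := key i hiS w hw1 q hq hw2
          have k2 := dist_triangle u q v
          rw [dist_comm q v] at k2
          have k3 := h2 q hq
          rcases le_total (dist w q) δ with h | h
          · obtain ⟨c', hc1, hc2⟩ := hT3 w q hw1 hw2 (by
              rw [abs_le]; constructor <;> linarith [dist_nonneg (x := w) (y := q)])
            exact ⟨c', by simp [hc1], hc2⟩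
          · obtain ⟨c', hc1, hc2⟩ := hT3' w q hw1 hw2 (by
              rw [abs_le]; constructor <;> linarith)
            exact ⟨c', by simp [hc1], hc2⟩
  obtain ⟨T, a1, a2, a3⟩ := hG
  obtain ⟨T', b1, b2, b3⟩ := hN
  refine ⟨T ∪ T', by rw [Finset.coe_union]; exact union_subset a1 b1,
    (Finset.card_union_le _ _).trans (by omega), fun q hq => ?_⟩
  by_cases h : dist v q + (dist u v - dist u q) ≤ 2 * δ
  · obtain ⟨c, hc, hc'⟩ := a3 q hq h
    exact ⟨c, by simp [hc], hc'⟩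
  · obtain ⟨c, hc, hc'⟩ := b3 q hq h
    exact ⟨c, by simp [hc], hc'⟩

lemma local_cover {K : Set X} (hK : GConvex K) {u v : X} (hu : u ∈ K) (hv : v ∈ K) {δ : ℝ} (hδ : 0 < δ)
    (S : Finset X) (hS : ↑S ⊆ K)
    (h1 : ∀ q ∈ S, dist u q ≤ dist u v) (h2 : ∀ q ∈ S, dist v q ≤ 2 * δ) :
    ∃ T : Finset X, ↑T ⊆ K ∧ T.card ≤ 19 ∧ ∀ q ∈ S, ∃ c ∈ T, dist q c ≤ δ := by
  classical
  rcases le_total (dist u v) δ with hR | hR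
  · refine ⟨{u}, by simpa using hu, by simp, fun q hq => ⟨u, by simp, ?_⟩⟩
    rw [dist_comm]; exact (h1 q hq).trans hR
  obtain ⟨m, hm', hmd⟩ := exists_at (a := v) (b := u) (e := δ) hδ.le (by rwa [dist_comm])
  have hm := seg_symm hm'
  have hmu : dist u m = dist u v - δ := by
    have : dist u m + dist m v = dist u v := hm
    rw [dist_comm m v] at this; linarith
  have hmK : m ∈ K := hK _ hu _ hv hm
  obtain ⟨c1, hc1, hc1'⟩ := up_lemma (u := u) (v := v) (j := m) hδ (by rw [hmd, hmu]; linarith)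
  obtain ⟨c2, hc2, hc2'⟩ := low_lemma (u := u) (v := v) (i := m) (δ := δ) (by rw [hmd, hmu]; linarith)
  have sub : ∀ (p : X → Prop) [DecidablePred p], ∀ q ∈ S.filter p, q ∈ S ∧ p q :=
    fun p _ q hq => Finset.mem_filter.1 hq
  obtain ⟨T, a1, a2, a3⟩ := side hK hu hv hδ hm (S.filter (fun q => Ad u v m q ∧ 0 < (sg u v q).im))
    (fun q hq => hS (Finset.mem_filter.1 hq).1) (fun q hq => (sub _ q hq).2.1)
    (fun p hp q hq h => by
      have := congrArg Complex.im h
      rw [Complex.add_im, Complex.zero_im] at this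
      linarith [(sub _ q hq).2.2, (sub _ p hp).2.2])
    (fun q hq => h1 q (sub _ q hq).1) (fun q hq => h2 q (sub _ q hq).1)
  obtain ⟨T', b1, b2, b3⟩ := side hK hu hv hδ hm (S.filter (fun q => Ad u v m q ∧ (sg u v q).im < 0))
    (fun q hq => hS (Finset.mem_filter.1 hq).1) (fun q hq => (sub _ q hq).2.1)
    (fun p hp q hq h => by
      have := congrArg Complex.im h
      rw [Complex.add_im, Complex.zero_im] at this
      linarith [(sub _ q hq).2.2, (sub _ p hp).2.2])
    (fun q hq => h1 q (sub _ q hq).1) (fun q hq => h2 q (sub _ q hq).1)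
  refine ⟨{c1, c2} ∪ (T ∪ T'), ?_, ?_, fun q hq => ?_⟩
  · rw [Finset.coe_union, Finset.coe_union]
    refine union_subset (fun x hx => ?_) (union_subset a1 b1)
    have k1 := hK _ hv _ hmK hc1
    have k2 := hK _ hmK _ hu hc2
    simp at hx
    rcases hx with rfl | rfl <;> assumption
  · have e1 := Finset.card_union_le {c1, c2} (T ∪ T')
    have e2 := Finset.card_union_le T T'
    have e3 : ({c1, c2} : Finset X).card ≤ 2 := Finset.card_le_two
    omega
  · by_cases hA : Ad u v m q
    · rcases lt_or_gt_of_ne (sg_im_ne hA.h1 hA.h2 (hA.h3 hm)) with h | h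
      · obtain ⟨c, hc, hc'⟩ := b3 q (Finset.mem_filter.2 ⟨hq, hA, h⟩)
        exact ⟨c, by simp [hc], hc'⟩
      · obtain ⟨c, hc, hc'⟩ := a3 q (Finset.mem_filter.2 ⟨hq, hA, h⟩)
        exact ⟨c, by simp [hc], hc'⟩
    · unfold Ad at hA
      rw [not_and_or] at hA
      push Not at hA
      rcases hA with ⟨w, hw1, hw2⟩ | ⟨w, hw1, hw2⟩
      · exact ⟨c1, by simp, hc1' q (h1 q hq) w hw1 hw2⟩
      · exact ⟨c2, by simp, hc2' q (h2 q hq) w hw1 hw2⟩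

lemma finite_cover {K : Set X} (hK : GConvex K) {u : X} (hu : u ∈ K) {δ : ℝ} (hδ : 0 < δ) (n : ℕ) :
    ∀ Q : Finset X, Q.card ≤ n → ↑Q ⊆ K → ∃ T S : Finset X, ↑T ⊆ K ∧ S ⊆ Q ∧
      (∀ p ∈ S, ∀ q ∈ S, p ≠ q → 2 * δ < dist p q) ∧ T.card ≤ 19 * S.card ∧
      ∀ q ∈ Q, ∃ c ∈ T, dist q c ≤ δ := by
  classical
  induction n with
  | zero =>
    intro Q hQ hQK
    have : Q = ∅ := Finset.card_eq_zero.1 (by omega)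
    subst this
    exact ⟨∅, ∅, by simp, by simp, by simp, by simp, by simp⟩
  | succ n ih =>
    intro Q hQ hQK
    rcases Q.eq_empty_or_nonempty with rfl | hne
    · exact ⟨∅, ∅, by simp, by simp, by simp, by simp, by simp⟩
    obtain ⟨v, hv, hmax⟩ := Finset.exists_max_image Q (fun q => dist u q) hne
    have hlt : (Q.filter (fun q => ¬ dist v q ≤ 2 * δ)).card < Q.card := by
      apply Finset.card_lt_card
      rw [Finset.filter_ssubset]
      exact ⟨v, hv, by rw [dist_self]; push Not; linarith⟩
    obtain ⟨T, S, t1, t2, t3, t4, t5⟩ := ih (Q.filter (fun q => ¬ dist v q ≤ 2 * δ)) (by omega)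
      (fun q hq => hQK (Finset.mem_filter.1 hq).1)
    obtain ⟨T', s1, s2, s3⟩ := local_cover hK hu (hQK hv) hδ (Q.filter (fun q => dist v q ≤ 2 * δ))
      (fun q hq => hQK (Finset.mem_filter.1 hq).1) (fun q hq => hmax q (Finset.mem_filter.1 hq).1)
      (fun q hq => (Finset.mem_filter.1 hq).2)
    have hvS : ∀ q ∈ S, 2 * δ < dist v q := fun q hq => not_le.1 (Finset.mem_filter.1 (t2 hq)).2
    have hvn : v ∉ S := fun h => by have := hvS v h; rw [dist_self] at this; linarith
    refine ⟨T ∪ T', insert v S, ?_, ?_, ?_, ?_, fun q hq => ?_⟩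
    · rw [Finset.coe_union]; exact union_subset t1 s1
    · exact Finset.insert_subset hv (t2.trans (Finset.filter_subset _ _))
    · intro p hp q hq hpq
      rcases Finset.mem_insert.1 hp with rfl | hp2 <;> rcases Finset.mem_insert.1 hq with rfl | hq2
      · exact absurd rfl hpq
      · exact hvS q hq2
      · rw [dist_comm]; exact hvS p hp2
      · exact t3 p hp2 q hq2 hpq
    · rw [Finset.card_insert_of_notMem hvn]
      have := Finset.card_union_le T T'
      omega
    · by_cases h : dist v q ≤ 2 * δ
      · obtain ⟨c, hc, hc'⟩ := s3 q (Finset.mem_filter.2 ⟨hq, h⟩)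
        exact ⟨c, by simp [hc], hc'⟩
      · obtain ⟨c, hc, hc'⟩ := t5 q (Finset.mem_filter.2 ⟨hq, h⟩)
        exact ⟨c, by simp [hc], hc'⟩

end Met


section Glob
variable {X : Type*} [MetricSpace X]

lemma pack_le_of_cover {δ : ℝ} {P T : Set X} (hT : P ⊆ ⋃ x ∈ T, Metric.closedBall x δ) :
    packNum δ P ≤ T.encard := by
  apply sSup_le
  rintro n ⟨S, hSP, rfl, hS⟩
  have : ∀ x : X, ∃ c, x ∈ S → c ∈ T ∧ dist x c ≤ δ := by
    intro x
    by_cases hx : x ∈ S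
    · have := hT (hSP hx)
      simp only [mem_iUnion, mem_closedBall, exists_prop] at this
      obtain ⟨c, h1, h2⟩ := this
      exact ⟨c, fun _ => ⟨h1, h2⟩⟩
    · exact ⟨x, fun h => absurd h hx⟩
  choose f hf using this
  apply Set.encard_le_encard_of_injOn (f := f) (fun x hx => (hf x hx).1)
  intro x hx y hy hxy
  by_contra hne
  have h1 := hS hx hy hne
  have h2 := (hf x hx).2
  have h3 := (hf y hy).2
  rw [← hxy, dist_comm] at h3
  linarith [dist_triangle x (f x) y]

lemma compact_cover [BSurf X] {P : Set X} (hP : IsCompact P) (hconv : GConvex P) {u : X} (hu : u ∈ P)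
    {δ : ℝ} (hδ : 0 < δ) {n : ℕ} (hn : packNum δ P ≤ n) :
    ∃ T : Finset X, ↑T ⊆ P ∧ T.card ≤ 19 * n ∧ P ⊆ ⋃ x ∈ T, Metric.closedBall x δ := by
  classical
  have hfin : ∀ Q : Finset X, ↑Q ⊆ P → ∃ f : Fin (19 * n) → X, (∀ i, f i ∈ P) ∧
      ∀ q ∈ Q, ∃ i, dist q (f i) ≤ δ := by
    intro Q hQ
    obtain ⟨T, S, h1, h2, h3, h4, h5⟩ := finite_cover hconv hu hδ _ Q le_rfl hQ
    have hS : (S.card : ℕ∞) ≤ n := by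
      refine le_trans ?_ hn
      apply le_sSup
      refine ⟨(S : Set X), fun x hx => hQ (h2 hx), Set.encard_coe_eq_coe_finsetCard S, ?_⟩
      intro p hp q hq hpq
      exact h3 p hp q hq hpq
    have hS' : S.card ≤ n := by exact_mod_cast hS
    refine ⟨fun i => if h : i.1 < T.card then (T.equivFin.symm ⟨i.1, h⟩ : X) else u, fun i => ?_,
      fun q hq => ?_⟩
    · dsimp only
      split_ifs with h
      · exact h1 (Subtype.prop _)
      · exact hu
    · obtain ⟨c, hc, hc'⟩ := h5 q hq
      have hlt := (T.equivFin ⟨c, hc⟩).2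
      refine ⟨⟨(T.equivFin ⟨c, hc⟩).1, by omega⟩, ?_⟩
      simpa [hlt] using hc'
  have hcomp : IsCompact (Set.pi univ (fun _ : Fin (19 * n) => P)) := isCompact_univ_pi (fun _ => hP)
  obtain ⟨f, hf1, hf2⟩ := hcomp.inter_iInter_nonempty
    (fun q : P => {f : Fin (19 * n) → X | ∃ i, dist q.1 (f i) ≤ δ})
    (fun q => by
      have : {f : Fin (19 * n) → X | ∃ i, dist q.1 (f i) ≤ δ} = ⋃ i, {f | dist q.1 (f i) ≤ δ} := by
        ext; simp
      rw [this]
      exact isClosed_iUnion_of_finite (fun i => isClosed_le (by fun_prop) continuous_const))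
    (fun Q => by
      obtain ⟨f, h1, h2⟩ := hfin (Q.image Subtype.val) (by
        intro x hx
        simp at hx
        exact hx.1)
      refine ⟨f, fun i _ => h1 i, ?_⟩
      simp only [mem_iInter]
      intro q hq
      exact h2 q.1 (Finset.mem_image_of_mem _ hq))
  refine ⟨Finset.univ.image f, ?_, Finset.card_image_le.trans (by simp), fun q hq => ?_⟩
  · intro x hx
    simp at hx
    obtain ⟨i, rfl⟩ := hx
    exact hf1 i trivial
  · have := mem_iInter.1 hf2 ⟨q, hq⟩
    obtain ⟨i, hi⟩ := this
    simp only [mem_iUnion, mem_closedBall, exists_prop]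
    exact ⟨f i, Finset.mem_image_of_mem _ (Finset.mem_univ _), hi⟩

end Glob

/-- covering–packing inequality for compact convex subsets, with
centers of the covering balls inside the set. -/
theorem compact_convex_cover_packing {X : Type*} [MetricSpace X]
    (hX : IsBusemannSurface X) (δ : ℝ) (hδ : 0 < δ) (P : Set X)
    (hP : IsCompact P) (hconv : GConvex P) :
    (∃ T : Finset X, ↑T ⊆ P ∧ (T.card : ℕ∞) ≤ 19 * packNum δ P ∧
      P ⊆ ⋃ x ∈ T, Metric.closedBall x δ) ∧
    packNum δ P ≤ covNum δ P ∧ covNum δ P ≤ 19 * packNum δ P := by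
  have : BSurf X := ⟨hX⟩
  have main : ∃ T : Finset X, ↑T ⊆ P ∧ (T.card : ℕ∞) ≤ 19 * packNum δ P ∧
      P ⊆ ⋃ x ∈ T, Metric.closedBall x δ := by
    rcases P.eq_empty_or_nonempty with rfl | ⟨u, hu⟩
    · exact ⟨∅, by simp, by simp, by simp⟩
    obtain ⟨T0, -, hfin, hT0⟩ := hP.finite_cover_balls hδ
    have h1 : packNum δ P ≤ T0.encard := pack_le_of_cover (hT0.trans
      (iUnion₂_mono fun x _ => ball_subset_closedBall))
    have h2 : packNum δ P ≠ ⊤ := ne_top_of_le_ne_top (by simpa using hfin) h1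
    obtain ⟨n, hn⟩ := ENat.ne_top_iff_exists.1 h2
    obtain ⟨T, a1, a2, a3⟩ := compact_cover hP hconv hu hδ (n := n) hn.symm.le
    refine ⟨T, a1, ?_, a3⟩
    rw [← hn]
    exact_mod_cast a2
  refine ⟨main, ?_, ?_⟩
  · apply le_sInf
    rintro n ⟨T, rfl, hT⟩
    exact pack_le_of_cover hT
  · obtain ⟨T, -, h2, h3⟩ := main
    refine le_trans (sInf_le ⟨(T : Set X), Set.encard_coe_eq_coe_finsetCard T, ?_⟩) h2
    simpa using h3
end

section
/- Let S be a compact subset of a Busemann surface (𝒮,d) with diameter at most 2δ for some δ > 0. Then S can be covered by 3 closed balls of radius δ, i.e., ρ_δ(S) ≤ 3. -/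
open Metric Set

/-! ### Variation of the logarithm along a path -/

/-- `IsLift f g`: `g` is a continuous logarithm of `f` on the unit interval. -/
def IsLift (f g : ℝ → ℂ) : Prop :=
  ContinuousOn g (Icc 0 1) ∧ ∀ t ∈ Icc (0 : ℝ) 1, Complex.exp (g t) = f t

open Classical in
/-- Variation of the logarithm of `f` along the unit interval. -/
noncomputable def logVar (f : ℝ → ℂ) : ℂ :=
  if h : ∃ g, IsLift f g then h.choose 1 - h.choose 0 else 0

theorem IsLift.unique {f g g' : ℝ → ℂ} (h : IsLift f g) (h' : IsLift f g') :
    g 1 - g 0 = g' 1 - g' 0 := by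
  have key : ∀ t ∈ Icc (0 : ℝ) 1, ∃ n : ℤ, g t - g' t = n * (2 * Real.pi * Complex.I) := by
    intro t ht
    have := (h.2 t ht).trans (h'.2 t ht).symm
    rw [Complex.exp_eq_exp_iff_exists_int] at this
    obtain ⟨n, hn⟩ := this
    exact ⟨n, by rw [hn]; ring⟩
  have hc : ContinuousOn (fun t => ((g t - g' t) / (2 * Real.pi * Complex.I)).re) (Icc 0 1) := by
    have := (h.1.sub h'.1).div_const (2 * Real.pi * Complex.I)
    exact Complex.continuous_re.comp_continuousOn this
  have hp : (2 * Real.pi * Complex.I : ℂ) ≠ 0 := Complex.two_pi_I_ne_zero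
  have hmemInt : ∀ t ∈ Icc (0 : ℝ) 1, ((g t - g' t) / (2 * Real.pi * Complex.I)).re ∈
      Set.range ((↑) : ℤ → ℝ) := by
    intro t ht
    obtain ⟨n, hn⟩ := key t ht
    refine ⟨n, ?_⟩
    rw [hn, mul_div_cancel_right₀ _ hp]
    simp
  have hconst : ((g 0 - g' 0) / (2 * Real.pi * Complex.I)).re
      = ((g 1 - g' 1) / (2 * Real.pi * Complex.I)).re := by
    have hpre : IsPreconnected (Icc (0 : ℝ) 1) := isPreconnected_Icc
    have hT : (Set.range ((↑) : ℤ → ℝ)).Countable := Set.countable_range _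
    have := (hpre.image _ hc)
    have hsub : (Set.image (fun t => ((g t - g' t) / (2 * Real.pi * Complex.I)).re) (Icc 0 1)).Subsingleton := by
      refine Set.Countable.isTotallyDisconnected ?_ _ Subset.rfl this
      exact hT.mono (by rintro _ ⟨t, ht, rfl⟩; exact hmemInt t ht)
    exact hsub ⟨0, by simp, rfl⟩ ⟨1, by simp, rfl⟩
  obtain ⟨n, hn⟩ := key 0 (by simp)
  obtain ⟨m, hm⟩ := key 1 (by simp)
  rw [hn, hm, mul_div_cancel_right₀ _ hp, mul_div_cancel_right₀ _ hp] at hconst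
  simp only [Complex.intCast_re, Int.cast_inj] at hconst
  subst hconst
  linear_combination hm - hn

theorem logVar_eq {f g : ℝ → ℂ} (h : IsLift f g) : logVar f = g 1 - g 0 := by
  have hex : ∃ g, IsLift f g := ⟨g, h⟩
  rw [logVar, dif_pos hex]
  exact hex.choose_spec.unique h

theorem logVar_const (c : ℂ) (hc : c ≠ 0) (f : ℝ → ℂ) (hf : ∀ t ∈ Icc (0 : ℝ) 1, f t = c) :
    logVar f = 0 := by
  have : IsLift f (fun _ => Complex.log c) :=
    ⟨continuousOn_const, fun t ht => by rw [hf t ht, Complex.exp_log hc]⟩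
  rw [logVar_eq this, sub_self]

theorem square_log (f : ℝ → ℝ → ℂ)
    (hf : Continuous (fun p : ℝ × ℝ => f p.1 p.2))
    (h0 : ∀ t ∈ Icc (0 : ℝ) 1, ∀ u ∈ Icc (0 : ℝ) 1, f t u ≠ 0) :
    logVar (fun t => f t 0) + logVar (fun u => f 1 u)
      = logVar (fun u => f 0 u) + logVar (fun t => f t 1) := by
  let c : ℝ → ℝ := fun t => (projIcc (0 : ℝ) 1 zero_le_one t : ℝ)
  have hc : Continuous c := continuous_subtype_val.comp continuous_projIcc
  have hcm : ∀ t, c t ∈ Icc (0 : ℝ) 1 := fun t => (projIcc (0 : ℝ) 1 zero_le_one t).2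
  have hci : ∀ t ∈ Icc (0 : ℝ) 1, c t = t := fun t ht => by
    simp only [c, projIcc_of_mem _ ht]
  have hsc : IsSimplyConnected (Set.univ : Set (ℝ × ℝ)) := by
    have : ContractibleSpace (Set.univ : Set (ℝ × ℝ)) :=
      convex_univ.contractibleSpace Set.univ_nonempty
    exact SimplyConnectedSpace.ofContractible _
  obtain ⟨G, hG, hGe⟩ := Complex.exists_continuousOn_eqOn_exp_comp hsc isOpen_univ
    (g := fun p : ℝ × ℝ => f (c p.1) (c p.2))
    (by
      have : Continuous (fun p : ℝ × ℝ => (c p.1, c p.2)) := by fun_prop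
      exact (hf.comp this).continuousOn)
    (by
      rintro ⟨p, -, hp⟩
      exact h0 _ (hcm _) _ (hcm _) hp)
  have hG' : Continuous G := continuousOn_univ.mp hG
  have hGe' : ∀ t ∈ Icc (0 : ℝ) 1, ∀ u ∈ Icc (0 : ℝ) 1, Complex.exp (G (t, u)) = f t u := by
    intro t ht u hu
    have := hGe (Set.mem_univ (t, u))
    simpa [hci t ht, hci u hu] using this
  have z : (0 : ℝ) ∈ Icc (0 : ℝ) 1 := by simp
  have o : (1 : ℝ) ∈ Icc (0 : ℝ) 1 := by simp
  rw [logVar_eq (f := fun t => f t 0) (g := fun t => G (t, 0))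
      ⟨by fun_prop, fun t ht => hGe' t ht 0 z⟩,
    logVar_eq (f := fun t => f t 1) (g := fun t => G (t, 1))
      ⟨by fun_prop, fun t ht => hGe' t ht 1 o⟩,
    logVar_eq (f := fun t => f 0 t) (g := fun t => G (0, t))
      ⟨by fun_prop, fun t ht => hGe' 0 z t ht⟩,
    logVar_eq (f := fun t => f 1 t) (g := fun t => G (1, t))
      ⟨by fun_prop, fun t ht => hGe' 1 o t ht⟩]
  ring

/-! ### Geodesic combinations in a Busemann space -/

/-- A continuous geodesic bicombing with the properties we need. -/
structure Bicomb (X : Type*) [MetricSpace X] where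
  G : X → X → ℝ → X
  cont : Continuous (fun p : X × X × ℝ => G p.1 p.2.1 p.2.2)
  zero : ∀ x y, G x y 0 = x
  one : ∀ x y, G x y 1 = y
  self : ∀ x t, G x x t = x
  dist_eq : ∀ x y, ∀ s ∈ Icc (0 : ℝ) 1, ∀ t ∈ Icc (0 : ℝ) 1,
    dist (G x y s) (G x y t) = |s - t| * dist x y
  symm : ∀ x y, G x y (1 / 2) = G y x (1 / 2)
  conv : ∀ x y x' y', ∀ t ∈ Icc (0 : ℝ) 1,
    dist (G x y t) (G x' y' t) ≤ (1 - t) * dist x x' + t * dist y y'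
  ball : ∀ c x y r, dist c x ≤ r → dist c y ≤ r → ∀ t ∈ Icc (0 : ℝ) 1, dist c (G x y t) ≤ r
  ball_left : ∀ c x y r, dist c x ≤ r → dist c (G x y (1 / 2)) ≤ r →
    ∀ t ∈ Icc (0 : ℝ) (1 / 2), dist c (G x y t) ≤ r
  ball_right : ∀ c x y r, dist c (G x y (1 / 2)) ≤ r → dist c y ≤ r →
    ∀ t ∈ Icc (1 / 2 : ℝ) 1, dist c (G x y t) ≤ r

theorem IsGeodesicMap.reverse {X : Type*} [MetricSpace X] {γ : ℝ → X} {l : ℝ}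
    (h : IsGeodesicMap γ l) : IsGeodesicMap (fun s => γ (l - s)) l := by
  intro s hs t ht
  have := h (l - s) ⟨by linarith [hs.2], by linarith [hs.1]⟩ (l - t)
    ⟨by linarith [ht.2], by linarith [ht.1]⟩
  simp only [this]
  rw [abs_sub_comm]
  congr 1
  ring

theorem IsGeodesicMap.mono {X : Type*} [MetricSpace X] {γ : ℝ → X} {l l' : ℝ}
    (h : IsGeodesicMap γ l) (hl : l' ≤ l) : IsGeodesicMap γ l' :=
  fun s hs t ht => h s ⟨hs.1, hs.2.trans hl⟩ t ⟨ht.1, ht.2.trans hl⟩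

theorem busemann_ball {X : Type*} [MetricSpace X] (hX : IsBusemannSpace X) {γ : ℝ → X} {l : ℝ}
    (hl : 0 ≤ l) (h : IsGeodesicMap γ l) (c : X) (r : ℝ) (h0 : dist c (γ 0) ≤ r)
    (h1 : dist c (γ l) ≤ r) (s : ℝ) (hs : s ∈ Icc 0 l) : dist c (γ s) ≤ r := by
  rcases hl.eq_or_lt with rfl | hl'
  · have : s = 0 := le_antisymm hs.2 hs.1
    rw [this]; exact h0
  have hc : IsGeodesicMap (fun _ : ℝ => c) 0 := by
    intro s hs t ht
    have h1 : s = 0 := le_antisymm hs.2 hs.1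
    have h2 : t = 0 := le_antisymm ht.2 ht.1
    simp [h1, h2]
  have ht : s / l ∈ Icc (0 : ℝ) 1 := ⟨div_nonneg hs.1 hl, (div_le_one hl').2 hs.2⟩
  have := hX.2 (fun _ => c) γ 0 l le_rfl hl hc h (s / l) ht
  rw [div_mul_cancel₀ _ hl'.ne'] at this
  nlinarith [ht.1, ht.2, mul_le_mul_of_nonneg_left h0 (sub_nonneg.2 ht.2),
    mul_le_mul_of_nonneg_left h1 ht.1]

theorem exists_bicomb {X : Type*} [MetricSpace X] (hX : IsBusemannSpace X) :
    Nonempty (Bicomb X) := by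
  have hB := hX.2
  choose γ hγ hγ0 hγ1 using hX.1
  let c : ℝ → ℝ := fun t => (projIcc (0 : ℝ) 1 zero_le_one t : ℝ)
  have hc : Continuous c := continuous_subtype_val.comp continuous_projIcc
  have hcm : ∀ t, c t ∈ Icc (0 : ℝ) 1 := fun t => (projIcc (0 : ℝ) 1 zero_le_one t).2
  have hci : ∀ t ∈ Icc (0 : ℝ) 1, c t = t := fun t ht => by
    simp only [c, projIcc_of_mem _ ht]
  let G : X → X → ℝ → X := fun x y t => γ x y (c t * dist x y)
  have mem : ∀ (x y : X), ∀ t ∈ Icc (0 : ℝ) 1, t * dist x y ∈ Icc 0 (dist x y) := fun x y t ht =>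
    ⟨mul_nonneg ht.1 dist_nonneg, mul_le_of_le_one_left dist_nonneg ht.2⟩
  have hdist : ∀ x y s t, dist (G x y s) (G x y t) = |c s - c t| * dist x y := by
    intro x y s t
    rw [hγ x y _ (mem x y _ (hcm s)) _ (mem x y _ (hcm t)), ← sub_mul, abs_mul,
      abs_of_nonneg (dist_nonneg (x := x) (y := y))]
  have hconv : ∀ x y x' y' t, dist (G x y t) (G x' y' t)
      ≤ (1 - c t) * dist x x' + c t * dist y y' := by
    intro x y x' y' t
    have := hB (γ x y) (γ x' y') _ _ dist_nonneg dist_nonneg (hγ x y) (hγ x' y') (c t) (hcm t)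
    simpa only [hγ0, hγ1] using this
  have half : (1 / 2 : ℝ) ∈ Icc (0 : ℝ) 1 := by norm_num
  refine ⟨⟨G, ?_, ?_, ?_, ?_, ?_, ?_, ?_, ?_, ?_, ?_⟩⟩
  · rw [continuous_iff_continuousAt]
    rintro ⟨x, y, t⟩
    rw [ContinuousAt, tendsto_iff_dist_tendsto_zero]
    have lim : Filter.Tendsto (fun p : X × X × ℝ =>
        dist p.1 x + dist p.2.1 y + |c p.2.2 - c t| * dist x y) (nhds (x, y, t)) (nhds 0) := by
      have : Continuous (fun p : X × X × ℝ =>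
        dist p.1 x + dist p.2.1 y + |c p.2.2 - c t| * dist x y) := by fun_prop
      simpa using this.tendsto (x, y, t)
    refine squeeze_zero (fun _ => dist_nonneg) ?_ lim
    rintro ⟨x', y', t'⟩
    have h1 := dist_triangle (G x' y' t') (G x y t') (G x y t)
    have h2 := hconv x' y' x y t'
    have h3 := hdist x y t' t
    have h4 := hcm t'
    have h5 : (1 - c t') * dist x' x ≤ dist x' x :=
      mul_le_of_le_one_left dist_nonneg (by linarith [h4.1])
    have h6 : c t' * dist y' y ≤ dist y' y := mul_le_of_le_one_left dist_nonneg h4.2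
    simp only
    linarith
  · intro x y
    simp only [G, hci 0 (by simp), zero_mul, hγ0]
  · intro x y
    simp only [G, hci 1 (by simp), one_mul, hγ1]
  · intro x t
    simp only [G, dist_self, mul_zero, hγ0]
  · intro x y s hs t ht
    rw [hdist, hci s hs, hci t ht]
  · intro x y
    have := hB (γ x y) (fun s => γ y x (dist y x - s)) _ _ dist_nonneg dist_nonneg (hγ x y)
      (hγ y x).reverse (1 / 2) half
    simp only [hγ0, hγ1, sub_zero, sub_self, dist_self, mul_zero, add_zero] at this
    have h2 := dist_le_zero.1 this
    simp only [G, hci _ half]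
    rw [h2]
    congr 1
    ring
  · intro x y x' y' t ht
    have := hconv x y x' y' t
    rwa [hci t ht] at this
  · intro z x y r h0 h1 t ht
    simp only [G, hci t ht]
    exact busemann_ball hX dist_nonneg (hγ x y) z r (by rwa [hγ0]) (by rwa [hγ1]) _ (mem x y t ht)
  · intro z x y r h0 h1 t ht
    have ht' : t ∈ Icc (0 : ℝ) 1 := ⟨ht.1, by linarith [ht.2]⟩
    simp only [G, hci t ht', hci _ half] at h1 ⊢
    refine busemann_ball hX (l := 1 / 2 * dist x y) (by positivity)
      ((hγ x y).mono (mem x y _ half).2) z r (by rwa [hγ0]) h1 _ ⟨(mem x y t ht').1, ?_⟩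
    exact mul_le_mul_of_nonneg_right ht.2 dist_nonneg
  · intro z x y r h0 h1 t ht
    have ht' : t ∈ Icc (0 : ℝ) 1 := ⟨by linarith [ht.1], ht.2⟩
    simp only [G, hci t ht', hci _ half] at h0 ⊢
    have key := busemann_ball hX (l := 1 / 2 * dist x y) (by positivity)
      ((hγ x y).reverse.mono (mem x y _ half).2) z r (by simpa [hγ1] using h1)
      (by
        have : dist x y - 1 / 2 * dist x y = 1 / 2 * dist x y := by ring
        rw [this]; exact h0) ((1 - t) * dist x y)
      ⟨mul_nonneg (by linarith [ht.2]) dist_nonneg,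
        mul_le_mul_of_nonneg_right (by linarith [ht.1]) dist_nonneg⟩
    have h2 : dist x y - (1 - t) * dist x y = t * dist x y := by ring
    rwa [h2] at key

namespace Bicomb

variable {X : Type*} [MetricSpace X] (b : Bicomb X)

theorem cross {δ ε : ℝ} {o x y w : X} (hxy : dist x y ≤ 2 * δ)
    (hx : dist o w ≤ dist o x + ε) (hy : dist o w ≤ dist o y + ε)
    (hm : δ + ε < dist (b.G x y (1 / 2)) w) :
    ∀ t ∈ Icc (0 : ℝ) 1, ∀ u ∈ Icc (0 : ℝ) 1, b.G x y t ≠ b.G o w u := by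
  intro t ht u hu heq
  have half : (1 / 2 : ℝ) ∈ Icc (0 : ℝ) 1 := by norm_num
  have z : (0 : ℝ) ∈ Icc (0 : ℝ) 1 := by simp
  have i : (1 : ℝ) ∈ Icc (0 : ℝ) 1 := by simp
  have e1 := b.dist_eq o w 0 z u hu
  have e2 := b.dist_eq o w u hu 1 i
  rw [b.zero] at e1
  rw [b.one] at e2
  rw [← heq] at e1 e2
  rw [abs_of_nonpos (by linarith [hu.1])] at e1
  rw [abs_of_nonpos (by linarith [hu.2])] at e2
  have e3 := b.dist_eq x y (1 / 2) half t ht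
  have e4 := b.dist_eq x y t ht 1 i
  have e5 := b.dist_eq x y t ht 0 z
  rw [b.one, abs_of_nonpos (by linarith [ht.2])] at e4
  rw [b.zero, abs_of_nonneg (by linarith [ht.1])] at e5
  have t1 := dist_triangle (b.G x y (1 / 2)) (b.G x y t) w
  have t2 := dist_triangle o (b.G x y t) y
  have t3 := dist_triangle o (b.G x y t) x
  rcases le_total t (1 / 2) with h | h
  · rw [abs_of_nonneg (by linarith)] at e3
    nlinarith
  · rw [abs_of_nonpos (by linarith)] at e3
    nlinarith

theorem cone {δ : ℝ} {x y z : X} (hxy : dist x y ≤ 2 * δ) (hxz : dist x z ≤ 2 * δ)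
    (hyz : dist y z ≤ 2 * δ) :
    ∀ t ∈ Icc (0 : ℝ) 1, ∀ u ∈ Icc (0 : ℝ) 1,
      dist (b.G x z (1 / 2)) (b.G (b.G x y t) z u) ≤ δ ∨
      dist (b.G y z (1 / 2)) (b.G (b.G x y t) z u) ≤ δ := by
  intro t ht u hu
  have half : (1 / 2 : ℝ) ∈ Icc (0 : ℝ) 1 := by norm_num
  have zz : (0 : ℝ) ∈ Icc (0 : ℝ) 1 := by simp
  have i : (1 : ℝ) ∈ Icc (0 : ℝ) 1 := by simp
  have hend : ∀ p q : X, dist p q ≤ 2 * δ → dist (b.G p q (1 / 2)) p ≤ δ ∧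
      dist (b.G p q (1 / 2)) q ≤ δ := by
    intro p q hpq
    have e1 := b.dist_eq p q (1 / 2) half 0 zz
    have e2 := b.dist_eq p q (1 / 2) half 1 i
    rw [b.zero] at e1
    rw [b.one] at e2
    norm_num [abs_of_pos, abs_of_neg] at e1 e2
    norm_num
    constructor <;> linarith
  rcases le_total t (1 / 2) with h | h
  · left
    refine b.ball _ _ _ _ ?_ (hend x z hxz).2 u hu
    refine b.ball_left _ _ _ _ (hend x z hxz).1 ?_ t ⟨ht.1, h⟩
    have := b.conv x z x y (1 / 2) half
    rw [dist_self, dist_comm z y] at this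
    linarith
  · right
    refine b.ball _ _ _ _ ?_ (hend y z hyz).2 u hu
    refine b.ball_right _ _ _ _ ?_ (hend y z hyz).1 t ⟨h, ht.2⟩
    have := b.conv y z y x (1 / 2) half
    rw [dist_self, dist_comm z x, b.symm y x] at this
    linarith

theorem contG {Y : Type*} [TopologicalSpace Y] {f g : Y → X} {t : Y → ℝ} (hf : Continuous f)
    (hg : Continuous g) (ht : Continuous t) : Continuous (fun y => b.G (f y) (g y) (t y)) :=
  b.cont.comp (hf.prodMk (hg.prodMk ht))

/-- Variation of the logarithm of `h - h o` along the geodesic from `x` to `y`. -/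
noncomputable def W (h : X ≃ₜ ℂ) (o x y : X) : ℂ := logVar (fun t => h (b.G x y t) - h o)

theorem W_move (h : X ≃ₜ ℂ) {o w x y : X}
    (hne : ∀ t ∈ Icc (0 : ℝ) 1, ∀ u ∈ Icc (0 : ℝ) 1, b.G x y t ≠ b.G o w u) :
    b.W h o x y + logVar (fun u => h y - h (b.G o w u))
      = logVar (fun u => h x - h (b.G o w u)) + b.W h w x y := by
  have := square_log (fun t u => h (b.G x y t) - h (b.G o w u))
    (by
      have h1 : Continuous (fun p : ℝ × ℝ => b.G x y p.1) :=
        b.contG continuous_const continuous_const continuous_fst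
      have h2 : Continuous (fun p : ℝ × ℝ => b.G o w p.2) :=
        b.contG continuous_const continuous_const continuous_snd
      exact (h.continuous.comp h1).sub (h.continuous.comp h2))
    (fun t ht u hu => sub_ne_zero.2 fun e => hne t ht u hu (h.injective e))
  simpa only [b.zero, b.one, W] using this

theorem W_cone (h : X ≃ₜ ℂ) {w x y z : X}
    (hne : ∀ t ∈ Icc (0 : ℝ) 1, ∀ u ∈ Icc (0 : ℝ) 1, b.G (b.G x y t) z u ≠ w) :
    b.W h w x y + b.W h w y z = b.W h w x z := by
  have := square_log (fun t u => h (b.G (b.G x y t) z u) - h w)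
    (by
      have h1 : Continuous (fun p : ℝ × ℝ => b.G (b.G x y p.1) z p.2) :=
        b.contG (b.contG continuous_const continuous_const continuous_fst)
          continuous_const continuous_snd
      exact (h.continuous.comp h1).sub continuous_const)
    (fun t ht u hu => sub_ne_zero.2 fun e => hne t ht u hu (h.injective e))
  simp only [b.zero, b.one] at this
  rw [logVar_const (h z - h w) ?_ (fun _ => h z - h w) (fun _ _ => rfl), add_zero] at this
  · exact this
  · have := hne 0 (by simp) 1 (by simp)
    rw [b.one] at this
    exact sub_ne_zero.2 fun e => this (h.injective e)

theorem W_cocycle (h : X ≃ₜ ℂ) {δ ε : ℝ} (hε : 0 < ε) {o w x y z : X}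
    (hxy : dist x y ≤ 2 * δ) (hxz : dist x z ≤ 2 * δ) (hyz : dist y z ≤ 2 * δ)
    (hx : dist o w ≤ dist o x + ε) (hy : dist o w ≤ dist o y + ε) (hz : dist o w ≤ dist o z + ε)
    (m1 : δ + ε < dist (b.G x y (1 / 2)) w) (m2 : δ + ε < dist (b.G x z (1 / 2)) w)
    (m3 : δ + ε < dist (b.G y z (1 / 2)) w) :
    b.W h o x y + b.W h o y z = b.W h o x z := by
  have a1 := b.W_move h (b.cross hxy hx hy m1)
  have a2 := b.W_move h (b.cross hxz hx hz m2)
  have a3 := b.W_move h (b.cross hyz hy hz m3)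
  have a4 := b.W_cone h (w := w) (x := x) (y := y) (z := z) (by
    intro t ht u hu e
    have := b.cone hxy hxz hyz t ht u hu
    rw [e] at this
    rcases this with h | h <;> linarith)
  linear_combination a1 - a2 + a3 + a4

end Bicomb

/-! ### The approximate covering result -/

section Main

variable {X : Type*} [MetricSpace X]

/-- The polar parametrization of a disc of radius `R`. -/
noncomputable def polarMap (R : ℝ) (P : ℝ × ℝ) : ℂ :=
  (R * P.1 : ℂ) * Complex.exp (2 * Real.pi * Complex.I * P.2)

theorem continuous_polarMap (R : ℝ) : Continuous (polarMap R) := by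
  unfold polarMap
  fun_prop

/-- Variation of the logarithm along an edge of the grid. -/
noncomputable def edgeVar (b : Bicomb X) (h : X ≃ₜ ℂ) (R : ℝ) (s : X → X) (P Q : ℝ × ℝ) : ℂ :=
  logVar (fun t => h (b.G (s (h.symm (polarMap R P))) (s (h.symm (polarMap R Q))) t)
    - polarMap R ((1 - t) • P + t • Q))

theorem edgeVar_eq (b : Bicomb X) (h : X ≃ₜ ℂ) (R : ℝ) (s : X → X) (C : Set (ℝ × ℝ))
    (hC : Convex ℝ C)
    (hne : ∀ Q ∈ C, ∀ T ∈ C, ∀ U ∈ C, ∀ t ∈ Icc (0 : ℝ) 1,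
      b.G (s (h.symm (polarMap R Q))) (s (h.symm (polarMap R T))) t ≠ h.symm (polarMap R U))
    {P Q T : ℝ × ℝ} (hP : P ∈ C) (hQ : Q ∈ C) (hT : T ∈ C) :
    b.W h (h.symm (polarMap R P)) (s (h.symm (polarMap R Q))) (s (h.symm (polarMap R T)))
      + logVar (fun u => h (s (h.symm (polarMap R T))) - polarMap R ((1 - u) • P + u • T))
      = logVar (fun u => h (s (h.symm (polarMap R Q))) - polarMap R ((1 - u) • P + u • Q))
      + edgeVar b h R s Q T := by
  have := square_log
    (fun t u => h (b.G (s (h.symm (polarMap R Q))) (s (h.symm (polarMap R T))) t)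
      - polarMap R ((1 - u) • P + u • ((1 - t) • Q + t • T)))
    (by
      have h1 : Continuous (fun p : ℝ × ℝ =>
          b.G (s (h.symm (polarMap R Q))) (s (h.symm (polarMap R T))) p.1) :=
        b.contG continuous_const continuous_const continuous_fst
      have h2 : Continuous (fun p : ℝ × ℝ =>
          ((1 - p.2) • P + p.2 • ((1 - p.1) • Q + p.1 • T))) := by fun_prop
      exact (h.continuous.comp h1).sub ((continuous_polarMap R).comp h2))
    (by
      intro t ht u hu
      have hU : (1 - u) • P + u • ((1 - t) • Q + t • T) ∈ C :=
        hC hP (hC hQ hT (by linarith [ht.2]) ht.1 (by ring)) (by linarith [hu.2]) hu.1 (by ring)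
      refine sub_ne_zero.2 fun e => hne Q hQ T hT _ hU t ht ?_
      rw [← e, h.symm_apply_apply])
  simpa only [b.zero, b.one, sub_zero, sub_self, one_smul, zero_smul, add_zero, zero_add,
    Bicomb.W, edgeVar, h.apply_symm_apply] using this

theorem eps_cover (b : Bicomb X) (h : X ≃ₜ ℂ) {δ ε : ℝ} (hε : 0 < ε) {S : Set X}
    (hS : IsCompact S) (hne : S.Nonempty) (hdiam : ∀ x ∈ S, ∀ y ∈ S, dist x y ≤ 2 * δ) :
    ∃ x ∈ S, ∃ y ∈ S, ∃ z ∈ S, ∀ w ∈ S, dist (b.G x y (1 / 2)) w ≤ δ + ε ∨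
      dist (b.G x z (1 / 2)) w ≤ δ + ε ∨ dist (b.G y z (1 / 2)) w ≤ δ + ε := by
  by_contra! H
  -- farthest points
  have hfar : ∀ o : X, ∃ p ∈ S, ∀ w ∈ S, dist o w ≤ dist o p := by
    intro o
    obtain ⟨p, hp, hmax⟩ := hS.exists_isMaxOn hne
      (f := fun w => dist o w) (by fun_prop)
    exact ⟨p, hp, fun w hw => hmax hw⟩
  choose s hsS hs using hfar
  -- a bound for all the geodesics
  obtain ⟨R₀, hR₀⟩ : ∃ R₀ : ℝ, ∀ x ∈ S, ∀ y ∈ S, ∀ t ∈ Icc (0 : ℝ) 1, ‖h (b.G x y t)‖ ≤ R₀ := by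
    have hK : IsCompact (S ×ˢ S ×ˢ Icc (0 : ℝ) 1) := hS.prod (hS.prod isCompact_Icc)
    obtain ⟨R₀, hR₀⟩ := hK.exists_bound_of_continuousOn
      (f := fun p : X × X × ℝ => h (b.G p.1 p.2.1 p.2.2)) (h.continuous.comp b.cont).continuousOn
    exact ⟨R₀, fun x hx y hy t ht => hR₀ (x, y, t) ⟨hx, hy, ht⟩⟩
  have hR₀nn : 0 ≤ R₀ := by
    obtain ⟨x, hx⟩ := hne
    exact (norm_nonneg _).trans (hR₀ x hx x hx 0 (by simp))
  let R : ℝ := R₀ + 1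
  have hR : R₀ < R := by simp [R]
  have hRpos : 0 < R := by linarith
  let e : ℝ × ℝ → X := fun P => h.symm (polarMap R P)
  have he : Continuous e := h.symm.continuous.comp (continuous_polarMap R)
  -- the mesh
  obtain ⟨ρ, hρ, hunif⟩ : ∃ ρ > 0, ∀ P ∈ Icc (0 : ℝ × ℝ) 1, ∀ Q ∈ Icc (0 : ℝ × ℝ) 1,
      dist P Q < ρ → dist (e P) (e Q) < ε / 2 := by
    have hu := (isCompact_Icc (a := (0 : ℝ × ℝ)) (b := 1)).uniformContinuousOn_of_continuous
      he.continuousOn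
    obtain ⟨ρ, hρ, h1⟩ := Metric.uniformContinuousOn_iff.1 hu (ε / 2) (by positivity)
    exact ⟨ρ, hρ, h1⟩
  obtain ⟨n, hn⟩ := exists_nat_one_div_lt hρ
  let N : ℕ := n + 1
  have hN : (0 : ℝ) < N := by positivity
  have hNρ : 1 / (N : ℝ) < ρ := by simpa [N] using hn
  let p : ℕ → ℕ → ℝ × ℝ := fun i j => ((i : ℝ) / N, (j : ℝ) / N)
  let A : ℝ × ℝ → ℝ × ℝ → ℂ := edgeVar b h R s
  -- cells
  have cell_ne : ∀ C : Set (ℝ × ℝ), (∀ U ∈ C, ∀ V ∈ C, dist (e U) (e V) < ε / 2) →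
      ∀ U ∈ C, ∀ V ∈ C, ∀ w ∈ S, dist (e U) w ≤ dist (e U) (s (e V)) + ε := by
    intro C hC U hU V hV w hw
    have h1 := hC U hU V hV
    have h2 := dist_triangle (e U) (e V) w
    have h3 := dist_triangle (e V) (e U) (s (e V))
    have h4 := hs (e V) w hw
    rw [dist_comm (e V) (e U)] at h3
    linarith
  have tri : ∀ C : Set (ℝ × ℝ), Convex ℝ C → (∀ U ∈ C, ∀ V ∈ C, dist (e U) (e V) < ε / 2) →
      ∀ P ∈ C, ∀ Q ∈ C, ∀ T ∈ C, A P Q + A Q T = A P T := by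
    intro C hCc hC P hP Q hQ T hT
    have hf := cell_ne C hC
    have hne' : ∀ Q ∈ C, ∀ T ∈ C, ∀ U ∈ C, ∀ t ∈ Icc (0 : ℝ) 1,
        b.G (s (e Q)) (s (e T)) t ≠ e U := by
      intro Q hQ T hT U hU t ht
      obtain ⟨w, hw, m1, -, -⟩ := H _ (hsS (e Q)) _ (hsS (e T)) _ (hsS (e T))
      have := b.cross (hdiam _ (hsS (e Q)) _ (hsS (e T))) (hf U hU Q hQ w hw) (hf U hU T hT w hw)
        m1 t ht 0 (by simp)
      rwa [b.zero] at this
    have a1 := edgeVar_eq b h R s C hCc hne' hP hP hQ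
    have a2 := edgeVar_eq b h R s C hCc hne' hP hQ hT
    have a3 := edgeVar_eq b h R s C hCc hne' hP hP hT
    obtain ⟨w, hw, m1, m2, m3⟩ := H _ (hsS (e P)) _ (hsS (e Q)) _ (hsS (e T))
    have a4 := b.W_cocycle h hε (hdiam _ (hsS (e P)) _ (hsS (e Q)))
      (hdiam _ (hsS (e P)) _ (hsS (e T))) (hdiam _ (hsS (e Q)) _ (hsS (e T)))
      (hf P hP P hP w hw) (hf P hP Q hQ w hw) (hf P hP T hT w hw) m1 m2 m3
    simp only [A]
    simp only [e] at a4
    linear_combination a4 - a1 - a2 + a3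
  have sq : ∀ i < N, ∀ j < N,
      A (p i j) (p (i + 1) j) + A (p (i + 1) j) (p (i + 1) (j + 1))
        = A (p i j) (p i (j + 1)) + A (p i (j + 1)) (p (i + 1) (j + 1)) := by
    intro i hi j hj
    have hmono : ∀ k : ℕ, (k : ℝ) / N ≤ ((k + 1 : ℕ) : ℝ) / N := fun k => by
      gcongr; linarith
    have hle1 : ∀ k : ℕ, k < N → ((k + 1 : ℕ) : ℝ) / N ≤ 1 := fun k hk => by
      rw [div_le_one hN]; exact_mod_cast hk
    have hdiff : ∀ k : ℕ, ((k + 1 : ℕ) : ℝ) / N - (k : ℝ) / N = 1 / N := fun k => by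
      push_cast; ring
    have hsub : Icc (p i j) (p (i + 1) (j + 1)) ⊆ Icc (0 : ℝ × ℝ) 1 := by
      apply Icc_subset_Icc
      · exact ⟨by simp only [p, Prod.fst_zero]; positivity,
          by simp only [p, Prod.snd_zero]; positivity⟩
      · exact ⟨hle1 i hi, hle1 j hj⟩
    have hclose : ∀ U ∈ Icc (p i j) (p (i + 1) (j + 1)), ∀ V ∈ Icc (p i j) (p (i + 1) (j + 1)),
        dist (e U) (e V) < ε / 2 := by
      intro U hU V hV
      refine hunif U (hsub hU) V (hsub hV) (lt_of_le_of_lt ?_ hNρ)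
      rw [Prod.dist_eq]
      have d1 := Real.dist_le_of_mem_Icc ⟨hU.1.1, hU.2.1⟩ ⟨hV.1.1, hV.2.1⟩
      have d2 := Real.dist_le_of_mem_Icc ⟨hU.1.2, hU.2.2⟩ ⟨hV.1.2, hV.2.2⟩
      simp only [p, hdiff] at d1 d2
      exact max_le d1 d2
    have hconv : Convex ℝ (Icc (p i j) (p (i + 1) (j + 1))) := convex_Icc _ _
    have q1 : p i j ∈ Icc (p i j) (p (i + 1) (j + 1)) :=
      ⟨le_rfl, ⟨hmono i, hmono j⟩⟩
    have q2 : p (i + 1) j ∈ Icc (p i j) (p (i + 1) (j + 1)) :=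
      ⟨⟨hmono i, le_rfl⟩, ⟨le_rfl, hmono j⟩⟩
    have q3 : p i (j + 1) ∈ Icc (p i j) (p (i + 1) (j + 1)) :=
      ⟨⟨le_rfl, hmono j⟩, ⟨hmono i, le_rfl⟩⟩
    have q4 : p (i + 1) (j + 1) ∈ Icc (p i j) (p (i + 1) (j + 1)) :=
      ⟨⟨hmono i, hmono j⟩, le_rfl⟩
    rw [tri _ hconv hclose _ q1 _ q2 _ q4, tri _ hconv hclose _ q1 _ q3 _ q4]
  -- discrete Stokes
  have rows : ∀ j < N, (∑ i ∈ Finset.range N, A (p i j) (p (i + 1) j))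
      - ∑ i ∈ Finset.range N, A (p i (j + 1)) (p (i + 1) (j + 1))
      = A (p 0 j) (p 0 (j + 1)) - A (p N j) (p N (j + 1)) := by
    intro j hj
    rw [← Finset.sum_sub_distrib, ← Finset.sum_range_sub' (fun i => A (p i j) (p i (j + 1)))]
    refine Finset.sum_congr rfl fun i hi => ?_
    linear_combination sq i (Finset.mem_range.1 hi) j hj
  have stokes : (∑ i ∈ Finset.range N, A (p i 0) (p (i + 1) 0))
      - ∑ i ∈ Finset.range N, A (p i N) (p (i + 1) N)
      = ∑ j ∈ Finset.range N, A (p 0 j) (p 0 (j + 1))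
        - ∑ j ∈ Finset.range N, A (p N j) (p N (j + 1)) := by
    have h1 := Finset.sum_congr (rfl : Finset.range N = Finset.range N)
      fun j hj => rows j (Finset.mem_range.1 hj)
    rw [Finset.sum_range_sub' (fun j => ∑ i ∈ Finset.range N, A (p i j) (p (i + 1) j)),
      Finset.sum_sub_distrib] at h1
    exact h1
  -- the boundary terms
  have hper : ∀ a : ℝ, polarMap R (a, 1) = polarMap R (a, 0) := by
    intro a
    simp only [polarMap]
    simp [Complex.exp_two_pi_mul_I]
  have lr : ∀ i, A (p i 0) (p (i + 1) 0) = A (p i N) (p (i + 1) N) := by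
    intro i
    have e0 : ((0 : ℕ) : ℝ) / N = 0 := by simp
    have e1 : (N : ℝ) / N = 1 := div_self hN.ne'
    simp only [A, edgeVar, p, e0, e1]
    congr 1
    funext t
    rw [hper, hper]
    congr 1
    have k1 : (1 - t) • (((i : ℝ) / N, 0) : ℝ × ℝ) + t • ((((i + 1 : ℕ) : ℝ) / N, 0) : ℝ × ℝ)
      = ((1 - t) * ((i : ℝ) / N) + t * (((i + 1 : ℕ) : ℝ) / N), 0) := by
      ext <;> simp
    have k2 : (1 - t) • (((i : ℝ) / N, 1) : ℝ × ℝ) + t • ((((i + 1 : ℕ) : ℝ) / N, 1) : ℝ × ℝ)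
      = ((1 - t) * ((i : ℝ) / N) + t * (((i + 1 : ℕ) : ℝ) / N), 1) := by
      ext <;> simp
    rw [k1, k2, hper]
  have bottom : ∀ j, A (p 0 j) (p 0 (j + 1)) = 0 := by
    intro j
    have hz : ∀ c : ℝ, polarMap R (0, c) = 0 := fun c => by simp [polarMap]
    have e0 : ((0 : ℕ) : ℝ) / N = 0 := by simp
    refine logVar_const (h (s (h.symm 0)) - 0) ?_ _ ?_
    · obtain ⟨w, hw, m1, -, -⟩ := H _ (hsS (h.symm 0)) _ (hsS (h.symm 0)) _ (hsS (h.symm 0))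
      have hff : dist (h.symm 0) w ≤ dist (h.symm 0) (s (h.symm 0)) + ε := by
        linarith [hs (h.symm 0) w hw]
      have := b.cross (hdiam _ (hsS _) _ (hsS _)) hff hff m1 0 (by simp) 0 (by simp)
      rw [b.zero, b.zero] at this
      exact sub_ne_zero.2 fun e' => this (h.injective (by rw [e', h.apply_symm_apply]))
    · intro t ht
      have k : (1 - t) • p 0 j + t • p 0 (j + 1)
        = (0, (1 - t) * ((j : ℝ) / N) + t * (((j + 1 : ℕ) : ℝ) / N)) := by
        ext <;> simp [p]
      rw [k, hz]
      simp only [p, e0, hz, b.self]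
  let κ : ℕ → ℂ := fun j => logVar (fun u => (1 - (u : ℂ)) * h (s (e (p N j))) - polarMap R (p N j))
  have top : ∀ j, A (p N j) (p N (j + 1)) = κ j - κ (j + 1) + 2 * Real.pi * Complex.I / N := by
    intro j
    have k : ∀ t : ℝ, (1 - t) • p N j + t • p N (j + 1) = (1, ((j : ℝ) + t) / N) := by
      intro t
      have e1 : (N : ℝ) / N = 1 := div_self hN.ne'
      ext
      · simp [p, e1]
      · simp [p]; ring
    have hnorm : ∀ c : ℝ, ‖polarMap R (1, c)‖ = R := by
      intro c
      have : (2 * Real.pi * Complex.I * (c : ℂ)) = ((2 * Real.pi * c : ℝ) : ℂ) * Complex.I := by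
        push_cast; ring
      simp only [polarMap]
      rw [this, norm_mul, Complex.norm_exp_ofReal_mul_I]
      simp [abs_of_pos hRpos]
    have := square_log
      (fun t u => (1 - (u : ℂ)) * h (b.G (s (e (p N j))) (s (e (p N (j + 1)))) t)
        - polarMap R ((1 - t) • p N j + t • p N (j + 1)))
      (by
        have h1 : Continuous (fun q : ℝ × ℝ =>
            b.G (s (e (p N j))) (s (e (p N (j + 1)))) q.1) :=
          b.contG continuous_const continuous_const continuous_fst
        have h2 : Continuous (fun q : ℝ × ℝ => (1 - q.1) • p N j + q.1 • p N (j + 1)) := by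
          fun_prop
        have h3 : Continuous (fun q : ℝ × ℝ => 1 - (q.2 : ℂ)) := by fun_prop
        exact (h3.mul (h.continuous.comp h1)).sub ((continuous_polarMap R).comp h2))
      (by
        intro t ht u hu e0
        have e1 := congrArg norm (sub_eq_zero.1 e0)
        rw [k, hnorm, norm_mul] at e1
        have e2 := hR₀ _ (hsS (e (p N j))) _ (hsS (e (p N (j + 1)))) t ht
        have e3 : ‖1 - (u : ℂ)‖ ≤ 1 := by
          have : (1 - (u : ℂ)) = ((1 - u : ℝ) : ℂ) := by push_cast; ring
          rw [this, Complex.norm_real, Real.norm_eq_abs, abs_le]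
          constructor <;> linarith [hu.1, hu.2]
        have e4 := mul_le_mul e3 e2 (norm_nonneg _) zero_le_one
        linarith)
    have last : logVar (fun t : ℝ => (1 - ((1 : ℝ) : ℂ)) *
        h (b.G (s (e (p N j))) (s (e (p N (j + 1)))) t)
        - polarMap R ((1 - t) • p N j + t • p N (j + 1))) = 2 * Real.pi * Complex.I / N := by
      have hNC : (N : ℂ) ≠ 0 := by exact_mod_cast hN.ne'
      rw [logVar_eq (g := fun t : ℝ => Complex.log (-R) + 2 * Real.pi * Complex.I * ((j + t) / N))]
      · push_cast
        field_simp
        ring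
      · refine ⟨by fun_prop, fun t _ => ?_⟩
        beta_reduce
        rw [k, Complex.exp_add, Complex.exp_log (by simpa using hRpos.ne')]
        simp only [polarMap]
        push_cast
        ring
    simp only [b.zero, b.one, sub_zero, one_smul, zero_smul, add_zero, sub_self, zero_add] at this
    simp only [last] at this
    simp only [Complex.ofReal_zero, sub_zero, one_mul] at this
    have hA : A (p N j) (p N (j + 1)) + κ (j + 1) = κ j + 2 * Real.pi * Complex.I / N := this
    linear_combination hA
  have hκ : κ 0 = κ N := by
    have e0 : ((0 : ℕ) : ℝ) / N = 0 := by simp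
    have e1 : (N : ℝ) / N = 1 := div_self hN.ne'
    simp only [κ, e, p, e0, e1, hper]
  have hlr : (∑ i ∈ Finset.range N, A (p i 0) (p (i + 1) 0))
      = ∑ i ∈ Finset.range N, A (p i N) (p (i + 1) N) := Finset.sum_congr rfl fun i _ => lr i
  rw [hlr, sub_self, Finset.sum_eq_zero (fun j _ => bottom j),
    Finset.sum_congr rfl (fun j _ => top j), Finset.sum_add_distrib,
    Finset.sum_range_sub' κ, hκ, sub_self, Finset.sum_const, Finset.card_range, nsmul_eq_mul,
    mul_div_cancel₀ _ (by exact_mod_cast hN.ne')] at stokes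
  have := Complex.two_pi_I_ne_zero
  apply this
  linear_combination stokes

end Main

theorem exact_cover {X : Type*} [MetricSpace X] (b : Bicomb X) (h : X ≃ₜ ℂ) {δ : ℝ} {S : Set X}
    (hS : IsCompact S) (hne : S.Nonempty) (hdiam : ∀ x ∈ S, ∀ y ∈ S, dist x y ≤ 2 * δ) :
    ∃ m₁ m₂ m₃ : X, ∀ w ∈ S, dist m₁ w ≤ δ ∨ dist m₂ w ≤ δ ∨ dist m₃ w ≤ δ := by
  have key : ∀ n : ℕ, ∃ q : X × X × X, q ∈ S ×ˢ S ×ˢ S ∧ ∀ w ∈ S,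
      min (dist (b.G q.1 q.2.1 (1 / 2)) w) (min (dist (b.G q.1 q.2.2 (1 / 2)) w)
        (dist (b.G q.2.1 q.2.2 (1 / 2)) w)) ≤ δ + 1 / ((n : ℝ) + 1) := by
    intro n
    obtain ⟨x, hx, y, hy, z, hz, H⟩ := eps_cover b h (δ := δ)
      (Nat.one_div_pos_of_nat (α := ℝ) (n := n)) hS hne hdiam
    refine ⟨(x, y, z), ⟨hx, hy, hz⟩, fun w hw => ?_⟩
    simpa only [min_le_iff] using H w hw
  choose q hq hcov using key
  obtain ⟨a, -, φ, hφ, hlim⟩ := (hS.prod (hS.prod hS)).tendsto_subseq hq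
  refine ⟨b.G a.1 a.2.1 (1 / 2), b.G a.1 a.2.2 (1 / 2), b.G a.2.1 a.2.2 (1 / 2), fun w hw => ?_⟩
  have hc : Continuous (fun q : X × X × X =>
      min (dist (b.G q.1 q.2.1 (1 / 2)) w) (min (dist (b.G q.1 q.2.2 (1 / 2)) w)
        (dist (b.G q.2.1 q.2.2 (1 / 2)) w))) := by
    have c1 : Continuous (fun q : X × X × X => b.G q.1 q.2.1 (1 / 2)) :=
      b.contG (by fun_prop) (by fun_prop) continuous_const
    have c2 : Continuous (fun q : X × X × X => b.G q.1 q.2.2 (1 / 2)) :=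
      b.contG (by fun_prop) (by fun_prop) continuous_const
    have c3 : Continuous (fun q : X × X × X => b.G q.2.1 q.2.2 (1 / 2)) :=
      b.contG (by fun_prop) (by fun_prop) continuous_const
    exact (c1.dist continuous_const).min
      ((c2.dist continuous_const).min (c3.dist continuous_const))
  have t1 := (hc.tendsto a).comp hlim
  have t2 : Filter.Tendsto (fun n : ℕ => δ + 1 / ((n : ℝ) + 1)) Filter.atTop (nhds (δ + 0)) :=
    tendsto_const_nhds.add tendsto_one_div_add_atTop_nhds_zero_nat
  have := le_of_tendsto_of_tendsto' t1 (t2.comp hφ.tendsto_atTop) (fun n => hcov (φ n) w hw)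
  simpa only [min_le_iff, add_zero] using this

/-- a compact set of diameter at most `2δ` on a Busemann surface is
covered by 3 closed balls of radius `δ`. -/
theorem covNum_le_three_of_diam_le {X : Type*} [MetricSpace X]
    (hX : IsBusemannSurface X) (δ : ℝ) (hδ : 0 < δ) (S : Set X)
    (hS : IsCompact S) (hdiam : ∀ x ∈ S, ∀ y ∈ S, dist x y ≤ 2 * δ) :
    covNum δ S ≤ 3 := by
  obtain ⟨hB, ⟨h₀⟩⟩ := hX
  obtain ⟨b⟩ := exists_bicomb hB
  have h : X ≃ₜ ℂ := h₀.trans Complex.orthonormalBasisOneI.repr.toHomeomorph.symm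
  rcases S.eq_empty_or_nonempty with rfl | hne
  · refine le_trans (sInf_le ⟨∅, rfl, by simp⟩) (by simp)
  · obtain ⟨m₁, m₂, m₃, H⟩ := exact_cover b h hS hne hdiam
    refine le_trans (sInf_le ⟨{m₁, m₂, m₃}, rfl, fun w hw => ?_⟩) ?_
    · simp only [mem_iUnion, mem_closedBall, mem_insert_iff, mem_singleton_iff, exists_prop,
        exists_eq_or_imp, exists_eq_left]
      simpa only [dist_comm w] using H w hw
    · have h1 := Set.encard_insert_le ({m₂, m₃} : Set X) m₁
      have h2 := Set.encard_insert_le ({m₃} : Set X) m₂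
      rw [Set.encard_singleton] at h2
      calc _ ≤ _ := h1
        _ ≤ (1 + 1) + 1 := by gcongr
        _ = 3 := by norm_num
end
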